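/- If the finite alphabet A ⊆ ℕ (with |A| ≥ 2) satisfies δ_A > 1 − 5/(√369 + 23) = 0.8815..., then the set of denominators arising from A has positive proportion: there exist a constant c > 0 and N₀ such that #D_A(N) ≥ c·N for all N ≥ N₀. -/

import Mathlib

/-- Value of the finite continued fraction `[d₁, d₂, …, d_k] = 1/(d₁ + 1/(d₂ + ⋯ + 1/d_k))`. -/
def cfValue : List ℕ → ℚ
  | [] => 0
  | d :: l => 1 / ((d : ℚ) + cfValue l)

/-- `R_A`: rationals admitting a finite continued fraction expansion with all
partial quotients in the alphabet `A`. -/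
def Rset (A : Finset ℕ) : Set ℚ :=
  {x | ∃ l : List ℕ, l ≠ [] ∧ (∀ d ∈ l, d ∈ A) ∧ cfValue l = x}

/-- `D_A(N)`: denominators `d ≤ N` of fractions `b/d ∈ R_A` with `gcd(b,d) = 1`. -/
def Dset (A : Finset ℕ) (N : ℕ) : Set ℕ :=
  {d | d ≤ N ∧ ∃ b : ℕ, Nat.gcd b d = 1 ∧ ((b : ℚ) / (d : ℚ)) ∈ Rset A}

/-- Iterates of the Gauss map (complete quotients, as remainders): `x₀ = x`,
`x_{n+1} = 1/x_n - ⌊1/x_n⌋`. -/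
noncomputable def gaussIter (x : ℝ) : ℕ → ℝ
  | 0 => x
  | n + 1 => 1 / gaussIter x n - ⌊1 / gaussIter x n⌋₊

/-- `E_A`: irrationals in `(0,1)` whose infinite continued fraction expansion has all
partial quotients `a_{n+1} = ⌊1/x_n⌋` in the alphabet `A`. -/
noncomputable def Eset (A : Finset ℕ) : Set ℝ :=
  {x | x ∈ Set.Ioo (0 : ℝ) 1 ∧ Irrational x ∧ ∀ n : ℕ, ⌊1 / gaussIter x n⌋₊ ∈ A}

namespace Zaremba

/-- The action of the matrix product `∏ !![0, 1; 1, d_j]` of a word on a column vector. -/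
def act (z : ℕ × ℕ) : List ℕ → ℕ × ℕ
  | [] => z
  | a :: l => ((act z l).2, (act z l).1 + a * (act z l).2)

/-- Numerator of the continued fraction of a word. -/
def num (w : List ℕ) : ℕ := (act (0, 1) w).1
/-- Denominator of the continued fraction of a word. -/
def den (w : List ℕ) : ℕ := (act (0, 1) w).2
/-- Numerator of the last-but-one convergent of a word. -/
def num' (w : List ℕ) : ℕ := (act (1, 0) w).1
/-- Denominator of the last-but-one convergent of a word. -/
def den' (w : List ℕ) : ℕ := (act (1, 0) w).2

/-- All letters are positive. -/
def Pos (w : List ℕ) : Prop := ∀ d ∈ w, 0 < d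

@[simp] lemma num_nil : num [] = 0 := rfl
@[simp] lemma den_nil : den [] = 1 := rfl
@[simp] lemma num'_nil : num' [] = 1 := rfl
@[simp] lemma den'_nil : den' [] = 0 := rfl
@[simp] lemma num_cons (a : ℕ) (l : List ℕ) : num (a :: l) = den l := rfl
@[simp] lemma den_cons (a : ℕ) (l : List ℕ) : den (a :: l) = num l + a * den l := rfl
@[simp] lemma num'_cons (a : ℕ) (l : List ℕ) : num' (a :: l) = den' l := rfl
@[simp] lemma den'_cons (a : ℕ) (l : List ℕ) : den' (a :: l) = num' l + a * den' l := rfl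

lemma append_formula (w v : List ℕ) :
    (num (w ++ v) = num' w * num v + num w * den v ∧
      den (w ++ v) = den' w * num v + den w * den v) ∧
    (num' (w ++ v) = num' w * num' v + num w * den' v ∧
      den' (w ++ v) = den' w * num' v + den w * den' v) := by
  induction w with
  | nil => simp
  | cons a l ih =>
    obtain ⟨⟨h1, h2⟩, h3, h4⟩ := ih
    simp only [List.cons_append, num_cons, den_cons, num'_cons, den'_cons, h1, h2, h3, h4]
    refine ⟨⟨trivial, by ring⟩, trivial, by ring⟩

lemma num_append (w v : List ℕ) : num (w ++ v) = num' w * num v + num w * den v :=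
  (append_formula w v).1.1
lemma den_append (w v : List ℕ) : den (w ++ v) = den' w * num v + den w * den v :=
  (append_formula w v).1.2
lemma num'_append (w v : List ℕ) : num' (w ++ v) = num' w * num' v + num w * den' v :=
  (append_formula w v).2.1
lemma den'_append (w v : List ℕ) : den' (w ++ v) = den' w * num' v + den w * den' v :=
  (append_formula w v).2.2

lemma Pos.append {w v : List ℕ} (hw : Pos w) (hv : Pos v) : Pos (w ++ v) := by
  intro d hd
  rcases List.mem_append.1 hd with h | h
  exacts [hw d h, hv d h]

lemma Pos.tail {a : ℕ} {l : List ℕ} (h : Pos (a :: l)) : Pos l :=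
  fun d hd => h d (List.mem_cons_of_mem _ hd)
lemma Pos.head {a : ℕ} {l : List ℕ} (h : Pos (a :: l)) : 0 < a := h a List.mem_cons_self

lemma bounds_aux {w : List ℕ} (h : Pos w) : num w ≤ den w ∧ den' w ≤ den w ∧
    num' w + den' w ≤ num w + den w ∧ 0 < den w := by
  induction w with
  | nil => simp
  | cons a l ih =>
    obtain ⟨h1, h2, h3, h4⟩ := ih h.tail
    have ha := h.head
    obtain ⟨k, rfl⟩ : ∃ k, a = k + 1 := ⟨a - 1, by omega⟩
    simp only [num_cons, den_cons, num'_cons, den'_cons]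
    have := Nat.mul_le_mul_left k h2
    refine ⟨by nlinarith, by nlinarith, by nlinarith, by nlinarith⟩

lemma den_pos {w : List ℕ} (h : Pos w) : 0 < den w := (bounds_aux h).2.2.2
lemma num_le_den {w : List ℕ} (h : Pos w) : num w ≤ den w := (bounds_aux h).1
lemma den'_le_den {w : List ℕ} (h : Pos w) : den' w ≤ den w := (bounds_aux h).2.1
lemma num'_le_den {w : List ℕ} (h : Pos w) : num' w ≤ den w := by
  cases w with
  | nil => simp
  | cons a l =>
    have h1 := den'_le_den h.tail
    have := h.head
    simp only [num'_cons, den_cons]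
    nlinarith

lemma num_pos {w : List ℕ} (h : Pos w) (hw : w ≠ []) : 0 < num w := by
  cases w with
  | nil => exact absurd rfl hw
  | cons a l => exact den_pos h.tail

lemma den_mul_le {w v : List ℕ} : den w * den v ≤ den (w ++ v) := by
  rw [den_append]; omega

lemma den_append_le {w v : List ℕ} (hw : Pos w) (hv : Pos v) :
    den (w ++ v) ≤ 2 * (den w * den v) := by
  rw [den_append, two_mul]
  exact Nat.add_le_add_right (Nat.mul_le_mul (den'_le_den hw) (num_le_den hv)) _

lemma coprime_num_den (w : List ℕ) : Nat.Coprime (num w) (den w) := by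
  induction w with
  | nil => simp
  | cons a l ih =>
    simp only [num_cons, den_cons]
    simpa using ih.symm

lemma det_eq (w : List ℕ) :
    (num' w : ℤ) * den w - num w * den' w = (-1) ^ w.length := by
  induction w with
  | nil => simp
  | cons a l ih =>
    simp only [num'_cons, den_cons, num_cons, den'_cons, List.length_cons, pow_succ, ← ih]
    push_cast
    ring

lemma cfValue_eq {w : List ℕ} (h : Pos w) : cfValue w = (num w : ℚ) / den w := by
  induction w with
  | nil => simp [cfValue]
  | cons a l ih =>
    have h1 : (den l : ℚ) ≠ 0 := by exact_mod_cast (den_pos h.tail).ne'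
    simp only [cfValue, ih h.tail, num_cons, den_cons]
    push_cast
    rw [add_div' _ _ _ h1, one_div_div, add_comm]

lemma word_ext {w v : List ℕ} (hl : w.length = v.length) (hw : Pos w) (hv : Pos v)
    (hn : num w = num v) (hd : den w = den v) : w = v := by
  induction w generalizing v with
  | nil => simpa using hl.symm
  | cons a l ih =>
    cases v with
    | nil => simp at hl
    | cons b m =>
      simp only [List.length_cons, add_left_inj] at hl
      simp only [num_cons, den_cons] at hn hd
      have hl0 := den_pos hw.tail
      have hab : a = b ∧ num l = num m := by
        by_cases hne : l = []
        · subst hne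
          have : m = [] := by simpa using hl.symm
          subst this
          simpa using hd
        · have hmne : m ≠ [] := by rintro rfl; simp at hl; exact hne hl
          have h1 := num_pos hw.tail hne
          have h2 := num_le_den hw.tail
          have h3 := num_pos hv.tail hmne
          have h4 := num_le_den hv.tail
          rw [← hn] at hd h4
          have : a = b := by
            rcases lt_trichotomy a b with h | h | h
            · have := Nat.mul_le_mul_right (den l) (Nat.succ_le_of_lt h)
              rw [Nat.succ_mul] at this
              omega
            · exact h
            · have := Nat.mul_le_mul_right (den l) (Nat.succ_le_of_lt h)
              rw [Nat.succ_mul] at this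
              omega
          subst this
          exact ⟨rfl, by omega⟩
      rw [hab.1, ih hl hw.tail hv.tail hab.2 hn]

lemma reverse_formula (w : List ℕ) : num' w.reverse = num' w ∧ num w.reverse = den' w ∧
    den' w.reverse = num w ∧ den w.reverse = den w := by
  induction w with
  | nil => simp
  | cons a l ih =>
    obtain ⟨h1, h2, h3, h4⟩ := ih
    simp only [List.reverse_cons, num'_append, num_append, den'_append, den_append, h1, h2, h3, h4,
      num'_cons, num_cons, den'_cons, den_cons, num'_nil, num_nil, den'_nil, den_nil]
    refine ⟨by ring, by ring, by ring, by ring⟩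

lemma Pos.reverse {w : List ℕ} (h : Pos w) : Pos w.reverse :=
  fun d hd => h d (List.mem_reverse.1 hd)

lemma word_ext' {w v : List ℕ} (hl : w.length = v.length) (hw : Pos w) (hv : Pos v)
    (hn : den' w = den' v) (hd : den w = den v) : w = v := by
  have := word_ext (w := w.reverse) (v := v.reverse) (by simpa using hl) hw.reverse hv.reverse
    (by rw [(reverse_formula w).2.1, (reverse_formula v).2.1, hn])
    (by rw [(reverse_formula w).2.2.2, (reverse_formula v).2.2.2, hd])
  exact List.reverse_injective this

lemma two_pow_le_den {w : List ℕ} (h : Pos w) : 2 ^ (w.length / 2) ≤ den w := by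
  match w with
  | [] => simp
  | [a] => simpa using Nat.succ_le_of_lt h.head
  | a :: b :: l =>
    have ih := two_pow_le_den h.tail.tail
    have ha := h.head
    have hb := h.tail.head
    have : (a :: b :: l).length / 2 = l.length / 2 + 1 := by simp; omega
    rw [this, pow_succ]
    simp only [den_cons, num_cons]
    have h1 : den l ≤ b * den l := Nat.le_mul_of_pos_left _ hb
    have h2 : num l + b * den l ≤ a * (num l + b * den l) := Nat.le_mul_of_pos_left _ ha
    omega

/-- The determinant of the column vectors of two words. -/
def det (v v' : List ℕ) : ℤ := (num v : ℤ) * den v' - num v' * den v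

lemma det_append_left (f r : List ℕ) :
    det (f ++ r) f = (-1) ^ f.length * num r := by
  rw [det, num_append, den_append, ← det_eq]
  push_cast
  ring

/-- A finite set of words with positive letters, all of the same length. -/
structure Unif (S : Finset (List ℕ)) : Prop where
  pos : ∀ w ∈ S, Pos w
  len : ∀ w ∈ S, ∀ v ∈ S, w.length = v.length

lemma Unif.mono {S T : Finset (List ℕ)} (h : Unif T) (hST : S ⊆ T) : Unif S :=
  ⟨fun w hw => h.pos w (hST hw), fun w hw v hv => h.len w (hST hw) v (hST hv)⟩

lemma card_le_of_dist_le (S : Finset ℤ) (n : ℕ) (h : ∀ r ∈ S, ∀ r' ∈ S, |r - r'| ≤ n) :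
    S.card ≤ n + 1 := by
  rcases S.eq_empty_or_nonempty with rfl | hne
  · simp
  have hsub : S ⊆ Finset.Icc (S.min' hne) (S.min' hne + n) := by
    intro r hr
    have h1 := S.min'_le r hr
    have h2 := abs_le.1 (h r hr _ (S.min'_mem hne))
    rw [Finset.mem_Icc]
    constructor <;> linarith
  calc S.card ≤ _ := Finset.card_le_card hsub
    _ = n + 1 := by rw [Int.card_Icc]; omega

lemma card_det_fiber {S : Finset (List ℕ)} (hS : Unif S) {v : List ℕ} (hv : Pos v) (c : ℕ) (D : ℤ)
    (h : ∀ v' ∈ S, det v v' = D ∧ den v' ≤ c * den v) : S.card ≤ c + 1 := by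
  have hd := den_pos hv
  rw [← Finset.card_range (c + 1)]
  refine Finset.card_le_card_of_injOn (fun v' => den v' / den v) ?_ ?_
  · intro v' hv'
    have h2 := (h v' hv').2
    have : den v' / den v ≤ c := by
      rw [mul_comm] at h2
      exact (Nat.div_le_div_right h2).trans (by rw [Nat.mul_div_cancel_left _ hd])
    simpa using Nat.lt_succ_of_le this
  · intro v1 h1 v2 h2 heq
    simp only at heq
    have e1 := (h v1 h1).1
    have e2 := (h v2 h2).1
    simp only [det] at e1 e2
    have e3 : (num v : ℤ) * ((den v1 : ℤ) - den v2) = den v * ((num v1 : ℤ) - num v2) := by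
      linarith
    have hdvd : (den v : ℤ) ∣ (den v1 : ℤ) - den v2 := by
      have hc : IsCoprime (den v : ℤ) (num v : ℤ) :=
        (Nat.isCoprime_iff_coprime.2 (coprime_num_den v)).symm
      exact hc.dvd_of_dvd_mul_left ⟨_, e3⟩
    have hmod : den v1 = den v2 := by
      have h3 : den v1 ≡ den v2 [MOD den v] := by
        have := (Int.modEq_iff_dvd.2 hdvd).symm
        exact (Int.natCast_modEq_iff.1 this)
      have h4 := Nat.div_add_mod (den v1) (den v)
      have h5 := Nat.div_add_mod (den v2) (den v)
      rw [heq, show den v1 % den v = den v2 % den v from h3] at h4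
      omega
    have hnum : num v1 = num v2 := by
      have hd' : (den v : ℤ) ≠ 0 := by exact_mod_cast hd.ne'
      rw [hmod, sub_self, mul_zero] at e3
      have := (mul_eq_zero.1 e3.symm).resolve_left hd'
      omega
    exact word_ext (hS.len _ h1 _ h2) (hS.pos _ h1) (hS.pos _ h2) hnum hmod

lemma card_le_of_det_mem {S : Finset (List ℕ)} (hS : Unif S) {v : List ℕ} (hv : Pos v) (c : ℕ)
    (T : Finset ℤ) (h : ∀ v' ∈ S, det v v' ∈ T ∧ den v' ≤ c * den v) :
    S.card ≤ (c + 1) * T.card := by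
  refine Finset.card_le_mul_card_image_of_maps_to (f := det v) (fun v' hv' => (h v' hv').1) _ ?_
  intro D _
  refine card_det_fiber (hS.mono (Finset.filter_subset _ _)) hv c D ?_
  intro v' hv'
  rw [Finset.mem_filter] at hv'
  exact ⟨hv'.2, (h v' hv'.1).2⟩

lemma abs_det_le {v v' : List ℕ} (hv : Pos v) (hv' : Pos v') :
    |det v v'| ≤ (den v : ℤ) * den v' := by
  have h1 : (num v : ℤ) ≤ den v := by exact_mod_cast num_le_den hv
  have h2 : (num v' : ℤ) ≤ den v' := by exact_mod_cast num_le_den hv'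
  have h3 : (0 : ℤ) ≤ num v := by positivity
  have h4 : (0 : ℤ) ≤ num v' := by positivity
  rw [det, abs_le]
  constructor <;> nlinarith

lemma card_Icc_symm (n : ℕ) : (Finset.Icc (-(n : ℤ)) n).card = 2 * n + 1 := by
  rw [Int.card_Icc]; omega

/-- Words of a block whose extension to the left is proportional modulo `q` to a fixed vector. -/
lemma card_le_of_dvd_det {M : Finset (List ℕ)} (hM : Unif M) (c Y q : ℕ) (hq : 0 < q)
    (g z : List ℕ) (hY : ∀ m ∈ M, den m ≤ Y) (hc : ∀ m ∈ M, ∀ m' ∈ M, den m' ≤ c * den m)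
    (h : ∀ m ∈ M, (q : ℤ) ∣ det (g ++ m) z) :
    M.card ≤ (c + 1) * (2 * (Y ^ 2 / q) + 1) := by
  rcases M.eq_empty_or_nonempty with rfl | ⟨m0, hm0⟩
  · simp
  refine (card_le_of_det_mem hM (hM.pos m0 hm0) c
    ((Finset.Icc (-((Y ^ 2 / q : ℕ) : ℤ)) (Y ^ 2 / q : ℕ)).image (fun k => (q : ℤ) * k)) ?_).trans
    (Nat.mul_le_mul_left _ (Finset.card_image_le.trans (card_Icc_symm _).le))
  intro m hm
  refine ⟨?_, hc _ hm0 _ hm⟩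
  have h0 := h m0 hm0
  have h1 := h m hm
  set α : ℤ := (num' g : ℤ) * den z - num z * den' g with hα
  set β : ℤ := (num g : ℤ) * den z - num z * den g with hβ
  have hform : ∀ m, det (g ++ m) z = α * num m + β * den m := by
    intro m
    rw [det, num_append, den_append, hα, hβ]
    push_cast
    ring
  rw [hform] at h0 h1
  have hcop : IsCoprime α β := by
    obtain ⟨a, b, hab⟩ := Nat.isCoprime_iff_coprime.2 (coprime_num_den z)
    have hdet := det_eq g
    have hs : ((-1 : ℤ) ^ g.length) * (-1) ^ g.length = 1 := by
      rw [← mul_pow]; simp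
    have e1 : (den g : ℤ) * α - den' g * β = (-1) ^ g.length * den z := by
      rw [← hdet, hα, hβ]; ring
    have e2 : (num g : ℤ) * α - num' g * β = (-1) ^ g.length * num z := by
      rw [← hdet, hα, hβ]; ring
    refine ⟨(-1) ^ g.length * (a * num g + b * den g),
      -((-1) ^ g.length * (a * num' g + b * den' g)), ?_⟩
    linear_combination (-1) ^ g.length * (a * e2 + b * e1) +
      ((-1) ^ g.length * (-1) ^ g.length) * hab + hs
  have hdvd : (q : ℤ) ∣ det m0 m := by
    obtain ⟨a, b, hab⟩ := hcop
    have e1 : det m0 m * α = den m * (α * num m0 + β * den m0) -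
        den m0 * (α * num m + β * den m) := by
      rw [det]; ring
    have e2 : det m0 m * β = num m0 * (α * num m + β * den m) -
        num m * (α * num m0 + β * den m0) := by
      rw [det]; ring
    have e3 : det m0 m = a * (det m0 m * α) + b * (det m0 m * β) := by
      linear_combination (- det m0 m) * hab
    rw [e3, e1, e2]
    exact dvd_add (Dvd.dvd.mul_left (dvd_sub (h0.mul_left _) (h1.mul_left _)) _)
      (Dvd.dvd.mul_left (dvd_sub (h1.mul_left _) (h0.mul_left _)) _)
  obtain ⟨k, hk⟩ := hdvd
  rw [hk]
  refine Finset.mem_image_of_mem _ ?_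
  have habs : |det m0 m| ≤ (Y : ℤ) ^ 2 := by
    refine (abs_det_le (hM.pos _ hm0) (hM.pos _ hm)).trans ?_
    rw [sq]
    exact_mod_cast Nat.mul_le_mul (hY _ hm0) (hY _ hm)
  rw [hk, abs_mul, Nat.abs_cast] at habs
  have : |k| ≤ ((Y ^ 2 / q : ℕ) : ℤ) := by
    push_cast
    rw [Int.le_ediv_iff_mul_le (by exact_mod_cast hq), mul_comm]
    exact habs
  rw [Finset.mem_Icc]
  exact abs_le.1 this

lemma abs_num_div_sub {f r : List ℕ} (hf : Pos f) (hr : Pos r) :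
    |(num (f ++ r) : ℝ) / den (f ++ r) - num f / den f| ≤ 1 / (den f : ℝ) ^ 2 := by
  have h1 : (0 : ℝ) < den f := by exact_mod_cast den_pos hf
  have h2 : (0 : ℝ) < den (f ++ r) := by exact_mod_cast den_pos (hf.append hr)
  have h3 : (num r : ℝ) ≤ den r := by exact_mod_cast num_le_den hr
  have h4 : (den f : ℝ) * den r ≤ den (f ++ r) := by exact_mod_cast den_mul_le
  have h5 := det_append_left f r
  have h6 : |(num (f ++ r) : ℝ) * den f - num f * den (f ++ r)| = num r := by
    have : ((num (f ++ r) : ℝ) * den f - num f * den (f ++ r)) = ((det (f ++ r) f : ℤ) : ℝ) := by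
      simp [det]
    rw [this, h5]
    simp [abs_mul]
  rw [div_sub_div _ _ h2.ne' h1.ne', abs_div, mul_comm (den (f ++ r) : ℝ) (num f), h6,
    abs_of_pos (by positivity), div_le_div_iff₀ (by positivity) (by positivity)]
  nlinarith [mul_pos h1 h1]

/-- Words of a block whose extension has nearly a prescribed direction. -/
lemma card_le_of_abs_det_le {B : Finset (List ℕ)} (hB : Unif B) (c Y K κ : ℕ) (hK : 0 < K)
    (hY : ∀ m ∈ B, den m ≤ Y) (hc : ∀ m ∈ B, ∀ m' ∈ B, den m' ≤ c * den m)
    (f r r' : List ℕ) (hf : f ∈ B) (hr : Pos r) (hr' : Pos r')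
    (S : Finset (List ℕ)) (hSB : S ⊆ B)
    (h : ∀ f' ∈ S, |det (f ++ r) (f' ++ r')| * K ≤ κ * (den (f ++ r) * den (f' ++ r') : ℤ)) :
    S.card ≤ (c + 1) * (2 * (κ * Y ^ 2 / K + 2 * c) + 1) := by
  refine (card_le_of_det_mem (hB.mono hSB) (hB.pos f hf) c
    (Finset.Icc (-((κ * Y ^ 2 / K + 2 * c : ℕ) : ℤ)) (κ * Y ^ 2 / K + 2 * c : ℕ)) ?_).trans
    (Nat.mul_le_mul_left _ (card_Icc_symm _).le)
  intro f' hf'S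
  have hf' := hSB hf'S
  refine ⟨?_, hc _ hf _ hf'⟩
  have hp := hB.pos f hf
  have hp' := hB.pos f' hf'
  have q0 : (0 : ℝ) < den f := by exact_mod_cast den_pos hp
  have q0' : (0 : ℝ) < den f' := by exact_mod_cast den_pos hp'
  have y0 : (0 : ℝ) < den (f ++ r) := by exact_mod_cast den_pos (hp.append hr)
  have y0' : (0 : ℝ) < den (f' ++ r') := by exact_mod_cast den_pos (hp'.append hr')
  have k0 : (0 : ℝ) < K := by exact_mod_cast hK
  have h1 := abs_num_div_sub hp hr
  have h2 := abs_num_div_sub hp' hr'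
  have h3 : |(num (f ++ r) : ℝ) / den (f ++ r) - num (f' ++ r') / den (f' ++ r')| ≤ κ / K := by
    have h := h f' hf'S
    have hR : |(num (f ++ r) : ℝ) * den (f' ++ r') - num (f' ++ r') * den (f ++ r)| * K ≤
        κ * (den (f ++ r) * den (f' ++ r')) := by
      have h' : ((|det (f ++ r) (f' ++ r')| * K : ℤ) : ℝ) ≤
        ((κ * (den (f ++ r) * den (f' ++ r') : ℤ) : ℤ) : ℝ) := by exact_mod_cast h
      simpa [det] using h'
    rw [div_sub_div _ _ y0.ne' y0'.ne', abs_div, mul_comm (den (f ++ r) : ℝ) (num (f' ++ r')),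
      abs_of_pos (a := (den (f ++ r) : ℝ) * _) (by positivity),
      div_le_div_iff₀ (by positivity) (by positivity)]
    exact hR
  have h4 : |(num f : ℝ) / den f - num f' / den f'| ≤ κ / K + 1 / (den f : ℝ) ^ 2 +
      1 / (den f' : ℝ) ^ 2 := by
    rw [abs_le] at *
    constructor <;> linarith [h1.1, h1.2, h2.1, h2.2, h3.1, h3.2]
  have h5 : |((det f f' : ℤ) : ℝ)| ≤ κ * (Y : ℝ) ^ 2 / K + 2 * c := by
    have e : ((det f f' : ℤ) : ℝ) = ((num f : ℝ) / den f - num f' / den f') * (den f * den f') := by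
      rw [det]; push_cast; field_simp
    rw [e, abs_mul, abs_of_pos (a := (den f : ℝ) * den f') (by positivity)]
    have hY1 : (den f : ℝ) ≤ Y := by exact_mod_cast hY _ hf
    have hY2 : (den f' : ℝ) ≤ Y := by exact_mod_cast hY _ hf'
    have hc1 : (den f : ℝ) ≤ c * den f' := by exact_mod_cast hc _ hf' _ hf
    have hc2 : (den f' : ℝ) ≤ c * den f := by exact_mod_cast hc _ hf _ hf'
    calc _ ≤ (κ / K + 1 / (den f : ℝ) ^ 2 + 1 / (den f' : ℝ) ^ 2) * (den f * den f') := by gcongr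
      _ = κ * (den f * den f') / K + den f' / den f + den f / den f' := by field_simp
      _ ≤ κ * (Y * Y) / K + c + c := by
        gcongr
        · rwa [div_le_iff₀ q0]
        · rwa [div_le_iff₀ q0']
      _ = _ := by ring
  have h6 : |det f f'| ≤ ((κ * Y ^ 2 / K + 2 * c : ℕ) : ℤ) := by
    have h7 : (|det f f'| : ℤ) * K ≤ κ * Y ^ 2 + 2 * c * K := by
      have : ((|det f f'| : ℤ) : ℝ) * K ≤ κ * Y ^ 2 + 2 * c * K := by
        push_cast
        calc _ ≤ (κ * (Y : ℝ) ^ 2 / K + 2 * c) * K := by gcongr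
          _ = _ := by field_simp
      exact_mod_cast this
    rw [← Nat.add_mul_div_right _ _ hK]
    push_cast
    rw [Int.le_ediv_iff_mul_le (by exact_mod_cast hK)]
    exact h7
  rw [Finset.mem_Icc]
  exact abs_le.1 h6

/-- Integers `D` in a symmetric interval with `t D` close to a multiple of `L`. -/
lemma card_close_multiples (L q Dm m0 : ℕ) (t a e : ℤ) (hL : 0 < L) (hq : 0 < q)
    (hcop : IsCoprime a (q : ℤ)) (he : (q : ℤ) * t = a * L + e) (heq : |e| * q ≤ L)
    (T : Finset ℤ) (hT : ∀ D ∈ T, |D| ≤ Dm ∧ ∃ m l : ℤ, t * D = m + l * L ∧ |m| ≤ m0) :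
    T.card ≤ (2 * (q * m0 / L) + 3) * (2 * (Dm / q) + 2) := by
  have hq' : (0 : ℤ) < q := by exact_mod_cast hq
  have hL' : (0 : ℤ) < L := by exact_mod_cast hL
  have hblocks : (Finset.Icc (-((Dm / q : ℕ) : ℤ) - 1) (Dm / q : ℕ)).card = 2 * (Dm / q) + 2 := by
    rw [Int.card_Icc]; omega
  rw [← hblocks]
  refine Finset.card_le_mul_card_image_of_maps_to (f := fun D => D / (q : ℤ)) ?_ _ ?_
  · intro D hD
    have h1 := abs_le.1 (hT D hD).1
    rw [Finset.mem_Icc]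
    constructor
    · rw [Int.le_ediv_iff_mul_le hq']
      have h2 := Nat.div_add_mod Dm q
      have h3 := Nat.mod_lt Dm hq
      have h4 : (Dm : ℤ) = q * (Dm / q : ℕ) + (Dm % q : ℕ) := by exact_mod_cast h2.symm
      have h5 : ((Dm % q : ℕ) : ℤ) < q := by exact_mod_cast h3
      nlinarith [h1.1]
    · push_cast
      exact Int.ediv_le_ediv hq' h1.2
  · intro k _
    have hex : ∀ D ∈ T, ∃ l : ℤ, |t * D - l * L| ≤ m0 := by
      intro D hD
      obtain ⟨_, m, l, h1, h2⟩ := hT D hD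
      exact ⟨l, by rw [h1]; simpa using h2⟩
    choose! l hl using hex
    set F := T.filter (fun D => D / (q : ℤ) = k) with hF
    set ρ : ℤ → ℤ := fun D => a * D - q * l D with hρ
    have hinj : Set.InjOn ρ F := by
      intro D hD D' hD' heq
      rw [Finset.mem_coe, hF, Finset.mem_filter] at hD hD'
      simp only [hρ] at heq
      have h1 : (q : ℤ) ∣ a * (D - D') := ⟨l D - l D', by linear_combination heq⟩
      have h2 : (q : ℤ) ∣ D - D' := hcop.symm.dvd_of_dvd_mul_left h1
      have h3 : D % q = D' % q := (Int.modEq_iff_dvd.2 h2).symm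
      have h4 := Int.mul_ediv_add_emod D q
      have h5 := Int.mul_ediv_add_emod D' q
      rw [hD.2, h3] at h4
      rw [hD'.2] at h5
      linarith
    rw [← Finset.card_image_of_injOn hinj]
    refine card_le_of_dist_le _ (2 * (q * m0 / L) + 2) ?_
    intro r hr r' hr'
    obtain ⟨D, hD, rfl⟩ := Finset.mem_image.1 hr
    obtain ⟨D', hD', rfl⟩ := Finset.mem_image.1 hr'
    rw [hF, Finset.mem_filter] at hD hD'
    have h1 := hl D hD.1
    have h2 := hl D' hD'.1
    have hDD : |D - D'| ≤ q := by
      have h4 := Int.mul_ediv_add_emod D q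
      have h5 := Int.mul_ediv_add_emod D' q
      rw [hD.2] at h4
      rw [hD'.2] at h5
      have h6 := Int.emod_nonneg D hq'.ne'
      have h7 := Int.emod_nonneg D' hq'.ne'
      have h8 := Int.emod_lt_of_pos D hq'
      have h9 := Int.emod_lt_of_pos D' hq'
      rw [abs_le]
      constructor <;> linarith
    have h3 : (L : ℤ) * (ρ D - ρ D') = q * ((t * D - l D * L) - (t * D' - l D' * L)) -
        e * (D - D') := by
      simp only [hρ]
      linear_combination (-(D - D')) * he
    have h4 : |e * (D - D')| ≤ L := by
      rw [abs_mul]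
      exact (mul_le_mul_of_nonneg_left hDD (abs_nonneg e)).trans heq
    have h5 : (L : ℤ) * |ρ D - ρ D'| ≤ 2 * (q * m0) + L := by
      have h6 : (L : ℤ) * |ρ D - ρ D'| = |(L : ℤ) * (ρ D - ρ D')| := by
        rw [abs_mul, Nat.abs_cast]
      rw [h6, h3]
      have h7 : |(q : ℤ) * ((t * D - l D * L) - (t * D' - l D' * L))| ≤ q * (2 * m0) := by
        rw [abs_mul, Nat.abs_cast]
        refine mul_le_mul_of_nonneg_left ?_ hq'.le
        exact (abs_sub _ _).trans (by linarith)
      refine (abs_sub _ _).trans ?_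
      linarith
    have h6 : |ρ D - ρ D'| < 2 * ((q * m0 / L : ℕ) : ℤ) + 3 := by
      have h7 := Nat.div_add_mod (q * m0) L
      have h8 := Nat.mod_lt (q * m0) hL
      have h9 : (q * m0 : ℤ) = L * ((q * m0 / L : ℕ) : ℤ) + ((q * m0 % L : ℕ) : ℤ) := by
        exact_mod_cast h7.symm
      have h10 : ((q * m0 % L : ℕ) : ℤ) < L := by exact_mod_cast h8
      rw [← mul_lt_mul_iff_right₀ hL']
      nlinarith
    push_cast at h6 ⊢
    linarith

section Fourier

variable {L : ℕ}

lemma normSq_sum_eq [NeZero L] {ι : Type*} (I : Finset ι) (c : ι → ℂ) (x : ι → ZMod L) :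
    ((‖∑ i ∈ I, c i * ZMod.stdAddChar (x i)‖ ^ 2 : ℝ) : ℂ) =
      ∑ i ∈ I, ∑ k ∈ I, c i * (starRingEnd ℂ) (c k) * ZMod.stdAddChar (x i - x k) := by
  push_cast
  rw [← Complex.mul_conj', map_sum, Finset.sum_mul_sum]
  refine Finset.sum_congr rfl fun i _ => Finset.sum_congr rfl fun k _ => ?_
  rw [map_mul, ← AddChar.map_neg_eq_conj, sub_eq_add_neg, AddChar.map_add_eq_mul]
  ring

lemma sum_stdAddChar_mul [NeZero L] (b : ZMod L) :
    ∑ t : ZMod L, ZMod.stdAddChar (t * b) = if b = 0 then (L : ℂ) else 0 := by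
  have := AddChar.sum_mulShift (R' := ℂ) b (ZMod.isPrimitive_stdAddChar L)
  rw [this, ZMod.card]
  split_ifs <;> simp

/-- If the exponential sum over `Ω` has small second moment, then `d` takes many values. -/
lemma mul_card_sq_le [NeZero L] {ι : Type*} (Ω : Finset ι) (d : ι → ℕ) (hd : ∀ γ ∈ Ω, d γ < L) :
    (L : ℝ) * (Ω.card : ℝ) ^ 2 ≤ (Ω.image d).card *
      ∑ t : ZMod L, ‖∑ γ ∈ Ω, (ZMod.stdAddChar (t * (d γ : ZMod L)) : ℂ)‖ ^ 2 := by
  have h1 : ∑ t : ZMod L, ‖∑ γ ∈ Ω, (ZMod.stdAddChar (t * (d γ : ZMod L)) : ℂ)‖ ^ 2 =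
      L * ∑ γ ∈ Ω, ∑ γ' ∈ Ω, if d γ = d γ' then (1 : ℝ) else 0 := by
    have h2 : ∀ t : ZMod L, ((‖∑ γ ∈ Ω, (ZMod.stdAddChar (t * (d γ : ZMod L)) : ℂ)‖ ^ 2 : ℝ) : ℂ) =
        ∑ γ ∈ Ω, ∑ γ' ∈ Ω, ZMod.stdAddChar (t * ((d γ : ZMod L) - (d γ' : ZMod L))) := by
      intro t
      have := normSq_sum_eq Ω (fun _ => 1) (fun γ => t * (d γ : ZMod L))
      simpa [mul_sub] using this
    apply Complex.ofReal_injective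
    rw [Complex.ofReal_sum, Finset.sum_congr rfl fun t _ => h2 t, Finset.sum_comm]
    rw [Complex.ofReal_mul, Complex.ofReal_sum, Finset.mul_sum]
    refine Finset.sum_congr rfl fun γ hγ => ?_
    rw [Finset.sum_comm, Complex.ofReal_sum, Finset.mul_sum]
    refine Finset.sum_congr rfl fun γ' hγ' => ?_
    rw [sum_stdAddChar_mul]
    have : (d γ : ZMod L) - (d γ' : ZMod L) = 0 ↔ d γ = d γ' := by
      rw [sub_eq_zero, ZMod.natCast_eq_natCast_iff]
      exact ⟨fun h => Nat.ModEq.eq_of_lt_of_lt h (hd γ hγ) (hd γ' hγ'), fun h => h ▸ rfl⟩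
    simp only [this]
    split_ifs <;> simp
  have h3 : (Ω.card : ℝ) ^ 2 ≤ (Ω.image d).card *
      ∑ γ ∈ Ω, ∑ γ' ∈ Ω, if d γ = d γ' then (1 : ℝ) else 0 := by
    have e1 : (Ω.card : ℝ) = ∑ b ∈ Ω.image d, ((Ω.filter (fun γ => d γ = b)).card : ℝ) := by
      exact_mod_cast Finset.card_eq_sum_card_image d Ω
    have e2 : ∑ γ ∈ Ω, ∑ γ' ∈ Ω, (if d γ = d γ' then (1 : ℝ) else 0) =
        ∑ b ∈ Ω.image d, ((Ω.filter (fun γ => d γ = b)).card : ℝ) ^ 2 := by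
      rw [← Finset.sum_fiberwise_of_maps_to (t := Ω.image d) (g := d)
        (fun γ hγ => Finset.mem_image_of_mem d hγ)]
      refine Finset.sum_congr rfl fun b _ => ?_
      have : ∀ γ ∈ Ω.filter (fun γ => d γ = b), ∑ γ' ∈ Ω, (if d γ = d γ' then (1 : ℝ) else 0) =
          ((Ω.filter (fun γ => d γ = b)).card : ℝ) := by
        intro γ hγ
        rw [(Finset.mem_filter.1 hγ).2, Finset.sum_boole]
        simp only [eq_comm]
      rw [Finset.sum_congr rfl this, Finset.sum_const, nsmul_eq_mul, sq]
    rw [e2, e1]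
    exact sq_sum_le_card_mul_sum_sq
  rw [h1]
  have : (0 : ℝ) ≤ L := by positivity
  calc (L : ℝ) * (Ω.card : ℝ) ^ 2 ≤ L * _ := mul_le_mul_of_nonneg_left h3 this
    _ = _ := by ring

lemma sum_normSq_le [NeZero L] {ι : Type*} (I : Finset ι) (c : ι → ℂ) (x y : ι → ZMod L) :
    ∑ p : ZMod L × ZMod L, ‖∑ i ∈ I, c i * ZMod.stdAddChar (p.1 * x i + p.2 * y i)‖ ^ 2 ≤
      (L : ℝ) ^ 2 * ∑ i ∈ I, ∑ k ∈ I,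
        if x i = x k ∧ y i = y k then ‖c i‖ * ‖c k‖ else 0 := by
  have h1 : ((∑ p : ZMod L × ZMod L,
      ‖∑ i ∈ I, c i * ZMod.stdAddChar (p.1 * x i + p.2 * y i)‖ ^ 2 : ℝ) : ℂ) =
      (L : ℂ) ^ 2 * ∑ i ∈ I, ∑ k ∈ I,
        if x i = x k ∧ y i = y k then c i * (starRingEnd ℂ) (c k) else 0 := by
    rw [Complex.ofReal_sum, Finset.sum_congr rfl fun p _ => normSq_sum_eq I c _,
      Finset.sum_comm, Finset.mul_sum]
    refine Finset.sum_congr rfl fun i _ => ?_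
    rw [Finset.sum_comm, Finset.mul_sum]
    refine Finset.sum_congr rfl fun k _ => ?_
    rw [← Finset.mul_sum, Fintype.sum_prod_type]
    have : ∀ a b : ZMod L, (ZMod.stdAddChar (a * x i + b * y i - (a * x k + b * y k)) : ℂ) =
        ZMod.stdAddChar (a * (x i - x k)) * ZMod.stdAddChar (b * (y i - y k)) := by
      intro a b
      rw [← AddChar.map_add_eq_mul]
      congr 1
      ring
    simp only [this]
    rw [← Finset.sum_mul_sum, sum_stdAddChar_mul, sum_stdAddChar_mul]
    simp only [sub_eq_zero]
    by_cases h : x i = x k <;> by_cases h' : y i = y k <;> simp [h, h']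
    ring
  have h2 := congrArg norm h1
  rw [Complex.norm_real, Real.norm_of_nonneg (by positivity), norm_mul, norm_pow,
    Complex.norm_natCast] at h2
  rw [h2]
  refine mul_le_mul_of_nonneg_left ?_ (by positivity)
  refine (norm_sum_le _ _).trans (Finset.sum_le_sum fun i _ => (norm_sum_le _ _).trans
    (Finset.sum_le_sum fun k _ => ?_))
  split_ifs <;> simp

lemma half_le_norm_kernel [NeZero L] {D R u : ℕ} (h : 6 * D * R ≤ L) (hu : u ≤ R) :
    (D : ℝ) / 2 ≤ ‖∑ n ∈ Finset.range D, (ZMod.stdAddChar ((u : ZMod L) * (n : ZMod L)) : ℂ)‖ := by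
  refine le_trans ?_ (Complex.re_le_norm _)
  rw [Complex.re_sum]
  have : ∀ n ∈ Finset.range D, (1 : ℝ) / 2 ≤
      ((ZMod.stdAddChar ((u : ZMod L) * (n : ZMod L)) : ℂ)).re := by
    intro n hn
    have hL : (0 : ℝ) < L := by exact_mod_cast Nat.pos_of_neZero L
    have h1 : ((u : ZMod L) * (n : ZMod L)) = ((u * n : ℤ) : ZMod L) := by push_cast; rfl
    rw [h1, ZMod.stdAddChar_coe]
    have h2 : (2 * Real.pi * Complex.I * ((u * n : ℤ) : ℂ) / L : ℂ) =
        ((2 * Real.pi * (u * n) / L : ℝ) : ℂ) * Complex.I := by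
      push_cast; ring
    rw [h2, Complex.exp_ofReal_mul_I_re, ← Real.cos_pi_div_three]
    apply Real.cos_le_cos_of_nonneg_of_le_pi
    · positivity
    · linarith [Real.pi_pos]
    · rw [div_le_div_iff₀ hL (by norm_num)]
      have h3 : 6 * (u * n) ≤ L := by
        refine le_trans ?_ h
        have := Nat.mul_le_mul hu (Finset.mem_range.1 hn).le
        nlinarith
      have h4 : (6 * (u * n) : ℝ) ≤ L := by exact_mod_cast h3
      nlinarith [Real.pi_pos]
  calc (D : ℝ) / 2 = ∑ n ∈ Finset.range D, (1 : ℝ) / 2 := by simp; ring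
    _ ≤ _ := Finset.sum_le_sum this

/-- Residue classes with a representative of absolute value less than `D`. -/
def Close (D : ℕ) (z : ZMod L) : Prop := ∃ n : ℤ, |n| < D ∧ (n : ZMod L) = z

lemma Close.neg {D : ℕ} {z : ZMod L} (h : Close D z) : Close D (-z) := by
  obtain ⟨n, h1, rfl⟩ := h
  exact ⟨-n, by simpa using h1, by push_cast; rfl⟩

open Classical in
lemma sum_range_ite_le {D : ℕ} (hD : D ≤ L) (x x' : ZMod L) :
    (∑ n ∈ Finset.range D, ∑ n' ∈ Finset.range D,
      if x + (n : ZMod L) = x' + (n' : ZMod L) then (1 : ℝ) else 0) ≤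
      D * if Close D (x - x') then 1 else 0 := by
  have h1 : ∀ n ∈ Finset.range D, (∑ n' ∈ Finset.range D,
      if x + (n : ZMod L) = x' + (n' : ZMod L) then (1 : ℝ) else 0) ≤
      if Close D (x - x') then 1 else 0 := by
    intro n hn
    rw [Finset.sum_boole]
    split_ifs with hc
    · rw [← Nat.cast_one, Nat.cast_le, Finset.card_le_one]
      intro a ha b hb
      rw [Finset.mem_filter] at ha hb
      have := ha.2.symm.trans hb.2
      rw [add_right_inj, ZMod.natCast_eq_natCast_iff] at this
      exact Nat.ModEq.eq_of_lt_of_lt this ((Finset.mem_range.1 ha.1).trans_le hD)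
        ((Finset.mem_range.1 hb.1).trans_le hD)
    · rw [← Nat.cast_zero, Nat.cast_le, Nat.le_zero, Finset.card_eq_zero,
        Finset.filter_eq_empty_iff]
      intro n' hn' heq
      refine hc ⟨n' - n, ?_, ?_⟩
      · have := Finset.mem_range.1 hn
        have := Finset.mem_range.1 hn'
        rw [abs_lt]; constructor <;> omega
      · push_cast
        linear_combination -heq
  refine (Finset.sum_le_sum h1).trans ?_
  simp

open Classical in
lemma large_sieve [NeZero L] {ι : Type*} (J : Finset ι) (c : ι → ℂ) (x y : ι → ZMod L) {D R : ℕ}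
    (hD : 0 < D) (hR : 0 < R) (h : 6 * D * R ≤ L) (W : Finset (ℕ × ℕ))
    (hW : ∀ p ∈ W, p.1 ≤ R ∧ p.2 ≤ R) :
    (D : ℝ) ^ 2 * ∑ p ∈ W, ‖∑ j ∈ J, c j * ZMod.stdAddChar
        ((p.1 : ZMod L) * x j + (p.2 : ZMod L) * y j)‖ ^ 2 ≤
      16 * (L : ℝ) ^ 2 * ∑ j ∈ J, ∑ k ∈ J,
        if Close D (x j - x k) ∧ Close D (y j - y k) then ‖c j‖ * ‖c k‖ else 0 := by
  have hDL : D ≤ L := by nlinarith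
  have hRL : R < L := by nlinarith
  have hDr : (0 : ℝ) < D := by exact_mod_cast hD
  set I : Finset (ι × ℕ × ℕ) := J ×ˢ Finset.range D ×ˢ Finset.range D with hI
  set F : ZMod L × ZMod L → ℂ := fun p => ∑ i ∈ I, c i.1 * ZMod.stdAddChar
    (p.1 * (x i.1 + (i.2.1 : ZMod L)) + p.2 * (y i.1 + (i.2.2 : ZMod L))) with hF
  have hker : ∀ p ∈ W, ((D : ℝ) / 2) ^ 4 * ‖∑ j ∈ J, c j * ZMod.stdAddChar
        ((p.1 : ZMod L) * x j + (p.2 : ZMod L) * y j)‖ ^ 2 ≤ ‖F (p.1, p.2)‖ ^ 2 := by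
    intro p hp
    have e : F (p.1, p.2) = (∑ j ∈ J, c j * ZMod.stdAddChar
        ((p.1 : ZMod L) * x j + (p.2 : ZMod L) * y j)) *
        ((∑ n ∈ Finset.range D, ZMod.stdAddChar ((p.1 : ZMod L) * (n : ZMod L))) *
        (∑ n ∈ Finset.range D, ZMod.stdAddChar ((p.2 : ZMod L) * (n : ZMod L)))) := by
      simp only [hF, hI, Finset.sum_product]
      rw [Finset.sum_mul_sum, Finset.sum_mul]
      refine Finset.sum_congr rfl fun j _ => ?_
      rw [Finset.mul_sum]
      refine Finset.sum_congr rfl fun n _ => ?_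
      rw [Finset.mul_sum]
      refine Finset.sum_congr rfl fun n' _ => ?_
      rw [mul_assoc, ← AddChar.map_add_eq_mul, ← AddChar.map_add_eq_mul]
      congr 2
      ring
    have k1 := half_le_norm_kernel h (hW p hp).1
    have k2 := half_le_norm_kernel h (hW p hp).2
    rw [e, norm_mul, norm_mul, mul_pow, mul_comm]
    refine mul_le_mul_of_nonneg_left ?_ (by positivity)
    calc ((D : ℝ) / 2) ^ 4 = ((D : ℝ) / 2 * ((D : ℝ) / 2)) ^ 2 := by ring
      _ ≤ _ := by gcongr
  have hinj : ∑ p ∈ W, ‖F (p.1, p.2)‖ ^ 2 ≤ ∑ p : ZMod L × ZMod L, ‖F p‖ ^ 2 := by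
    rw [← Finset.sum_image (s := W) (g := fun p : ℕ × ℕ => ((p.1 : ZMod L), (p.2 : ZMod L)))
      (f := fun p => ‖F p‖ ^ 2)]
    · exact Finset.sum_le_sum_of_subset_of_nonneg (Finset.subset_univ _) fun _ _ _ => by positivity
    · intro p hp p' hp' heq
      simp only [Prod.mk.injEq, ZMod.natCast_eq_natCast_iff] at heq
      have a1 := hW p hp
      have a2 := hW p' hp'
      exact Prod.ext (Nat.ModEq.eq_of_lt_of_lt heq.1 (by omega) (by omega))
        (Nat.ModEq.eq_of_lt_of_lt heq.2 (by omega) (by omega))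
  have hpars := sum_normSq_le I (fun i => c i.1) (fun i => x i.1 + (i.2.1 : ZMod L))
    (fun i => y i.1 + (i.2.2 : ZMod L))
  have hcount : (∑ i ∈ I, ∑ k ∈ I, if x i.1 + (i.2.1 : ZMod L) = x k.1 + (k.2.1 : ZMod L) ∧
      y i.1 + (i.2.2 : ZMod L) = y k.1 + (k.2.2 : ZMod L) then ‖c i.1‖ * ‖c k.1‖ else 0) ≤
      (D : ℝ) ^ 2 * ∑ j ∈ J, ∑ k ∈ J,
        if Close D (x j - x k) ∧ Close D (y j - y k) then ‖c j‖ * ‖c k‖ else 0 := by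
    have e : (∑ i ∈ I, ∑ k ∈ I, if x i.1 + (i.2.1 : ZMod L) = x k.1 + (k.2.1 : ZMod L) ∧
      y i.1 + (i.2.2 : ZMod L) = y k.1 + (k.2.2 : ZMod L) then ‖c i.1‖ * ‖c k.1‖ else 0) =
      ∑ j ∈ J, ∑ k ∈ J, (‖c j‖ * ‖c k‖) * ((∑ n ∈ Finset.range D, ∑ n' ∈ Finset.range D,
      if x j + (n : ZMod L) = x k + (n' : ZMod L) then (1 : ℝ) else 0) *
      (∑ n ∈ Finset.range D, ∑ n' ∈ Finset.range D,
      if y j + (n : ZMod L) = y k + (n' : ZMod L) then (1 : ℝ) else 0)) := by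
      simp only [hI, Finset.sum_product]
      refine Finset.sum_congr rfl fun j _ => ?_
      rw [Finset.sum_congr rfl fun n _ => Finset.sum_comm, Finset.sum_comm]
      refine Finset.sum_congr rfl fun k _ => ?_
      rw [Finset.sum_mul_sum, Finset.mul_sum]
      refine Finset.sum_congr rfl fun n _ => ?_
      rw [Finset.mul_sum]
      refine Finset.sum_congr rfl fun m _ => ?_
      rw [Finset.sum_mul_sum, Finset.mul_sum]
      refine Finset.sum_congr rfl fun n' _ => ?_
      rw [Finset.mul_sum]
      refine Finset.sum_congr rfl fun m' _ => ?_
      by_cases h : x j + (n : ZMod L) = x k + (n' : ZMod L) <;>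
        by_cases h' : y j + (m : ZMod L) = y k + (m' : ZMod L) <;> simp [h, h']
    rw [e, Finset.mul_sum]
    refine Finset.sum_le_sum fun j _ => ?_
    rw [Finset.mul_sum]
    refine Finset.sum_le_sum fun k _ => ?_
    have hnn : 0 ≤ ‖c j‖ * ‖c k‖ := by positivity
    have := mul_le_mul_of_nonneg_left (mul_le_mul (sum_range_ite_le hDL (x j) (x k))
      (sum_range_ite_le hDL (y j) (y k))
      (Finset.sum_nonneg fun _ _ => Finset.sum_nonneg fun _ _ => by positivity)
      (by positivity)) hnn
    refine this.trans (le_of_eq ?_)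
    by_cases h : Close D (x j - x k) <;> by_cases h' : Close D (y j - y k) <;> simp [h, h']
    ring
  have hfin : ((D : ℝ) / 2) ^ 4 * ∑ p ∈ W, ‖∑ j ∈ J, c j * ZMod.stdAddChar
        ((p.1 : ZMod L) * x j + (p.2 : ZMod L) * y j)‖ ^ 2 ≤
      (L : ℝ) ^ 2 * ((D : ℝ) ^ 2 * ∑ j ∈ J, ∑ k ∈ J,
        if Close D (x j - x k) ∧ Close D (y j - y k) then ‖c j‖ * ‖c k‖ else 0) := by
    rw [Finset.mul_sum]
    exact ((Finset.sum_le_sum hker).trans hinj).trans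
      (hpars.trans (mul_le_mul_of_nonneg_left hcount (by positivity)))
  have hD2 : (0 : ℝ) < (D : ℝ) ^ 2 / 16 := by positivity
  refine le_of_mul_le_mul_left ?_ hD2
  refine le_trans (le_of_eq ?_) (hfin.trans (le_of_eq ?_)) <;> ring

end Fourier

/-- Concatenations of the words of two sets. -/
def cat (W V : Finset (List ℕ)) : Finset (List ℕ) := Finset.image₂ (· ++ ·) W V

lemma mem_cat {W V : Finset (List ℕ)} {x : List ℕ} :
    x ∈ cat W V ↔ ∃ w ∈ W, ∃ v ∈ V, w ++ v = x := by
  simp [cat, Finset.mem_image₂]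

lemma cat_assoc (W V U : Finset (List ℕ)) : cat (cat W V) U = cat W (cat V U) :=
  Finset.image₂_assoc List.append_assoc

lemma cat_injOn {W V : Finset (List ℕ)} (hW : Unif W) :
    Set.InjOn (fun p : List ℕ × List ℕ => p.1 ++ p.2) ((W ×ˢ V : Finset _) : Set _) := by
  intro p hp p' hp' heq
  rw [Finset.mem_coe, Finset.mem_product] at hp hp'
  have := List.append_inj heq (hW.len _ hp.1 _ hp'.1)
  exact Prod.ext this.1 this.2

lemma sum_cat {M : Type*} [AddCommMonoid M] {W V : Finset (List ℕ)} (hW : Unif W)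
    (f : List ℕ → M) : ∑ γ ∈ cat W V, f γ = ∑ w ∈ W, ∑ v ∈ V, f (w ++ v) := by
  have : cat W V = (W ×ˢ V).image (fun p => p.1 ++ p.2) := rfl
  rw [this, Finset.sum_image (cat_injOn hW), Finset.sum_product]

lemma card_cat {W V : Finset (List ℕ)} (hW : Unif W) : (cat W V).card = W.card * V.card := by
  have : cat W V = (W ×ˢ V).image (fun p => p.1 ++ p.2) := rfl
  rw [this, Finset.card_image_of_injOn (cat_injOn hW), Finset.card_product]

lemma Unif.cat {W V : Finset (List ℕ)} (hW : Unif W) (hV : Unif V) : Unif (cat W V) := by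
  constructor
  · intro x hx
    obtain ⟨w, hw, v, hv, rfl⟩ := mem_cat.1 hx
    exact (hW.pos w hw).append (hV.pos v hv)
  · intro x hx y hy
    obtain ⟨w, hw, v, hv, rfl⟩ := mem_cat.1 hx
    obtain ⟨w', hw', v', hv', rfl⟩ := mem_cat.1 hy
    rw [List.length_append, List.length_append, hW.len w hw w' hw', hV.len v hv v' hv']

/-- The exponential sum over the denominators of a set of words. -/
noncomputable def expSum (L : ℕ) [NeZero L] (Ω : Finset (List ℕ)) (t : ZMod L) : ℂ :=
  ∑ γ ∈ Ω, ZMod.stdAddChar (t * (den γ : ZMod L))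

open Classical in
/-- Triples `(v, v', t')` for which the frequencies `t v` and `t' v'` nearly coincide. -/
noncomputable def collisions {L : ℕ} (D : ℕ) (V : Finset (List ℕ)) (Z : Finset (ZMod L))
    (t : ZMod L) : Finset (List ℕ × List ℕ × ZMod L) :=
  (V ×ˢ V ×ˢ Z).filter fun j =>
    Close D (t * (num j.1 : ZMod L) - j.2.2 * (num j.2.1 : ZMod L)) ∧
    Close D (t * (den j.1 : ZMod L) - j.2.2 * (den j.2.1 : ZMod L))

open Classical in
lemma duality {L : ℕ} [NeZero L] {W V : Finset (List ℕ)} (hW : Unif W)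
    (Z : Finset (ZMod L)) {D R : ℕ} (hD : 0 < D) (hR : 0 < R) (h : 6 * D * R ≤ L)
    (hWR : ∀ w ∈ W, den w ≤ R) {Rm : ℝ} (hRm0 : 0 ≤ Rm)
    (hRm : ∀ t ∈ Z, ((collisions D V Z t).card : ℝ) ≤ Rm) :
    (D : ℝ) ^ 2 * ∑ t ∈ Z, ‖expSum L (cat W V) t‖ ^ 2 ≤ 16 * W.card * (L : ℝ) ^ 2 * Rm := by
  set S := expSum L (cat W V) with hS
  set T := ∑ t ∈ Z, ‖S t‖ ^ 2 with hT
  have hT0 : 0 ≤ T := Finset.sum_nonneg fun _ _ => by positivity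
  rcases hT0.eq_or_lt with h0 | hTpos
  · rw [← h0, mul_zero]
    positivity
  set J : Finset (ZMod L × List ℕ) := Z ×ˢ V with hJ
  set g : ℕ × ℕ → ℂ := fun p => ∑ j ∈ J, (starRingEnd ℂ) (S j.1) * ZMod.stdAddChar
    ((p.1 : ZMod L) * (j.1 * (num j.2 : ZMod L)) + (p.2 : ZMod L) * (j.1 * (den j.2 : ZMod L)))
    with hg
  set W' : Finset (ℕ × ℕ) := W.image (fun w => (den' w, den w)) with hW'
  have hinj : Set.InjOn (fun w => (den' w, den w)) (W : Set (List ℕ)) := by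
    intro w hw w' hw' heq
    simp only [Prod.mk.injEq] at heq
    exact word_ext' (hW.len _ hw _ hw') (hW.pos _ hw) (hW.pos _ hw') heq.1 heq.2
  have hsum : (T : ℂ) = ∑ p ∈ W', g p := by
    rw [hW', Finset.sum_image hinj, hT]
    push_cast
    simp only [hg, hJ, Finset.sum_product]
    rw [Finset.sum_comm]
    refine Finset.sum_congr rfl fun t _ => ?_
    rw [← Complex.conj_mul', ← Finset.sum_congr rfl fun w _ => Finset.mul_sum _ _ _,
      ← Finset.mul_sum]
    congr 1
    rw [hS, expSum, sum_cat hW]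
    refine Finset.sum_congr rfl fun w _ => Finset.sum_congr rfl fun v _ => ?_
    rw [den_append]
    congr 1
    push_cast
    ring
  have hls := large_sieve J (fun j => (starRingEnd ℂ) (S j.1))
    (fun j => j.1 * (num j.2 : ZMod L)) (fun j => j.1 * (den j.2 : ZMod L)) hD hR h W' (by
      intro p hp
      obtain ⟨w, hw, rfl⟩ := Finset.mem_image.1 hp
      exact ⟨(den'_le_den (hW.pos w hw)).trans (hWR w hw), hWR w hw⟩)
  simp only [RCLike.norm_conj] at hls
  have hcs : T ^ 2 ≤ W.card * ∑ p ∈ W', ‖g p‖ ^ 2 := by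
    have h1 : T ≤ ∑ p ∈ W', ‖g p‖ := by
      have := congrArg norm hsum
      rw [Complex.norm_real, Real.norm_of_nonneg hT0] at this
      rw [this]
      exact norm_sum_le _ _
    have h2 : W'.card = W.card := Finset.card_image_of_injOn hinj
    rw [← h2]
    exact (pow_le_pow_left₀ hT0 h1 2).trans sq_sum_le_card_mul_sum_sq
  have hcoll : (∑ j ∈ J, ∑ k ∈ J,
      if Close D (j.1 * (num j.2 : ZMod L) - k.1 * (num k.2 : ZMod L)) ∧
        Close D (j.1 * (den j.2 : ZMod L) - k.1 * (den k.2 : ZMod L))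
        then ‖S j.1‖ * ‖S k.1‖ else 0) ≤ Rm * T := by
    set P : ZMod L × List ℕ → ZMod L × List ℕ → Prop := fun j k =>
      Close D (j.1 * (num j.2 : ZMod L) - k.1 * (num k.2 : ZMod L)) ∧
        Close D (j.1 * (den j.2 : ZMod L) - k.1 * (den k.2 : ZMod L)) with hP
    have hsymm : ∀ j k, P j k ↔ P k j := by
      have : ∀ j k, P j k → P k j := by
        intro j k hjk
        have h1 := hjk.1.neg
        have h2 := hjk.2.neg
        rw [neg_sub] at h1 h2
        exact ⟨h1, h2⟩
      exact fun j k => ⟨this j k, this k j⟩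
    have e1 : (∑ j ∈ J, ∑ k ∈ J, if P j k then ‖S j.1‖ * ‖S k.1‖ else 0) ≤
        ∑ j ∈ J, ∑ k ∈ J, ((if P j k then ‖S j.1‖ ^ 2 / 2 else 0) +
          (if P j k then ‖S k.1‖ ^ 2 / 2 else 0)) := by
      refine Finset.sum_le_sum fun j _ => Finset.sum_le_sum fun k _ => ?_
      split_ifs
      · nlinarith [sq_nonneg (‖S j.1‖ - ‖S k.1‖)]
      · simp
    have e2 : (∑ j ∈ J, ∑ k ∈ J, if P j k then ‖S k.1‖ ^ 2 / 2 else 0) =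
        ∑ j ∈ J, ∑ k ∈ J, if P j k then ‖S j.1‖ ^ 2 / 2 else 0 := by
      rw [Finset.sum_comm]
      simp only [hsymm]
    have e3 : ∑ j ∈ J, ∑ k ∈ J, (if P j k then ‖S j.1‖ ^ 2 / 2 else 0) =
        ∑ t ∈ Z, ‖S t‖ ^ 2 / 2 * (collisions D V Z t).card := by
      rw [hJ, Finset.sum_product]
      refine Finset.sum_congr rfl fun t _ => ?_
      have : ((collisions D V Z t).card : ℝ) = ∑ v ∈ V, ∑ k ∈ Z ×ˢ V,
          if P (t, v) k then (1 : ℝ) else 0 := by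
        rw [collisions, Finset.card_filter]
        push_cast
        rw [Finset.sum_product]
        refine Finset.sum_congr rfl fun v _ => ?_
        rw [Finset.sum_product, Finset.sum_product, Finset.sum_comm]
      rw [this, Finset.mul_sum]
      refine Finset.sum_congr rfl fun v _ => ?_
      rw [Finset.mul_sum]
      refine Finset.sum_congr rfl fun k _ => ?_
      simp
    refine e1.trans ?_
    simp only [Finset.sum_add_distrib]
    rw [e2, ← two_mul, e3, Finset.mul_sum, hT, Finset.mul_sum]
    refine Finset.sum_le_sum fun t ht => ?_
    have := mul_le_mul_of_nonneg_left (hRm t ht) (sq_nonneg ‖S t‖)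
    linarith
  have hfin : (D : ℝ) ^ 2 * T * T ≤ (16 * W.card * (L : ℝ) ^ 2 * Rm) * T := by
    have h1 := mul_le_mul_of_nonneg_left hcs (sq_nonneg (D : ℝ))
    have h2 := mul_le_mul_of_nonneg_left hls (Nat.cast_nonneg (α := ℝ) W.card)
    have h3 := mul_le_mul_of_nonneg_left hcoll
      (by positivity : (0 : ℝ) ≤ W.card * (16 * (L : ℝ) ^ 2))
    calc (D : ℝ) ^ 2 * T * T = (D : ℝ) ^ 2 * T ^ 2 := by ring
      _ ≤ _ := h1
      _ = W.card * ((D : ℝ) ^ 2 * ∑ p ∈ W', ‖g p‖ ^ 2) := by ring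
      _ ≤ _ := h2
      _ = W.card * (16 * (L : ℝ) ^ 2) * _ := by rw [← mul_assoc, ← mul_assoc]
      _ ≤ _ := h3
      _ = _ := by ring
  exact le_of_mul_le_mul_right hfin hTpos

/-- A rational approximation `a / q` of `t / L` with error `e / (q L)`. -/
structure Approx {L : ℕ} (t : ZMod L) (q : ℕ) (a e : ℤ) : Prop where
  pos : 0 < q
  cop : IsCoprime a (q : ℤ)
  eq : (q : ℤ) * (t.val : ℤ) = a * L + e

lemma card_le_of_close {L : ℕ} (Z : Finset (ZMod L)) (n : ℕ)
    (h : ∀ t ∈ Z, ∀ t' ∈ Z, Close n (t' - t)) : Z.card ≤ 2 * n := by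
  classical
  rcases Z.eq_empty_or_nonempty with rfl | ⟨t, ht⟩
  · simp
  have hsub : Z ⊆ (Finset.Ioo (-(n : ℤ)) n).image (fun k : ℤ => t + (k : ZMod L)) := by
    intro t' ht'
    obtain ⟨k, hk, hk'⟩ := h t ht t' ht'
    refine Finset.mem_image.2 ⟨k, Finset.mem_Ioo.2 (abs_lt.1 hk), ?_⟩
    rw [hk']; ring
  refine (Finset.card_le_card hsub).trans (Finset.card_image_le.trans ?_)
  rw [Int.card_Ioo]
  omega

lemma mem_collisions {L D : ℕ} [NeZero L] {V : Finset (List ℕ)} {Z : Finset (ZMod L)}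
    {t t' : ZMod L}
    {v v' : List ℕ} (h : (v, v', t') ∈ collisions D V Z t) :
    (v ∈ V ∧ v' ∈ V ∧ t' ∈ Z) ∧
    (∃ n l : ℤ, (t.val : ℤ) * num v - t'.val * num v' = n + l * L ∧ |n| < D) ∧
    (∃ n l : ℤ, (t.val : ℤ) * den v - t'.val * den v' = n + l * L ∧ |n| < D) := by
  simp only [collisions, Finset.mem_filter, Finset.mem_product] at h
  obtain ⟨⟨h1, h2, h3⟩, ⟨n, hn, hn'⟩, ⟨k, hk, hk'⟩⟩ := h
  have key : ∀ (n : ℤ) (x y : ℕ), (n : ZMod L) = t * (x : ZMod L) - t' * (y : ZMod L) →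
      ∃ l : ℤ, (t.val : ℤ) * x - t'.val * y = n + l * L := by
    intro n x y hnxy
    have : (L : ℤ) ∣ ((t.val : ℤ) * x - t'.val * y) - n := by
      rw [← ZMod.intCast_zmod_eq_zero_iff_dvd]
      push_cast
      rw [ZMod.natCast_zmod_val, ZMod.natCast_zmod_val, hnxy]
      ring
    obtain ⟨l, hl⟩ := this
    exact ⟨l, by linear_combination hl⟩
  obtain ⟨l1, hl1⟩ := key _ _ _ hn'
  obtain ⟨l2, hl2⟩ := key _ _ _ hk'
  exact ⟨⟨h1, h2, h3⟩, ⟨n, l1, hl1, hn⟩, ⟨k, l2, hl2, hk⟩⟩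

lemma card_collisions_le {L D : ℕ} {V : Finset (List ℕ)} {Z : Finset (ZMod L)} {t : ZMod L}
    (n : ℕ) (E : Finset (List ℕ × List ℕ))
    (hE : ∀ v v' t', (v, v', t') ∈ collisions D V Z t → (v, v') ∈ E)
    (hfib : ∀ v v' t' t'', (v, v', t') ∈ collisions D V Z t → (v, v', t'') ∈ collisions D V Z t →
      Close n (t'' - t')) : (collisions D V Z t).card ≤ 2 * n * E.card := by
  classical
  refine Finset.card_le_mul_card_image_of_maps_to
    (f := fun j : List ℕ × List ℕ × ZMod L => (j.1, j.2.1)) (fun j hj => hE _ _ _ hj) _ ?_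
  rintro ⟨v, v'⟩ _
  set F := (collisions D V Z t).filter
    (fun j : List ℕ × List ℕ × ZMod L => (j.1, j.2.1) = (v, v')) with hF
  have hinj : Set.InjOn (fun j : List ℕ × List ℕ × ZMod L => j.2.2) F := by
    rintro ⟨a, b, s⟩ h1 ⟨a', b', s'⟩ h2 heq
    rw [hF, Finset.mem_coe, Finset.mem_filter] at h1 h2
    simp only [Prod.mk.injEq] at h1 h2 heq ⊢
    exact ⟨h1.2.1.trans h2.2.1.symm, h1.2.2.trans h2.2.2.symm, heq⟩
  rw [← Finset.card_image_of_injOn hinj]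
  refine card_le_of_close _ n ?_
  intro s hs s' hs'
  obtain ⟨⟨a, b, s⟩, h1, rfl⟩ := Finset.mem_image.1 hs
  obtain ⟨⟨a', b', s'⟩, h2, rfl⟩ := Finset.mem_image.1 hs'
  rw [hF, Finset.mem_filter] at h1 h2
  simp only [Prod.mk.injEq] at h1 h2
  obtain ⟨h1, rfl, rfl⟩ := h1
  obtain ⟨h2, rfl, rfl⟩ := h2
  exact hfib _ _ _ _ h1 h2

lemma close_of_mul_lt {L : ℕ} [NeZero L] {t t' : ZMod L} {y κ D : ℕ} {m k : ℤ} (hy : 0 < y)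
    (h : ((t'.val : ℤ) - t.val - k * L) * y = m) (hm : |m| < 2 * D) (hD : D ≤ κ * y) :
    Close (2 * κ) (t' - t) := by
  refine ⟨(t'.val : ℤ) - t.val - k * L, ?_, ?_⟩
  · rw [← h, abs_mul, Nat.abs_cast] at hm
    have hy' : (0 : ℤ) < y := by exact_mod_cast hy
    have hD' : (D : ℤ) ≤ κ * y := by exact_mod_cast hD
    rw [← mul_lt_mul_iff_left₀ hy']
    push_cast
    linarith
  · push_cast
    rw [ZMod.natCast_zmod_val, ZMod.natCast_zmod_val]
    simp

/-- Minor arc collision bound. -/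
lemma card_collisions_le_of_large_den {L D κ c Y : ℕ} [NeZero L] {V : Finset (List ℕ)} (hV : Unif V)
    (hY : ∀ v ∈ V, den v ≤ Y) (hc : ∀ v ∈ V, ∀ v' ∈ V, den v' ≤ c * den v)
    (hκ : ∀ v ∈ V, D ≤ κ * den v) (hL : 4 * D * Y ≤ L) (Z : Finset (ZMod L)) {t : ZMod L}
    {q : ℕ} {a e : ℤ} (ht : Approx t q a e) (he : |e| * q ≤ L) :
    (collisions D V Z t).card ≤ 4 * κ * (V.card * ((c + 1) *
      ((2 * (q * (2 * D * Y) / L) + 3) * (2 * (Y ^ 2 / q) + 2)))) := by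
  classical
  have hLpos : 0 < L := Nat.pos_of_neZero L
  have hLpos' : (0 : ℤ) < L := by exact_mod_cast hLpos
  set E : Finset (List ℕ × List ℕ) := (V ×ˢ V).filter fun p =>
    ∃ m l : ℤ, (t.val : ℤ) * det p.1 p.2 = m + l * L ∧ |m| ≤ (2 * D * Y : ℕ) with hEdef
  have hE : E.card ≤ V.card * ((c + 1) *
      ((2 * (q * (2 * D * Y) / L) + 3) * (2 * (Y ^ 2 / q) + 2))) := by
    rw [mul_comm]
    refine Finset.card_le_mul_card_image_of_maps_to (f := Prod.fst) (t := V)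
      (fun p hp => (Finset.mem_product.1 (Finset.mem_filter.1 hp).1).1) _ ?_
    intro v hv
    set F := E.filter (fun p => p.1 = v) with hF
    have hinj : Set.InjOn Prod.snd (F : Set (List ℕ × List ℕ)) := by
      rintro ⟨a, b⟩ h1 ⟨a', b'⟩ h2 heq
      rw [hF, Finset.mem_coe, Finset.mem_filter] at h1 h2
      exact Prod.ext (h1.2.trans h2.2.symm) heq
    rw [← Finset.card_image_of_injOn hinj]
    have hmem : ∀ v' ∈ F.image Prod.snd, v' ∈ V ∧ ∃ m l : ℤ,
        (t.val : ℤ) * det v v' = m + l * L ∧ |m| ≤ (2 * D * Y : ℕ) := by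
      intro v' hv'
      obtain ⟨⟨a, b⟩, h1, rfl⟩ := Finset.mem_image.1 hv'
      rw [hF, Finset.mem_filter, hEdef, Finset.mem_filter, Finset.mem_product] at h1
      obtain ⟨⟨⟨_, h2⟩, h3⟩, rfl⟩ := h1
      exact ⟨h2, h3⟩
    refine (card_le_of_det_mem (hV.mono fun v' hv' => (hmem v' hv').1) (hV.pos v hv) c
      ((F.image Prod.snd).image (det v)) ?_).trans (Nat.mul_le_mul_left _ ?_)
    · intro v' hv'
      exact ⟨Finset.mem_image_of_mem _ hv', hc _ hv _ (hmem v' hv').1⟩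
    · refine card_close_multiples L q (Y ^ 2) (2 * D * Y) t.val a e hLpos ht.pos ht.cop ht.eq he
        _ ?_
      intro d hd
      obtain ⟨v', hv', rfl⟩ := Finset.mem_image.1 hd
      refine ⟨?_, (hmem v' hv').2⟩
      refine (abs_det_le (hV.pos v hv) (hV.pos _ (hmem v' hv').1)).trans ?_
      rw [sq]
      exact_mod_cast Nat.mul_le_mul (hY _ hv) (hY _ (hmem v' hv').1)
  refine (card_collisions_le (2 * κ) E ?_ ?_).trans ?_
  · intro v v' t' h
    obtain ⟨⟨hv, hv', -⟩, ⟨n1, l1, h1, hn1⟩, ⟨n2, l2, h2, hn2⟩⟩ := mem_collisions h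
    rw [hEdef, Finset.mem_filter, Finset.mem_product]
    refine ⟨⟨hv, hv'⟩, n1 * den v' - n2 * num v', l1 * den v' - l2 * num v', ?_, ?_⟩
    · rw [det]
      linear_combination (den v' : ℤ) * h1 - (num v' : ℤ) * h2
    · have b1 : (den v' : ℤ) ≤ Y := by exact_mod_cast hY v' hv'
      have b2 : (num v' : ℤ) ≤ Y := by
        exact_mod_cast (num_le_den (hV.pos _ hv')).trans (hY v' hv')
      refine (abs_sub _ _).trans ?_
      rw [abs_mul, abs_mul, Nat.abs_cast, Nat.abs_cast]
      push_cast
      have c1 := mul_le_mul hn1.le b1 (by positivity) (by positivity)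
      have c2 := mul_le_mul hn2.le b2 (by positivity) (by positivity)
      linarith
  · intro v v' t' t'' h h'
    obtain ⟨⟨hv, hv', -⟩, ⟨n1, l1, h1, hn1⟩, ⟨n2, l2, h2, hn2⟩⟩ := mem_collisions h
    obtain ⟨-, ⟨m1, k1, h3, hm1⟩, ⟨m2, k2, h4, hm2⟩⟩ := mem_collisions h'
    have hx := num_le_den (hV.pos _ hv')
    have hy := den_pos (hV.pos _ hv')
    have hYv := hY v' hv'
    have e1 : ((t''.val : ℤ) - t'.val) * num v' = (n1 - m1) + (l1 - k1) * L := by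
      linear_combination h1 - h3
    have e2 : ((t''.val : ℤ) - t'.val) * den v' = (n2 - m2) + (l2 - k2) * L := by
      linear_combination h2 - h4
    have a1 : |n1 - m1| < 2 * D := by linarith [abs_sub n1 m1]
    have a2 : |n2 - m2| < 2 * D := by linarith [abs_sub n2 m2]
    have e3 : (L : ℤ) * (num v' * (l2 - k2) - den v' * (l1 - k1)) =
        den v' * (n1 - m1) - num v' * (n2 - m2) := by
      linear_combination (den v' : ℤ) * e1 - (num v' : ℤ) * e2
    have e4 : (num v' : ℤ) * (l2 - k2) - den v' * (l1 - k1) = 0 := by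
      have b1 : (den v' : ℤ) ≤ Y := by exact_mod_cast hYv
      have b2 : (num v' : ℤ) ≤ Y := by exact_mod_cast hx.trans hYv
      have b3 : (0 : ℤ) < den v' := by exact_mod_cast hy
      have b4 : (4 * D * Y : ℤ) ≤ L := by exact_mod_cast hL
      have b5 : |(den v' : ℤ) * (n1 - m1) - num v' * (n2 - m2)| < L := by
        refine (abs_sub _ _).trans_lt ?_
        rw [abs_mul, abs_mul, Nat.abs_cast, Nat.abs_cast]
        have c1 : (den v' : ℤ) * |n1 - m1| < den v' * (2 * D) := mul_lt_mul_of_pos_left a1 b3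
        have c2 : (den v' : ℤ) * (2 * D) ≤ Y * (2 * D) := by gcongr
        have c3 : (num v' : ℤ) * |n2 - m2| ≤ Y * (2 * D) := by gcongr
        linarith
      have b6 := Int.eq_zero_of_abs_lt_dvd ⟨_, e3.symm⟩ b5
      rw [b6] at e3
      exact (mul_eq_zero.1 e3).resolve_left hLpos'.ne'
    have e5 : (den v' : ℤ) ∣ l2 - k2 := by
      have hcop : IsCoprime (den v' : ℤ) (num v' : ℤ) :=
        (Nat.isCoprime_iff_coprime.2 (coprime_num_den v')).symm
      exact hcop.dvd_of_dvd_mul_left ⟨l1 - k1, by linear_combination e4⟩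
    obtain ⟨k, hk⟩ := e5
    refine close_of_mul_lt (k := k) hy (m := n2 - m2) ?_ a2 (hκ v' hv')
    rw [hk] at e2
    linear_combination e2
  · rw [show 2 * (2 * κ) = 4 * κ by ring]
    exact Nat.mul_le_mul_left _ hE

/-- Collisions of frequencies with close approximations are exact modulo the denominator. -/
lemma collision_exact {L D Q K Y : ℕ} {v v' : List ℕ} (hv : Pos v) (hv' : Pos v')
    (hvY : den v ≤ Y) (hvY' : den v' ≤ Y)
    {q q' : ℕ} {t t' a a' e e' n1 l1 n2 l2 : ℤ} (hq : 0 < q) (hq' : 0 < q')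
    (hcop : IsCoprime a (q : ℤ)) (hcop' : IsCoprime a' (q' : ℤ))
    (ht : (q : ℤ) * t = a * L + e) (ht' : (q' : ℤ) * t' = a' * L + e')
    (hqQ : q ≤ 2 * Q) (hqQ' : q' ≤ 2 * Q) (he : |e| ≤ 2 * K * q) (he' : |e'| ≤ 2 * K * q')
    (hL : 4 * Q ^ 2 * D + 16 * Q ^ 2 * K * Y ≤ L)
    (h1 : t * num v - t' * num v' = n1 + l1 * L) (hn1 : |n1| < D)
    (h2 : t * den v - t' * den v' = n2 + l2 * L) (hn2 : |n2| < D) :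
    q = q' ∧ a * num v - a' * num v' = q * l1 ∧ a * den v - a' * den v' = q * l2 ∧
      e * num v - e' * num v' = q * n1 ∧ e * den v - e' * den v' = q * n2 := by
  have hqz : (0 : ℤ) < q := by exact_mod_cast hq
  have hqz' : (0 : ℤ) < q' := by exact_mod_cast hq'
  have hqQz : (q : ℤ) ≤ 2 * Q := by exact_mod_cast hqQ
  have hqQz' : (q' : ℤ) ≤ 2 * Q := by exact_mod_cast hqQ'
  have hLz : (4 * Q ^ 2 * D + 16 * Q ^ 2 * K * Y : ℤ) ≤ L := by exact_mod_cast hL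
  have key : ∀ (x x' : ℕ) (n l : ℤ), x ≤ Y → x' ≤ Y → t * x - t' * x' = n + l * L → |n| < D →
      (q' : ℤ) * a * x - q * a' * x' = q * q' * l := by
    intro x x' n l hx hx' h hn
    have e1 : (L : ℤ) * (q' * a * x - q * a' * x' - q * q' * l) =
        q * q' * n - q' * e * x + q * e' * x' := by
      linear_combination (q : ℤ) * q' * h - q' * x * ht + q * x' * ht'
    have hxz : (x : ℤ) ≤ Y := by exact_mod_cast hx
    have hxz' : (x' : ℤ) ≤ Y := by exact_mod_cast hx'
    have b0 : (q : ℤ) * q' ≤ 4 * Q ^ 2 := by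
      have := mul_le_mul hqQz hqQz' hqz'.le (by positivity)
      linarith
    have b1 : |(q : ℤ) * q' * n| < 4 * Q ^ 2 * D := by
      rw [abs_mul, abs_of_pos (by positivity)]
      have hpos : (0 : ℤ) < q * q' := by positivity
      calc (q : ℤ) * q' * |n| < q * q' * D := mul_lt_mul_of_pos_left hn hpos
        _ ≤ _ := mul_le_mul_of_nonneg_right b0 (by positivity)
    have b2 : |(q' : ℤ) * e * x| ≤ 8 * Q ^ 2 * K * Y := by
      rw [abs_mul, abs_mul, Nat.abs_cast, Nat.abs_cast]
      calc (q' : ℤ) * |e| * x ≤ q' * (2 * K * q) * Y := by gcongr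
        _ = (q * q') * (2 * K * Y) := by ring
        _ ≤ 4 * Q ^ 2 * (2 * K * Y) := by gcongr
        _ = _ := by ring
    have b3 : |(q : ℤ) * e' * x'| ≤ 8 * Q ^ 2 * K * Y := by
      rw [abs_mul, abs_mul, Nat.abs_cast, Nat.abs_cast]
      calc (q : ℤ) * |e'| * x' ≤ q * (2 * K * q') * Y := by gcongr
        _ = (q * q') * (2 * K * Y) := by ring
        _ ≤ 4 * Q ^ 2 * (2 * K * Y) := by gcongr
        _ = _ := by ring
    have b4 : |(q : ℤ) * q' * n - q' * e * x + q * e' * x'| < L := by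
      rw [abs_lt] at b1
      rw [abs_le] at b2 b3
      rw [abs_lt]
      constructor <;> linarith
    have := Int.eq_zero_of_abs_lt_dvd ⟨_, e1.symm⟩ b4
    rw [this] at e1
    have hL0 : (L : ℤ) ≠ 0 := by
      have : (0 : ℤ) < L := lt_of_le_of_lt (abs_nonneg _) b4
      exact this.ne'
    have := (mul_eq_zero.1 e1).resolve_left hL0
    linarith
  have k1 := key (num v) (num v') n1 l1 ((num_le_den hv).trans hvY) ((num_le_den hv').trans hvY')
    h1 hn1
  have k2 := key (den v) (den v') n2 l2 hvY hvY' h2 hn2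
  have dvd_aux : ∀ {q q' : ℤ} {a x y : ℤ}, IsCoprime a q → IsCoprime x y →
      q ∣ q' * a * x → q ∣ q' * a * y → q ∣ q' := by
    intro q q' a x y hc ⟨u, w, huw⟩ d1 d2
    have : q ∣ q' * a := by
      have e : q' * a = u * (q' * a * x) + w * (q' * a * y) := by
        linear_combination (-(q' * a)) * huw
      rw [e]
      exact dvd_add (d1.mul_left _) (d2.mul_left _)
    exact hc.symm.dvd_of_dvd_mul_right this
  have hqq : q = q' := by
    apply Nat.dvd_antisymm
    · have : (q : ℤ) ∣ q' := dvd_aux hcop (Nat.isCoprime_iff_coprime.2 (coprime_num_den v))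
        ⟨a' * num v' + q' * l1, by linear_combination k1⟩
        ⟨a' * den v' + q' * l2, by linear_combination k2⟩
      exact_mod_cast this
    · have : (q' : ℤ) ∣ q := dvd_aux hcop' (Nat.isCoprime_iff_coprime.2 (coprime_num_den v'))
        ⟨a * num v - q * l1, by linear_combination -k1⟩
        ⟨a * den v - q * l2, by linear_combination -k2⟩
      exact_mod_cast this
  subst hqq
  have f1 : a * num v - a' * num v' = q * l1 :=
    mul_left_cancel₀ hqz.ne' (by linear_combination k1)
  have f2 : a * den v - a' * den v' = q * l2 :=
    mul_left_cancel₀ hqz.ne' (by linear_combination k2)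
  refine ⟨rfl, f1, f2, ?_, ?_⟩
  · linear_combination (q : ℤ) * h1 - num v * ht + num v' * ht' + (-L : ℤ) * f1
  · linear_combination (q : ℤ) * h2 - den v * ht + den v' * ht' + (-L : ℤ) * f2

/-- A class of frequencies with approximations of comparable denominators and errors. -/
structure ArcClass {L : ℕ} (Z : Finset (ZMod L)) (Q K : ℕ) (q : ZMod L → ℕ) (a e : ZMod L → ℤ) :
    Prop where
  approx : ∀ t ∈ Z, Approx t (q t) (a t) (e t)
  le_den : ∀ t ∈ Z, Q ≤ q t
  den_le : ∀ t ∈ Z, q t ≤ 2 * Q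
  err_le : ∀ t ∈ Z, |e t| ≤ 2 * K * q t
  le_err : 1 < K → ∀ t ∈ Z, K * q t ≤ |e t|

/-- A uniform set of words with comparable denominators, adapted to the sieve scale `D`. -/
structure Window (V : Finset (List ℕ)) (D Y κ c : ℕ) : Prop where
  unif : Unif V
  le : ∀ v ∈ V, den v ≤ Y
  ratio : ∀ v ∈ V, ∀ v' ∈ V, den v' ≤ c * den v
  scale : ∀ v ∈ V, D ≤ κ * den v

section Major

variable {L D κ c Y Q K : ℕ} [NeZero L] {V : Finset (List ℕ)} {Z : Finset (ZMod L)}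
  {q : ZMod L → ℕ} {a e : ZMod L → ℤ} {t : ZMod L}

lemma major_close (hV : Window V D Y κ c) (hL : 4 * Q ^ 2 * D + 16 * Q ^ 2 * K * Y ≤ L)
    (hZ : ArcClass Z Q K q a e) (ht : t ∈ Z) {v v' : List ℕ} {t' t'' : ZMod L}
    (h : (v, v', t') ∈ collisions D V Z t) (h' : (v, v', t'') ∈ collisions D V Z t) :
    Close (2 * κ) (t'' - t') := by
  obtain ⟨⟨hv, hv', ht'⟩, ⟨n1, l1, h1, hn1⟩, ⟨n2, l2, h2, hn2⟩⟩ := mem_collisions h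
  obtain ⟨⟨-, -, ht''⟩, ⟨m1, k1, h3, hm1⟩, ⟨m2, k2, h4, hm2⟩⟩ := mem_collisions h'
  have p := hZ.approx t ht
  have p' := hZ.approx t' ht'
  have p'' := hZ.approx t'' ht''
  obtain ⟨f0, f1, f2, f3, f4⟩ := collision_exact (hV.unif.pos v hv) (hV.unif.pos v' hv')
    (hV.le v hv) (hV.le v' hv') p.pos p'.pos p.cop p'.cop p.eq p'.eq (hZ.den_le t ht)
    (hZ.den_le t' ht') (hZ.err_le t ht) (hZ.err_le t' ht') hL h1 hn1 h2 hn2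
  obtain ⟨g0, g1, g2, g3, g4⟩ := collision_exact (hV.unif.pos v hv) (hV.unif.pos v' hv')
    (hV.le v hv) (hV.le v' hv') p.pos p''.pos p.cop p''.cop p.eq p''.eq (hZ.den_le t ht)
    (hZ.den_le t'' ht'') (hZ.err_le t ht) (hZ.err_le t'' ht'') hL h3 hm1 h4 hm2
  have hq : (q t : ℤ) ≠ 0 := by exact_mod_cast p.pos.ne'
  have hdvd : (q t : ℤ) ∣ a t'' - a t' := by
    obtain ⟨u, w, huw⟩ := Nat.isCoprime_iff_coprime.2 (coprime_num_den v')
    exact ⟨u * (l1 - k1) + w * (l2 - k2), by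
      linear_combination -(a t'' - a t') * huw + u * (f1 - g1) + w * (f2 - g2)⟩
  obtain ⟨k, hk⟩ := hdvd
  have e1 := p'.eq
  have e2 := p''.eq
  rw [← f0] at e1
  rw [← g0] at e2
  refine close_of_mul_lt (k := k) (m := n2 - m2) (den_pos (hV.unif.pos v' hv')) ?_ ?_
    (hV.scale v' hv')
  · refine mul_left_cancel₀ hq ?_
    linear_combination (den v' : ℤ) * (e2 - e1) + (den v' : ℤ) * L * hk + f4 - g4
  · linarith [abs_sub n2 m2]

lemma major_det (hV : Window V D Y κ c) (hL : 4 * Q ^ 2 * D + 16 * Q ^ 2 * K * Y ≤ L)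
    (hZ : ArcClass Z Q K q a e) (ht : t ∈ Z) {v v' : List ℕ} {t' : ZMod L}
    (h : (v, v', t') ∈ collisions D V Z t) :
    (q t : ℤ) ∣ det v v' ∧ (1 < K → |det v v'| * K ≤ (2 * κ : ℕ) * (den v * den v' : ℤ)) := by
  obtain ⟨⟨hv, hv', ht'⟩, ⟨n1, l1, h1, hn1⟩, ⟨n2, l2, h2, hn2⟩⟩ := mem_collisions h
  have p := hZ.approx t ht
  have p' := hZ.approx t' ht'
  obtain ⟨f0, f1, f2, f3, f4⟩ := collision_exact (hV.unif.pos v hv) (hV.unif.pos v' hv')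
    (hV.le v hv) (hV.le v' hv') p.pos p'.pos p.cop p'.cop p.eq p'.eq (hZ.den_le t ht)
    (hZ.den_le t' ht') (hZ.err_le t ht) (hZ.err_le t' ht') hL h1 hn1 h2 hn2
  have hq : (0 : ℤ) < q t := by exact_mod_cast p.pos
  constructor
  · refine p.cop.symm.dvd_of_dvd_mul_left ⟨l1 * den v' - l2 * num v', ?_⟩
    rw [det]
    linear_combination (den v' : ℤ) * f1 - (num v' : ℤ) * f2
  · intro hK
    have hle := hZ.le_err hK t ht
    have e1 : e t * det v v' = q t * (n1 * den v' - n2 * num v') := by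
      rw [det]
      linear_combination (den v' : ℤ) * f3 - (num v' : ℤ) * f4
    have hx : (num v' : ℤ) ≤ den v' := by exact_mod_cast num_le_den (hV.unif.pos v' hv')
    have hD : (D : ℤ) ≤ κ * den v := by exact_mod_cast hV.scale v hv
    have e2 : |n1 * den v' - n2 * num v'| ≤ 2 * D * den v' := by
      refine (abs_sub _ _).trans ?_
      rw [abs_mul, abs_mul, Nat.abs_cast, Nat.abs_cast]
      have c1 : |n1| * (den v' : ℤ) ≤ D * den v' := by gcongr
      have c2 : |n2| * (num v' : ℤ) ≤ D * den v' := by gcongr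
      linarith
    have e3 : |e t| * |det v v'| ≤ q t * (2 * D * den v') := by
      rw [← abs_mul, e1, abs_mul, Nat.abs_cast]
      gcongr
    have e4 : (q t : ℤ) * (|det v v'| * K) ≤ q t * (2 * D * den v') := by
      refine le_trans ?_ e3
      calc (q t : ℤ) * (|det v v'| * K) = (K * q t) * |det v v'| := by ring
        _ ≤ _ := by gcongr
    have e5 := le_of_mul_le_mul_left e4 hq
    push_cast
    calc |det v v'| * (K : ℤ) ≤ 2 * D * den v' := e5
      _ ≤ 2 * (κ * den v) * den v' := by gcongr
      _ = _ := by ring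

lemma card_collisions_le_of_err {B M : Finset (List ℕ)} {F c' : ℕ} (hB : Unif B) (hM : Unif M)
    (hBF : ∀ b ∈ B, den b ≤ F) (hBc : ∀ b ∈ B, ∀ b' ∈ B, den b' ≤ c' * den b)
    (hV : Window (cat B M) D Y κ c) (hL : 4 * Q ^ 2 * D + 16 * Q ^ 2 * K * Y ≤ L)
    (hZ : ArcClass Z Q K q a e) (ht : t ∈ Z) (hK : 1 < K) :
    (collisions D (cat B M) Z t).card ≤ 4 * κ * ((cat B M).card * (M.card *
      ((c' + 1) * (2 * (2 * κ * F ^ 2 / K + 2 * c') + 1)))) := by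
  classical
  set E : Finset (List ℕ × List ℕ) := (cat B M ×ˢ cat B M).filter fun p =>
    |det p.1 p.2| * K ≤ (2 * κ : ℕ) * (den p.1 * den p.2 : ℤ) with hEdef
  have hE : E.card ≤ (cat B M).card * (M.card *
      ((c' + 1) * (2 * (2 * κ * F ^ 2 / K + 2 * c') + 1))) := by
    rw [mul_comm]
    refine Finset.card_le_mul_card_image_of_maps_to (f := Prod.fst) (t := cat B M)
      (fun p hp => (Finset.mem_product.1 (Finset.mem_filter.1 hp).1).1) _ ?_
    intro v hv
    obtain ⟨f, hf, r, hr, rfl⟩ := mem_cat.1 hv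
    have hsub : (E.filter (fun p => p.1 = f ++ r)).card ≤
        ((cat B M).filter fun v' => |det (f ++ r) v'| * K ≤
          (2 * κ : ℕ) * (den (f ++ r) * den v' : ℤ)).card := by
      refine Finset.card_le_card_of_injOn Prod.snd ?_ ?_
      · rintro ⟨x, y⟩ hxy
        simp only [hEdef, Finset.coe_filter, Finset.mem_filter, Finset.mem_product,
          Set.mem_ofPred_eq] at hxy ⊢
        obtain ⟨⟨⟨-, h1⟩, h2⟩, rfl⟩ := hxy
        exact ⟨h1, h2⟩
      · rintro ⟨x, y⟩ h1 ⟨x', y'⟩ h2 heq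
        rw [Finset.mem_coe, Finset.mem_filter] at h1 h2
        exact Prod.ext (h1.2.trans h2.2.symm) heq
    refine hsub.trans ?_
    rw [Finset.card_filter, sum_cat hB, Finset.sum_comm]
    rw [← smul_eq_mul (a := M.card)]
    refine Finset.sum_le_card_nsmul _ _ _ fun r' hr' => ?_
    rw [← Finset.card_filter]
    refine card_le_of_abs_det_le hB c' F K (2 * κ) (by omega) hBF hBc f r r' hf (hM.pos r hr)
      (hM.pos r' hr') _ (Finset.filter_subset _ _) ?_
    intro f' hf'
    exact_mod_cast (Finset.mem_filter.1 hf').2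
  refine (card_collisions_le (2 * κ) E ?_ ?_).trans ?_
  · intro v v' t' h
    have hm := (mem_collisions h).1
    rw [hEdef, Finset.mem_filter, Finset.mem_product]
    exact ⟨⟨hm.1, hm.2.1⟩, (major_det hV hL hZ ht h).2 hK⟩
  · intro v v' t' t'' h h'
    exact major_close hV hL hZ ht h h'
  · rw [show 2 * (2 * κ) = 4 * κ by ring]
    exact Nat.mul_le_mul_left _ hE

lemma card_collisions_le_of_den {G M : Finset (List ℕ)} {F c' : ℕ} (hG : Unif G) (hM : Unif M)
    (hMF : ∀ m ∈ M, den m ≤ F) (hMc : ∀ m ∈ M, ∀ m' ∈ M, den m' ≤ c' * den m)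
    (hV : Window (cat G M) D Y κ c) (hL : 4 * Q ^ 2 * D + 16 * Q ^ 2 * K * Y ≤ L)
    (hZ : ArcClass Z Q K q a e) (ht : t ∈ Z) (hQ : 0 < Q) :
    (collisions D (cat G M) Z t).card ≤ 4 * κ * ((cat G M).card * (G.card *
      ((c' + 1) * (2 * (F ^ 2 / Q) + 1)))) := by
  classical
  set E : Finset (List ℕ × List ℕ) := (cat G M ×ˢ cat G M).filter fun p =>
    (q t : ℤ) ∣ det p.2 p.1 with hEdef
  have hE : E.card ≤ (cat G M).card * (G.card * ((c' + 1) * (2 * (F ^ 2 / Q) + 1))) := by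
    rw [mul_comm]
    refine Finset.card_le_mul_card_image_of_maps_to (f := Prod.fst) (t := cat G M)
      (fun p hp => (Finset.mem_product.1 (Finset.mem_filter.1 hp).1).1) _ ?_
    intro v hv
    have hsub : (E.filter (fun p => p.1 = v)).card ≤
        ((cat G M).filter fun v' => (q t : ℤ) ∣ det v' v).card := by
      refine Finset.card_le_card_of_injOn Prod.snd ?_ ?_
      · rintro ⟨x, y⟩ hxy
        simp only [hEdef, Finset.coe_filter, Finset.mem_filter, Finset.mem_product,
          Set.mem_ofPred_eq] at hxy ⊢
        obtain ⟨⟨⟨-, h1⟩, h2⟩, rfl⟩ := hxy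
        exact ⟨h1, h2⟩
      · rintro ⟨x, y⟩ h1 ⟨x', y'⟩ h2 heq
        rw [Finset.mem_coe, Finset.mem_filter] at h1 h2
        exact Prod.ext (h1.2.trans h2.2.symm) heq
    refine hsub.trans ?_
    rw [Finset.card_filter, sum_cat hG]
    rw [← smul_eq_mul (a := G.card)]
    refine Finset.sum_le_card_nsmul _ _ _ fun g hg => ?_
    rw [← Finset.card_filter]
    refine (card_le_of_dvd_det (hM.mono (Finset.filter_subset _ _)) c' F (q t)
      (hZ.approx t ht).pos g v ?_ ?_ ?_).trans ?_
    · exact fun m hm => hMF m (Finset.mem_of_mem_filter _ hm)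
    · exact fun m hm m' hm' => hMc m (Finset.mem_of_mem_filter _ hm) m'
        (Finset.mem_of_mem_filter _ hm')
    · exact fun m hm => (Finset.mem_filter.1 hm).2
    · have := Nat.div_le_div_left (a := F ^ 2) (hZ.le_den t ht) hQ
      gcongr
  refine (card_collisions_le (2 * κ) E ?_ ?_).trans ?_
  · intro v v' t' h
    have hm := (mem_collisions h).1
    rw [hEdef, Finset.mem_filter, Finset.mem_product]
    refine ⟨⟨hm.1, hm.2.1⟩, ?_⟩
    have := (major_det hV hL hZ ht h).1
    rw [← dvd_neg] at this
    have e1 : det v' v = -det v v' := by rw [det, det]; ring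
    rwa [e1]
  · intro v v' t' t'' h h'
    exact major_close hV hL hZ ht h h'
  · rw [show 2 * (2 * κ) = 4 * κ by ring]
    exact Nat.mul_le_mul_left _ hE

end Major

/-- A set of words of denominators of size `N` which factorises at many scales. -/
structure Ensemble (N κ c : ℕ) (P₀ : ℝ) (Ω : Finset (List ℕ)) : Prop where
  unif : Unif Ω
  nonempty : Ω.Nonempty
  den_le : ∀ γ ∈ Ω, den γ ≤ N
  le_den : ∀ γ ∈ Ω, N ≤ κ * den γ
  left : ∀ P : ℝ, P₀ ≤ P → P ≤ (N : ℝ) ^ (0.56 : ℝ) → ∃ W B M : Finset (List ℕ), ∃ h F : ℕ,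
    Ω = cat W (cat B M) ∧ Unif W ∧ Unif B ∧ Unif M ∧
    P ≤ h ∧ (h : ℝ) ≤ P ^ (1.168 : ℝ) ∧ (∀ w ∈ W, h ≤ den w ∧ den w ≤ 2 * h) ∧
    (h : ℝ) ^ (1.76 : ℝ) ≤ W.card ∧
    P ^ (0.1666 : ℝ) ≤ F ∧ (F : ℝ) ≤ P ^ (0.195 : ℝ) ∧ (∀ b ∈ B, F ≤ den b ∧ den b ≤ c * F) ∧
    (F : ℝ) ^ (1.76 : ℝ) ≤ B.card
  right : ∀ P : ℝ, P₀ ≤ P → P ≤ (N : ℝ) ^ (0.56 : ℝ) → ∃ W G M : Finset (List ℕ), ∃ h F : ℕ,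
    Ω = cat W (cat G M) ∧ Unif W ∧ Unif G ∧ Unif M ∧
    P ≤ h ∧ (h : ℝ) ≤ P ^ (1.168 : ℝ) ∧ (∀ w ∈ W, h ≤ den w ∧ den w ≤ 2 * h) ∧
    (h : ℝ) ^ (1.76 : ℝ) ≤ W.card ∧
    P ^ (0.1666 : ℝ) ≤ F ∧ (F : ℝ) ≤ P ^ (0.195 : ℝ) ∧ (∀ b ∈ M, F ≤ den b ∧ den b ≤ c * F) ∧
    (F : ℝ) ^ (1.76 : ℝ) ≤ M.card
  mid : ∃ W V : Finset (List ℕ), ∃ h : ℕ, Ω = cat W V ∧ Unif W ∧ Unif V ∧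
    (N : ℝ) ^ (0.66 : ℝ) ≤ h ∧ (h : ℝ) ≤ (N : ℝ) ^ (0.78 : ℝ) ∧
    (∀ w ∈ W, h ≤ den w ∧ den w ≤ 2 * h) ∧
    (h : ℝ) ^ (1.76 : ℝ) ≤ W.card ∧ ((N : ℝ) / h) ^ (1.76 : ℝ) ≤ c * V.card

lemma window_of_cat {N κ h : ℕ} {W V : Finset (List ℕ)} (hN : 0 < N) (hh : 0 < h) (hW : Unif W)
    (hV : Unif V) (hne : W.Nonempty) (hle : ∀ γ ∈ cat W V, den γ ≤ N)
    (hge : ∀ γ ∈ cat W V, N ≤ κ * den γ) (hWh : ∀ w ∈ W, h ≤ den w ∧ den w ≤ 2 * h) :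
    Window V ((N + 1) / (12 * h)) (N / h) κ (4 * κ) := by
  obtain ⟨w, hw⟩ := hne
  have hup : ∀ v ∈ V, den v * h ≤ N := by
    intro v hv
    have h1 := hle _ (mem_cat.2 ⟨w, hw, v, hv, rfl⟩)
    have h2 := (hWh w hw).1
    have h3 : den w * den v ≤ den (w ++ v) := den_mul_le
    nlinarith
  have hlow : ∀ v ∈ V, N ≤ 4 * κ * (h * den v) := by
    intro v hv
    have h1 := hge _ (mem_cat.2 ⟨w, hw, v, hv, rfl⟩)
    have h2 := (hWh w hw).2
    have h3 := den_append_le (hW.pos w hw) (hV.pos v hv)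
    calc N ≤ κ * den (w ++ v) := h1
      _ ≤ κ * (2 * (2 * h * den v)) := by gcongr; exact h3.trans (by gcongr)
      _ = _ := by ring
  refine ⟨hV, ?_, ?_, ?_⟩
  · intro v hv
    rw [Nat.le_div_iff_mul_le hh]
    exact hup v hv
  · intro v hv v' hv'
    have h1 := (hup v' hv').trans (hlow v hv)
    refine Nat.le_of_mul_le_mul_right (c := h) ?_ hh
    linarith
  · intro v hv
    have h1 := hlow v hv
    refine Nat.div_le_of_le_mul ?_
    have : N + 1 ≤ 2 * N := by omega
    nlinarith

lemma sum_sq_le_of_collisions {N h : ℕ} {W V : Finset (List ℕ)} (hh : 0 < h) (hhN : 12 * h ≤ N)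
    (hW : Unif W) (hWh : ∀ w ∈ W, den w ≤ 2 * h) (Z : Finset (ZMod (N + 1)))
    {Rm : ℝ} (hRm0 : 0 ≤ Rm)
    (hRm : ∀ t ∈ Z, ((collisions ((N + 1) / (12 * h)) V Z t).card : ℝ) ≤ Rm) :
    ∑ t ∈ Z, ‖expSum (N + 1) (cat W V) t‖ ^ 2 ≤ 9216 * W.card * (h : ℝ) ^ 2 * Rm := by
  set D := (N + 1) / (12 * h) with hD
  have hDpos : 0 < D := Nat.div_pos (by omega) (by omega)
  have h1 := duality (V := V) hW Z (D := D) (R := 2 * h) hDpos (by omega) (by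
    have := Nat.div_mul_le_self (N + 1) (12 * h)
    calc 6 * D * (2 * h) = D * (12 * h) := by ring
      _ ≤ _ := this) hWh hRm0 hRm
  have h2 : ((N + 1 : ℕ) : ℝ) ≤ D * (24 * h) := by
    have h3 := Nat.lt_div_mul_add (a := N + 1) (b := 12 * h) (by omega)
    rw [← hD] at h3
    have : N + 1 ≤ D * (24 * h) := by nlinarith
    exact_mod_cast this
  have hD2 : (0 : ℝ) < (D : ℝ) ^ 2 := by positivity
  refine le_of_mul_le_mul_left (h1.trans ?_) hD2
  calc 16 * (W.card : ℝ) * ((N + 1 : ℕ) : ℝ) ^ 2 * Rm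
      ≤ 16 * (W.card : ℝ) * (D * (24 * h)) ^ 2 * Rm := by gcongr
    _ = _ := by ring

lemma scale_bound {P h F Wc Bc X : ℝ} (hP : 1 ≤ P) (hh : 0 < h) (hhP : h ≤ P ^ (1.168 : ℝ))
    (hW : h ^ (1.76 : ℝ) ≤ Wc) (hF : P ^ (0.1666 : ℝ) ≤ F) (hF' : F ≤ P ^ (0.195 : ℝ))
    (hB : F ^ (1.76 : ℝ) ≤ Bc) (hX : P ^ (1 / 3 : ℝ) ≤ 3 * X) :
    h ^ 2 * (1 + F ^ 2 / X) ≤ 4 * P ^ (-0.006 : ℝ) * (Wc * Bc) := by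
  have hP0 : 0 < P := by linarith
  have hF0 : 0 < F := lt_of_lt_of_le (by positivity) hF
  have hX0 : 0 < X := by
    have : 0 < P ^ (1 / 3 : ℝ) := by positivity
    linarith
  have hW0 : 0 < Wc := lt_of_lt_of_le (by positivity) hW
  have e1 : h ^ 2 ≤ P ^ (0.28032 : ℝ) * Wc := by
    have : h ^ 2 = h ^ (0.24 : ℝ) * h ^ (1.76 : ℝ) := by
      rw [← Real.rpow_add hh, ← Real.rpow_natCast]; norm_num
    rw [this]
    gcongr
    calc h ^ (0.24 : ℝ) ≤ (P ^ (1.168 : ℝ)) ^ (0.24 : ℝ) := by gcongr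
      _ = _ := by rw [← Real.rpow_mul hP0.le]; norm_num
  have e2 : (1 : ℝ) ≤ P ^ (-0.293216 : ℝ) * Bc := by
    calc (1 : ℝ) = P ^ (-0.293216 : ℝ) * (P ^ (0.1666 : ℝ)) ^ (1.76 : ℝ) := by
          rw [← Real.rpow_mul hP0.le, ← Real.rpow_add hP0]; norm_num
      _ ≤ P ^ (-0.293216 : ℝ) * F ^ (1.76 : ℝ) := by gcongr
      _ ≤ _ := by gcongr
  have e3 : F ^ 2 / X ≤ 3 * P ^ (-0.286533 : ℝ) * Bc := by
    have h1 : F ^ 2 = F ^ (0.24 : ℝ) * F ^ (1.76 : ℝ) := by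
      rw [← Real.rpow_add hF0, ← Real.rpow_natCast]; norm_num
    have h2 : F ^ (0.24 : ℝ) ≤ P ^ (0.0468 : ℝ) := by
      calc F ^ (0.24 : ℝ) ≤ (P ^ (0.195 : ℝ)) ^ (0.24 : ℝ) := by gcongr
        _ = _ := by rw [← Real.rpow_mul hP0.le]; norm_num
    have h3 : P ^ (0.0468 : ℝ) ≤ P ^ (-0.286533 : ℝ) * P ^ (1 / 3 : ℝ) := by
      rw [← Real.rpow_add hP0]
      exact Real.rpow_le_rpow_of_exponent_le hP (by norm_num)
    have hB0 : 0 ≤ Bc := le_trans (by positivity) hB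
    rw [div_le_iff₀ hX0, h1]
    calc F ^ (0.24 : ℝ) * F ^ (1.76 : ℝ) ≤ (P ^ (-0.286533 : ℝ) * P ^ (1 / 3 : ℝ)) * Bc :=
          mul_le_mul (h2.trans h3) hB (by positivity) (by positivity)
      _ ≤ (P ^ (-0.286533 : ℝ) * (3 * X)) * Bc := by gcongr
      _ = _ := by ring
  have hB0 : 0 ≤ Bc := le_trans (by positivity) hB
  have f1 : P ^ (0.28032 : ℝ) * P ^ (-0.293216 : ℝ) ≤ P ^ (-0.006 : ℝ) := by
    rw [← Real.rpow_add hP0]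
    exact Real.rpow_le_rpow_of_exponent_le hP (by norm_num)
  have f2 : P ^ (0.28032 : ℝ) * P ^ (-0.286533 : ℝ) ≤ P ^ (-0.006 : ℝ) := by
    rw [← Real.rpow_add hP0]
    exact Real.rpow_le_rpow_of_exponent_le hP (by norm_num)
  calc h ^ 2 * (1 + F ^ 2 / X) ≤ (P ^ (0.28032 : ℝ) * Wc) *
        (P ^ (-0.293216 : ℝ) * Bc + 3 * P ^ (-0.286533 : ℝ) * Bc) := by gcongr
    _ = ((P ^ (0.28032 : ℝ) * P ^ (-0.293216 : ℝ)) + 3 * (P ^ (0.28032 : ℝ) * P ^ (-0.286533 : ℝ)))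
        * (Wc * Bc) := by ring
    _ ≤ (P ^ (-0.006 : ℝ) + 3 * P ^ (-0.006 : ℝ)) * (Wc * Bc) := by gcongr
    _ = _ := by ring

lemma major_scale {N h Q K : ℕ} (hh : 0 < h) (hP : 17 * Q ^ 2 * K ≤ h) (hK : 0 < K) :
    4 * Q ^ 2 * ((N + 1) / (12 * h)) + 16 * Q ^ 2 * K * (N / h) ≤ N + 1 := by
  have h1 : (N + 1) / (12 * h) ≤ (N + 1) / h :=
    Nat.div_le_div_left (by omega) hh
  have h2 : N / h ≤ (N + 1) / h := Nat.div_le_div_right (by omega)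
  have h3 : (N + 1) / (12 * h) * 12 ≤ (N + 1) / h := by
    rw [mul_comm 12 h, ← Nat.div_div_eq_div_mul]
    exact Nat.div_mul_le_self _ _
  have h4 : 4 * Q ^ 2 * ((N + 1) / (12 * h)) ≤ Q ^ 2 * K * ((N + 1) / h) := by
    calc 4 * Q ^ 2 * ((N + 1) / (12 * h)) = Q ^ 2 * 1 * ((N + 1) / (12 * h) * 4) := by ring
      _ ≤ Q ^ 2 * K * ((N + 1) / h) := by
        refine Nat.mul_le_mul (Nat.mul_le_mul_left _ hK) ?_
        omega
  calc 4 * Q ^ 2 * ((N + 1) / (12 * h)) + 16 * Q ^ 2 * K * (N / h)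
      ≤ Q ^ 2 * K * ((N + 1) / h) + 16 * Q ^ 2 * K * ((N + 1) / h) :=
        Nat.add_le_add h4 (Nat.mul_le_mul_left _ h2)
    _ = (17 * Q ^ 2 * K) * ((N + 1) / h) := by ring
    _ ≤ h * ((N + 1) / h) := by gcongr
    _ ≤ N + 1 := Nat.mul_div_le _ _

/-- Contribution of one dyadic class of major arcs. -/
lemma arc_class_bound {N κ c : ℕ} {P₀ : ℝ} {Ω : Finset (List ℕ)} (hΩ : Ensemble N κ c P₀ Ω)
    (hP₀ : 1000 ≤ P₀) (hN : 10 ^ 6 ≤ N) {Q K : ℕ} (hQ : 0 < Q) (hK : 0 < K)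
    (hlow : P₀ ≤ 17 * (Q : ℝ) ^ 2 * K) (hupp : 17 * (Q : ℝ) ^ 2 * K ≤ (N : ℝ) ^ (0.56 : ℝ))
    {Z : Finset (ZMod (N + 1))} {q : ZMod (N + 1) → ℕ} {a e : ZMod (N + 1) → ℤ}
    (hZ : ArcClass Z Q K q a e) :
    ∑ t ∈ Z, ‖expSum (N + 1) Ω t‖ ^ 2 ≤
      (147456 * κ * ((c + 1) * (4 * κ * c ^ 2 + 2 * c ^ 2 + 4 * c + 1)) : ℝ) *
        (Ω.card : ℝ) ^ 2 * (17 * (Q : ℝ) ^ 2 * K) ^ (-0.006 : ℝ) := by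
  set P : ℝ := 17 * (Q : ℝ) ^ 2 * K with hP
  have hP1 : 1 ≤ P := by linarith
  have hNpos : 0 < N := by omega
  have hh12 : ∀ h : ℕ, (h : ℝ) ≤ P ^ (1.168 : ℝ) → 12 * h ≤ N := by
    intro h hh
    have hN1 : (1 : ℝ) ≤ N := by exact_mod_cast hNpos
    have e1 : (h : ℝ) ≤ (N : ℝ) ^ (0.66 : ℝ) := by
      refine hh.trans ?_
      calc P ^ (1.168 : ℝ) ≤ ((N : ℝ) ^ (0.56 : ℝ)) ^ (1.168 : ℝ) := by gcongr
        _ = (N : ℝ) ^ (0.56 * 1.168 : ℝ) := by rw [← Real.rpow_mul (by positivity)]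
        _ ≤ _ := Real.rpow_le_rpow_of_exponent_le hN1 (by norm_num)
    have e2 : (100 : ℝ) ≤ (N : ℝ) ^ (1 / 3 : ℝ) := by
      have : (100 : ℝ) = ((10 ^ 6 : ℕ) : ℝ) ^ (1 / 3 : ℝ) := by
        rw [show ((10 ^ 6 : ℕ) : ℝ) = (100 : ℝ) ^ (3 : ℝ) by norm_num,
          ← Real.rpow_mul (by norm_num)]
        norm_num
      rw [this]
      exact Real.rpow_le_rpow (by positivity) (by exact_mod_cast hN) (by norm_num)
    have e3 : (N : ℝ) ^ (0.66 : ℝ) * (N : ℝ) ^ (1 / 3 : ℝ) ≤ N := by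
      rw [← Real.rpow_add (by positivity)]
      calc _ ≤ (N : ℝ) ^ (1 : ℝ) := Real.rpow_le_rpow_of_exponent_le hN1 (by norm_num)
        _ = _ := Real.rpow_one _
    have : (12 * h : ℝ) ≤ N := by
      have h0 : (0 : ℝ) ≤ (N : ℝ) ^ (0.66 : ℝ) := by positivity
      nlinarith
    exact_mod_cast this
  have hcase : P ^ (1 / 3 : ℝ) ≤ 3 * K ∨ P ^ (1 / 3 : ℝ) ≤ 3 * Q := by
    by_contra! hcon
    have h0 : 0 ≤ P ^ (1 / 3 : ℝ) := by positivity
    have e1 : P = P ^ (1 / 3 : ℝ) * (P ^ (1 / 3 : ℝ)) ^ 2 := by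
      rw [← Real.rpow_natCast, ← Real.rpow_mul (by positivity), ← Real.rpow_add (by positivity)]
      norm_num
    have e2 : (3 * K : ℝ) * (3 * Q) ^ 2 ≤ P := by
      rw [e1]
      have := hcon.1.le
      have := hcon.2.le
      gcongr
    have hK' : (0 : ℝ) < K := by exact_mod_cast hK
    have hQ' : (0 : ℝ) < Q := by exact_mod_cast hQ
    have : (0 : ℝ) < (Q : ℝ) ^ 2 * K := by positivity
    rw [hP] at e2
    nlinarith
  rcases hcase with hX | hX
  · obtain ⟨W, B, M, h, F, rfl, hW, hB, hM, hPh, hhP, hWh, hWc, hF, hF', hBF, hBc⟩ :=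
      hΩ.left P hlow hupp
    have hh : 0 < h := by
      have : (0 : ℝ) < h := by linarith
      exact_mod_cast this
    have hV := hB.cat hM
    have hWne : W.Nonempty := by
      obtain ⟨x, hx⟩ := hΩ.nonempty
      obtain ⟨w, hw, -⟩ := mem_cat.1 hx
      exact ⟨w, hw⟩
    have hwin := window_of_cat hNpos hh hW hV hWne hΩ.den_le hΩ.le_den hWh
    have hsc : 17 * Q ^ 2 * K ≤ h := by
      have hPh' := hPh
      rw [hP] at hPh'
      exact_mod_cast hPh'
    have hK1 : 1 < K := by
      have h1 : (10 : ℝ) ≤ P ^ (1 / 3 : ℝ) := by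
        have : (10 : ℝ) = (1000 : ℝ) ^ (1 / 3 : ℝ) := by
          rw [show (1000 : ℝ) = (10 : ℝ) ^ (3 : ℝ) by norm_num, ← Real.rpow_mul (by norm_num)]
          norm_num
        rw [this]
        exact Real.rpow_le_rpow (by positivity) (by linarith) (by norm_num)
      have : (1 : ℝ) < K := by linarith
      exact_mod_cast this
    have hcol : ∀ t ∈ Z, ((collisions ((N + 1) / (12 * h)) (cat B M) Z t).card : ℝ) ≤
        4 * κ * ((cat B M).card * (M.card * ((c + 1) * (4 * κ * c ^ 2 + 2 * c ^ 2 + 4 * c + 1) *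
          (1 + (F : ℝ) ^ 2 / K)))) := by
      intro t ht
      have h1 := card_collisions_le_of_err (F := c * F) (c' := c) hB hM (fun b hb => (hBF b hb).2)
        (fun b hb b' hb' => (hBF b' hb').2.trans (Nat.mul_le_mul_left _ (hBF b hb).1)) hwin
        (major_scale hh hsc hK) hZ ht hK1
      have h2 : ((2 * κ * (c * F) ^ 2 / K : ℕ) : ℝ) ≤ 2 * κ * (c * F) ^ 2 / K := by
        have := Nat.cast_div_le (α := ℝ) (m := 2 * κ * (c * F) ^ 2) (n := K)
        push_cast at this
        exact this
      refine (Nat.cast_le (α := ℝ).2 h1).trans ?_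
      push_cast
      gcongr (4 * κ * (_ * (_ * ?_)))
      rw [mul_assoc ((c : ℝ) + 1)]
      refine mul_le_mul_of_nonneg_left ?_ (by positivity)
      have h3 : (0 : ℝ) ≤ (F : ℝ) ^ 2 / K := by positivity
      have h4 : 2 * (κ : ℝ) * (c * F) ^ 2 / K = 2 * κ * c ^ 2 * ((F : ℝ) ^ 2 / K) := by ring
      rw [h4] at h2
      have h5 : 0 ≤ (4 * c + 1 + 2 * c ^ 2) * ((F : ℝ) ^ 2 / K) := by positivity
      have h6 : 0 ≤ (4 * κ * c ^ 2 + 2 * c ^ 2 : ℝ) := by positivity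
      nlinarith
    have hfin := sum_sq_le_of_collisions hh (hh12 h hhP) hW (fun w hw => (hWh w hw).2) Z
      (by positivity) hcol
    have hsb := scale_bound hP1 (by exact_mod_cast hh) hhP hWc hF hF' hBc hX
    have hcW : ((cat W (cat B M)).card : ℝ) = W.card * (B.card * M.card) := by
      rw [card_cat hW, card_cat hB]; push_cast; ring
    have hcV : ((cat B M).card : ℝ) = B.card * M.card := by
      rw [card_cat hB]; push_cast; ring
    refine hfin.trans ?_
    rw [hcW, hcV]
    have hnn : (0 : ℝ) ≤ 36864 * κ * ((c + 1) * (4 * κ * c ^ 2 + 2 * c ^ 2 + 4 * c + 1)) *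
      (W.card * B.card * M.card ^ 2) := by positivity
    calc _ = 36864 * κ * ((c + 1) * (4 * κ * c ^ 2 + 2 * c ^ 2 + 4 * c + 1)) *
      (W.card * B.card * M.card ^ 2) * ((h : ℝ) ^ 2 * (1 + (F : ℝ) ^ 2 / K)) := by ring
      _ ≤ 36864 * κ * ((c + 1) * (4 * κ * c ^ 2 + 2 * c ^ 2 + 4 * c + 1)) *
      (W.card * B.card * M.card ^ 2) * (4 * P ^ (-0.006 : ℝ) * (W.card * B.card)) :=
        mul_le_mul_of_nonneg_left hsb hnn
      _ = _ := by ring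
  · obtain ⟨W, G, M, h, F, rfl, hW, hG, hM, hPh, hhP, hWh, hWc, hF, hF', hBF, hBc⟩ :=
      hΩ.right P hlow hupp
    have hh : 0 < h := by
      have : (0 : ℝ) < h := by linarith
      exact_mod_cast this
    have hV := hG.cat hM
    have hWne : W.Nonempty := by
      obtain ⟨x, hx⟩ := hΩ.nonempty
      obtain ⟨w, hw, -⟩ := mem_cat.1 hx
      exact ⟨w, hw⟩
    have hwin := window_of_cat hNpos hh hW hV hWne hΩ.den_le hΩ.le_den hWh
    have hsc : 17 * Q ^ 2 * K ≤ h := by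
      have hPh' := hPh
      rw [hP] at hPh'
      exact_mod_cast hPh'
    have hcol : ∀ t ∈ Z, ((collisions ((N + 1) / (12 * h)) (cat G M) Z t).card : ℝ) ≤
        4 * κ * ((cat G M).card * (G.card * ((c + 1) * (4 * κ * c ^ 2 + 2 * c ^ 2 + 4 * c + 1) *
          (1 + (F : ℝ) ^ 2 / Q)))) := by
      intro t ht
      have h1 := card_collisions_le_of_den (F := c * F) (c' := c) hG hM (fun b hb => (hBF b hb).2)
        (fun b hb b' hb' => (hBF b' hb').2.trans (Nat.mul_le_mul_left _ (hBF b hb).1)) hwin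
        (major_scale hh hsc hK) hZ ht hQ
      have h2 : (((c * F) ^ 2 / Q : ℕ) : ℝ) ≤ (c * F) ^ 2 / Q := by
        have := Nat.cast_div_le (α := ℝ) (m := (c * F) ^ 2) (n := Q)
        push_cast at this
        exact this
      refine (Nat.cast_le (α := ℝ).2 h1).trans ?_
      push_cast
      gcongr (4 * κ * (_ * (_ * ?_)))
      rw [mul_assoc ((c : ℝ) + 1)]
      refine mul_le_mul_of_nonneg_left ?_ (by positivity)
      have h3 : (0 : ℝ) ≤ (F : ℝ) ^ 2 / Q := by positivity
      have h4 : ((c : ℝ) * F) ^ 2 / Q = c ^ 2 * ((F : ℝ) ^ 2 / Q) := by ring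
      rw [h4] at h2
      have h5 : 0 ≤ (4 * c + 1 + 4 * κ * c ^ 2) * ((F : ℝ) ^ 2 / Q) := by positivity
      have h6 : 0 ≤ (4 * κ * c ^ 2 + 2 * c ^ 2 + 4 * c : ℝ) := by positivity
      nlinarith
    have hfin := sum_sq_le_of_collisions hh (hh12 h hhP) hW (fun w hw => (hWh w hw).2) Z
      (by positivity) hcol
    have hsb := scale_bound hP1 (by exact_mod_cast hh) hhP hWc hF hF' hBc hX
    have hcW : ((cat W (cat G M)).card : ℝ) = W.card * (G.card * M.card) := by
      rw [card_cat hW, card_cat hG]; push_cast; ring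
    have hcV : ((cat G M).card : ℝ) = G.card * M.card := by
      rw [card_cat hG]; push_cast; ring
    refine hfin.trans ?_
    rw [hcW, hcV]
    have hnn : (0 : ℝ) ≤ 36864 * κ * ((c + 1) * (4 * κ * c ^ 2 + 2 * c ^ 2 + 4 * c + 1)) *
      (W.card * M.card * G.card ^ 2) := by positivity
    calc _ = 36864 * κ * ((c + 1) * (4 * κ * c ^ 2 + 2 * c ^ 2 + 4 * c + 1)) *
      (W.card * M.card * G.card ^ 2) * ((h : ℝ) ^ 2 * (1 + (F : ℝ) ^ 2 / Q)) := by ring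
      _ ≤ 36864 * κ * ((c + 1) * (4 * κ * c ^ 2 + 2 * c ^ 2 + 4 * c + 1)) *
      (W.card * M.card * G.card ^ 2) * (4 * P ^ (-0.006 : ℝ) * (W.card * M.card)) :=
        mul_le_mul_of_nonneg_left hsb hnn
      _ = _ := by ring

lemma exists_approx {L : ℕ} [NeZero L] (t : ZMod L) {n : ℕ} (hn : 0 < n) :
    ∃ q : ℕ, ∃ a e : ℤ, Approx t q a e ∧ q ≤ n ∧ |e| * (n + 1) ≤ L := by
  have hL : (0 : ℝ) < L := by exact_mod_cast Nat.pos_of_neZero L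
  obtain ⟨r, hr, hrn⟩ := Real.exists_rat_abs_sub_le_and_den_le ((t.val : ℝ) / L) hn
  refine ⟨r.den, r.num, r.den * t.val - r.num * L, ⟨r.pos, ?_, by ring⟩, hrn, ?_⟩
  · rw [Int.isCoprime_iff_gcd_eq_one]
    exact r.reduced
  · have hq : (0 : ℝ) < r.den := by exact_mod_cast r.pos
    have h1 : ((r.den : ℝ) * t.val - r.num * L) = ((t.val : ℝ) / L - r) * (r.den * L) := by
      have : (r : ℝ) = r.num / r.den := by exact_mod_cast (Rat.num_div_den r).symm
      rw [this]
      field_simp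
    have h2 : |(r.den : ℝ) * t.val - r.num * L| * (n + 1) ≤ L := by
      rw [h1, abs_mul, abs_of_pos (by positivity : (0 : ℝ) < r.den * L)]
      calc |(t.val : ℝ) / L - r| * (r.den * L) * (n + 1)
          ≤ 1 / ((n + 1) * r.den) * (r.den * L) * (n + 1) := by gcongr
        _ = L := by field_simp
    exact_mod_cast h2

lemma card_le_of_bounded_approx {L : ℕ} [NeZero L] (Z : Finset (ZMod L)) {q : ZMod L → ℕ}
    {a e : ZMod L → ℤ} {m : ℕ} (h : ∀ t ∈ Z, Approx t (q t) (a t) (e t)) (hq : ∀ t ∈ Z, q t ≤ m)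
    (he : ∀ t ∈ Z, |e t| ≤ m) : Z.card ≤ (m + 1) * ((4 * m + 1) * (2 * m + 1)) := by
  classical
  have hL : (0 : ℤ) < L := by exact_mod_cast Nat.pos_of_neZero L
  have hinj : Set.InjOn (fun t => (q t, a t, e t)) (Z : Set (ZMod L)) := by
    intro t ht t' ht' heq
    simp only [Prod.mk.injEq] at heq
    obtain ⟨e1, e2, e3⟩ := heq
    have h1 := (h t ht).eq
    have h2 := (h t' ht').eq
    rw [e1, e2, e3, ← h2] at h1
    have h3 := mul_left_cancel₀ (by exact_mod_cast (h t' ht').pos.ne') h1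
    exact ZMod.val_injective L (by exact_mod_cast h3)
  rw [← Finset.card_image_of_injOn hinj]
  have hsub : Z.image (fun t => (q t, a t, e t)) ⊆ Finset.range (m + 1) ×ˢ
      (Finset.Icc (-((2 * m : ℕ) : ℤ)) (2 * m : ℕ) ×ˢ Finset.Icc (-(m : ℤ)) m) := by
    intro x hx
    obtain ⟨t, ht, rfl⟩ := Finset.mem_image.1 hx
    have hqt := hq t ht
    have het := abs_le.1 (he t ht)
    simp only [Finset.mem_product, Finset.mem_range, Finset.mem_Icc]
    have heq := (h t ht).eq
    have hv : (t.val : ℤ) < L := by exact_mod_cast ZMod.val_lt t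
    have hv0 : (0 : ℤ) ≤ t.val := by positivity
    have hq0 : (0 : ℤ) ≤ q t := by positivity
    have hq1 : (q t : ℤ) ≤ m := by exact_mod_cast hqt
    have hm : (m : ℤ) ≤ m * L := by nlinarith
    refine ⟨by omega, ⟨?_, ?_⟩, het.1, het.2⟩
    · push_cast
      have : (-(2 * m) : ℤ) * L ≤ a t * L := by nlinarith
      exact le_of_mul_le_mul_right this hL
    · push_cast
      have : a t * L ≤ (2 * m : ℤ) * L := by nlinarith
      exact le_of_mul_le_mul_right this hL
  refine (Finset.card_le_card hsub).trans_eq ?_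
  rw [Finset.card_product, Finset.card_product, card_Icc_symm, card_Icc_symm, Finset.card_range]
  ring

lemma norm_expSum_le {L : ℕ} [NeZero L] (Ω : Finset (List ℕ)) (t : ZMod L) :
    ‖expSum L Ω t‖ ≤ Ω.card := by
  refine (norm_sum_le _ _).trans ?_
  simp

lemma minor_scale {N h v W V c : ℝ} (hN : 2 ≤ N) (hh1 : N ^ (0.66 : ℝ) ≤ h)
    (hh2 : h ≤ N ^ (0.78 : ℝ)) (hv : v = N / h) (hW : h ^ (1.76 : ℝ) ≤ W)
    (hV : v ^ (1.76 : ℝ) ≤ c * V) :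
    h ^ 2 * (2 * (v ^ 3 / h) + 4 * (N ^ (0.7 : ℝ) * v / h) + 6 * (v ^ 2 / N ^ (0.25 : ℝ)) + 6) ≤
      18 * (W * (c * V)) := by
  have hN0 : 0 < N := by linarith
  have hh0 : 0 < h := lt_of_lt_of_le (by positivity) hh1
  obtain ⟨u, rfl⟩ : ∃ u : ℝ, N ^ u = h := ⟨Real.logb N h, Real.rpow_logb hN0 (by linarith) hh0⟩
  rw [Real.rpow_le_rpow_left_iff (by linarith)] at hh1 hh2
  have hv' : v = N ^ (1 - u) := by rw [hv, Real.rpow_sub hN0, Real.rpow_one]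
  rw [hv'] at hV ⊢
  rw [← Real.rpow_mul hN0.le] at hV hW
  simp only [← Real.rpow_natCast, ← Real.rpow_mul hN0.le, ← Real.rpow_add hN0, ← Real.rpow_sub hN0]
  have key : ∀ x : ℝ, 2 * u + x ≤ 1.76 →
      N ^ (u * ((2 : ℕ) : ℝ)) * N ^ x ≤ W * (c * V) := by
    intro x hx
    have h1 : N ^ (u * ((2 : ℕ) : ℝ)) * N ^ x ≤ N ^ (u * 1.76) * N ^ ((1 - u) * 1.76) := by
      rw [← Real.rpow_add hN0, ← Real.rpow_add hN0]
      refine Real.rpow_le_rpow_of_exponent_le (by linarith) ?_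
      push_cast
      linarith
    refine h1.trans (mul_le_mul hW hV (by positivity) (le_trans (by positivity) hW))
  have k1 := key ((1 - u) * ((3 : ℕ) : ℝ) - u) (by push_cast; linarith)
  have k2 := key (0.7 + (1 - u) - u) (by linarith)
  have k3 := key ((1 - u) * ((2 : ℕ) : ℝ) - 0.25) (by push_cast; linarith)
  have k4 := key 0 (by linarith)
  rw [Real.rpow_zero] at k4
  generalize N ^ (u * ((2 : ℕ) : ℝ)) = x0 at *
  generalize N ^ ((1 - u) * ((3 : ℕ) : ℝ) - u) = x1 at *
  generalize N ^ (0.7 + (1 - u) - u) = x2 at *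
  generalize N ^ ((1 - u) * ((2 : ℕ) : ℝ) - 0.25) = x3 at *
  linarith

lemma minor_bound {N κ c : ℕ} {P₀ : ℝ} {Ω : Finset (List ℕ)} (hΩ : Ensemble N κ c P₀ Ω)
    (hN : 10 ^ 20 ≤ N) {Z : Finset (ZMod (N + 1))} {q : ZMod (N + 1) → ℕ}
    {a e : ZMod (N + 1) → ℤ} (hZ : ∀ t ∈ Z, Approx t (q t) (a t) (e t))
    (hq : ∀ t ∈ Z, (N : ℝ) ^ (0.25 : ℝ) ≤ q t) (hq' : ∀ t ∈ Z, (q t : ℝ) ≤ 2 * (N : ℝ) ^ (0.7 : ℝ))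
    (he : ∀ t ∈ Z, |e t| * q t ≤ N + 1) :
    ∑ t ∈ Z, ‖expSum (N + 1) Ω t‖ ^ 2 ≤
      (663552 * κ * (4 * κ + 1) * c : ℝ) * (Ω.card : ℝ) ^ 2 := by
  obtain ⟨W, V, h, rfl, hW, hV, hh1, hh2, hWh, hWc, hVc⟩ := hΩ.mid
  have hN2 : (2 : ℝ) ≤ N := by exact_mod_cast (by omega : 2 ≤ N)
  have hN0 : (0 : ℝ) < N := by linarith
  have hh0' : (0 : ℝ) < h := lt_of_lt_of_le (by positivity) hh1
  have hh0 : 0 < h := by exact_mod_cast hh0'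
  have hWne : W.Nonempty := by
    obtain ⟨x, hx⟩ := hΩ.nonempty
    obtain ⟨w, hw, -⟩ := mem_cat.1 hx
    exact ⟨w, hw⟩
  have hwin := window_of_cat (by omega) hh0 hW hV hWne hΩ.den_le hΩ.le_den hWh
  have h12 : 12 * h ≤ N := by
    have e1 : (12 : ℝ) ≤ (N : ℝ) ^ (0.22 : ℝ) := by
      calc (12 : ℝ) ≤ 10 ^ 4 := by norm_num
        _ = ((10 : ℝ) ^ (20 : ℝ)) ^ (0.2 : ℝ) := by rw [← Real.rpow_mul (by norm_num)]; norm_num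
        _ ≤ (N : ℝ) ^ (0.2 : ℝ) := by gcongr; exact_mod_cast hN
        _ ≤ _ := Real.rpow_le_rpow_of_exponent_le (by linarith) (by norm_num)
    have e2 : (N : ℝ) ^ (0.22 : ℝ) * (N : ℝ) ^ (0.78 : ℝ) = N := by
      rw [← Real.rpow_add hN0]; norm_num
    have : (12 * h : ℝ) ≤ N := by rw [← e2]; gcongr
    exact_mod_cast this
  have hYh : N ≤ h * h := by
    have : (N : ℝ) ≤ h * h := by
      calc (N : ℝ) = (N : ℝ) ^ (1 : ℝ) := (Real.rpow_one _).symm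
        _ ≤ (N : ℝ) ^ (0.66 + 0.66 : ℝ) :=
          Real.rpow_le_rpow_of_exponent_le (by linarith) (by norm_num)
        _ = (N : ℝ) ^ (0.66 : ℝ) * (N : ℝ) ^ (0.66 : ℝ) := Real.rpow_add hN0 _ _
        _ ≤ _ := by gcongr
    exact_mod_cast this
  set D := (N + 1) / (12 * h) with hD
  set Y := N / h with hY
  have hYle : Y ≤ h := Nat.div_le_of_le_mul hYh
  have hDh : D * (12 * h) ≤ N + 1 := Nat.div_mul_le_self _ _
  have hDY : 4 * D * Y ≤ N + 1 := by nlinarith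
  set v : ℝ := (N : ℝ) / h with hv
  have hv0 : 0 < v := by positivity
  have hYv : (Y : ℝ) ≤ v := Nat.cast_div_le
  set E : ℝ := 2 * (v ^ 3 / h) + 4 * ((N : ℝ) ^ (0.7 : ℝ) * v / h) +
    6 * (v ^ 2 / (N : ℝ) ^ (0.25 : ℝ)) + 6 with hE
  have hE0 : 0 ≤ E := by positivity
  have hcol : ∀ t ∈ Z, ((collisions D V Z t).card : ℝ) ≤ 4 * κ * (V.card * ((4 * κ + 1) * E)) := by
    intro t ht
    have h1 := card_collisions_le_of_large_den hV hwin.le hwin.ratio hwin.scale hDY Z (hZ t ht)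
      (by exact_mod_cast he t ht)
    have hqt : (0 : ℝ) < q t := by exact_mod_cast (hZ t ht).pos
    refine (Nat.cast_le (α := ℝ).2 h1).trans ?_
    rw [Nat.cast_mul, Nat.cast_mul, Nat.cast_mul, Nat.cast_mul, Nat.cast_mul]
    have a1 : (((2 * (q t * (2 * D * Y) / (N + 1)) + 3 : ℕ)) : ℝ) ≤ q t * v / h + 3 := by
      have b1 : ((q t * (2 * D * Y) / (N + 1) : ℕ) : ℝ) ≤ q t * (2 * D * Y) / (N + 1) := by
        have := Nat.cast_div_le (α := ℝ) (m := q t * (2 * D * Y)) (n := N + 1)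
        push_cast at this
        exact this
      have b2 : (D : ℝ) ≤ (N + 1) / (12 * h) := by
        rw [le_div_iff₀ (by positivity)]
        exact_mod_cast hDh
      have b3 : (q t : ℝ) * (2 * D * Y) / (N + 1) ≤
          q t * (2 * ((N + 1) / (12 * h)) * v) / (N + 1) := by
        gcongr
      have b4 : (q t : ℝ) * (2 * ((N + 1) / (12 * h)) * v) / (N + 1) = q t * v / h / 6 := by
        field_simp
        ring
      have b5 : 0 ≤ q t * v / h := by positivity
      push_cast
      linarith
    have a2 : ((2 * (Y ^ 2 / q t) + 2 : ℕ) : ℝ) ≤ 2 * (v ^ 2 / q t) + 2 := by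
      have b1 : ((Y ^ 2 / q t : ℕ) : ℝ) ≤ Y ^ 2 / q t := by
        have := Nat.cast_div_le (α := ℝ) (m := Y ^ 2) (n := q t)
        push_cast at this
        exact this
      have b2 : (Y : ℝ) ^ 2 / q t ≤ v ^ 2 / q t := by gcongr
      push_cast
      linarith
    have a3 : (q t * v / h + 3) * (2 * (v ^ 2 / q t) + 2) ≤ E := by
      have b1 : (q t * v / h + 3) * (2 * (v ^ 2 / q t) + 2) =
          2 * (v ^ 3 / h) + 2 * (q t * v / h) + 6 * (v ^ 2 / q t) + 6 := by
        field_simp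
        ring
      have b2 : (q t : ℝ) * v / h ≤ 2 * (N : ℝ) ^ (0.7 : ℝ) * v / h := by
        have := hq' t ht
        gcongr
      have b3 : v ^ 2 / q t ≤ v ^ 2 / (N : ℝ) ^ (0.25 : ℝ) := by
        have := hq t ht
        gcongr
      have b4 : 2 * (N : ℝ) ^ (0.7 : ℝ) * v / h = 2 * ((N : ℝ) ^ (0.7 : ℝ) * v / h) := by ring
      rw [b1, hE]
      linarith
    have a4 := (mul_le_mul a1 a2 (by positivity) (by positivity)).trans a3
    push_cast at a4 ⊢
    gcongr
  have hfin := sum_sq_le_of_collisions hh0 h12 hW (fun w hw => (hWh w hw).2) Z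
    (by positivity) hcol
  refine hfin.trans ?_
  have hsb := minor_scale hN2 hh1 hh2 hv hWc hVc
  rw [card_cat hW]
  push_cast
  calc 9216 * (W.card : ℝ) * (h : ℝ) ^ 2 * (4 * (κ : ℝ) * ((V.card : ℝ) * ((4 * (κ : ℝ) + 1) * E)))
      = 36864 * (κ : ℝ) * (4 * κ + 1) * W.card * V.card * ((h : ℝ) ^ 2 * E) := by ring
    _ ≤ 36864 * (κ : ℝ) * (4 * κ + 1) * W.card * V.card * (18 * (W.card * (c * V.card))) := by
      gcongr
    _ = _ := by ring

lemma arc_class_of_log {L : ℕ} {Z : Finset (ZMod L)} {q : ZMod L → ℕ} {a e : ZMod L → ℤ} {α β : ℕ}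
    (h : ∀ t ∈ Z, Approx t (q t) (a t) (e t)) (hα : ∀ t ∈ Z, Nat.log 2 (q t) = α)
    (hβ : ∀ t ∈ Z, Nat.log 2 ((e t).natAbs / q t) = β) : ArcClass Z (2 ^ α) (2 ^ β) q a e := by
  refine ⟨h, ?_, ?_, ?_, ?_⟩
  · intro t ht
    rw [← hα t ht]
    exact Nat.pow_log_le_self 2 (h t ht).pos.ne'
  · intro t ht
    rw [← hα t ht, mul_comm, ← pow_succ]
    exact (Nat.lt_pow_succ_log_self (by norm_num) _).le
  · intro t ht
    have h1 := Nat.lt_pow_succ_log_self (b := 2) (by norm_num) ((e t).natAbs / q t)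
    rw [hβ t ht, Nat.div_lt_iff_lt_mul (h t ht).pos] at h1
    have h2 : (e t).natAbs ≤ 2 * 2 ^ β * q t := by
      rw [pow_succ] at h1
      linarith
    rw [← Int.natCast_natAbs (e t)]
    exact_mod_cast h2
  · intro hK t ht
    have hne : (e t).natAbs / q t ≠ 0 := by
      intro h0
      have := hβ t ht
      rw [h0] at this
      simp at this
      rw [← this] at hK
      simp at hK
    have h1 := Nat.pow_log_le_self 2 hne
    rw [hβ t ht, Nat.le_div_iff_mul_le (h t ht).pos] at h1
    rw [← Int.natCast_natAbs (e t)]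
    exact_mod_cast h1

lemma sum_dyadic_le {ι : Type*} [DecidableEq ι] (S : Finset ι) (f : ι → ℝ) (α β : ι → ℕ) {ρ C : ℝ}
    (hρ : 0 ≤ ρ) (hρ1 : ρ < 1) (hC : 0 ≤ C)
    (h : ∀ i j, (S.filter fun t => α t = i ∧ β t = j).Nonempty →
      ∑ t ∈ S.filter (fun t => α t = i ∧ β t = j), f t ≤ C * (ρ ^ i * ρ ^ j)) :
    ∑ t ∈ S, f t ≤ C * ((1 - ρ)⁻¹ * (1 - ρ)⁻¹) := by
  obtain ⟨m, hm⟩ : ∃ m, ∀ t ∈ S, α t < m ∧ β t < m := by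
    refine ⟨S.sup (fun t => α t + β t) + 1, fun t ht => ?_⟩
    have := Finset.le_sup (f := fun t => α t + β t) ht
    omega
  have hgeo : ∑ i ∈ Finset.range m, ρ ^ i ≤ (1 - ρ)⁻¹ := by
    rw [← tsum_geometric_of_lt_one hρ hρ1]
    exact (summable_geometric_of_lt_one hρ hρ1).sum_le_tsum _ (fun i _ => by positivity)
  have h1 : ∑ t ∈ S, f t = ∑ p ∈ Finset.range m ×ˢ Finset.range m,
      ∑ t ∈ S.filter (fun t => (α t, β t) = p), f t :=
    (Finset.sum_fiberwise_of_maps_to (fun t ht => by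
      simp only [Finset.mem_product, Finset.mem_range]
      exact hm t ht) f).symm
  rw [h1]
  calc _ ≤ ∑ p ∈ Finset.range m ×ˢ Finset.range m, C * (ρ ^ p.1 * ρ ^ p.2) := by
        refine Finset.sum_le_sum fun p _ => ?_
        simp only [Prod.ext_iff]
        rcases (S.filter fun t => α t = p.1 ∧ β t = p.2).eq_empty_or_nonempty with h0 | h0
        · rw [h0, Finset.sum_empty]
          positivity
        · exact h p.1 p.2 h0
    _ = C * ((∑ i ∈ Finset.range m, ρ ^ i) * ∑ i ∈ Finset.range m, ρ ^ i) := by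
        rw [← Finset.mul_sum, Finset.sum_mul_sum, Finset.sum_product]
    _ ≤ _ := by
        have h0 : 0 ≤ ∑ i ∈ Finset.range m, ρ ^ i := by positivity
        gcongr

/-- The `L²` bound for the exponential sum over an ensemble. -/
lemma sum_sq_expSum_le (κ c : ℕ) (P₀ : ℝ) (hP₀ : 1000 ≤ P₀) :
    ∃ C : ℝ, 0 < C ∧ ∃ N₁ : ℕ, ∀ N : ℕ, N₁ ≤ N → ∀ Ω : Finset (List ℕ), Ensemble N κ c P₀ Ω →
      ∑ t : ZMod (N + 1), ‖expSum (N + 1) Ω t‖ ^ 2 ≤ C * (Ω.card : ℝ) ^ 2 := by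
  classical
  set ρ : ℝ := (2 : ℝ) ^ (-0.006 : ℝ) with hρ
  have hρ0 : 0 < ρ := by positivity
  have hρ1 : ρ < 1 := Real.rpow_lt_one_of_one_lt_of_neg (by norm_num) (by norm_num)
  set CA : ℝ := 147456 * κ * ((c + 1) * (4 * κ * c ^ 2 + 2 * c ^ 2 + 4 * c + 1)) with hCA
  have hCA0 : 0 ≤ CA := by positivity
  set CB : ℝ := 663552 * κ * (4 * κ + 1) * c with hCB
  have hCB0 : 0 ≤ CB := by positivity
  set m : ℕ := ⌈4 * P₀⌉₊ with hm
  set CT : ℕ := (m + 1) * ((4 * m + 1) * (2 * m + 1)) with hCT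
  refine ⟨CT + CA * ((1 - ρ)⁻¹ * (1 - ρ)⁻¹) + CB + 1, ?_, 34 ^ 100, ?_⟩
  · have : 0 < (1 - ρ)⁻¹ := inv_pos.2 (by linarith)
    positivity
  intro N hN Ω hΩ
  have hN20 : 10 ^ 20 ≤ N := le_trans (by norm_num) hN
  have hN1 : (1 : ℝ) ≤ N := by exact_mod_cast (by omega : 1 ≤ N)
  have hN0 : (0 : ℝ) < N := by linarith
  have h34 : (34 : ℝ) ≤ (N : ℝ) ^ (0.01 : ℝ) := by
    calc (34 : ℝ) = ((34 : ℝ) ^ (100 : ℝ)) ^ (0.01 : ℝ) := by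
          rw [← Real.rpow_mul (by norm_num)]; norm_num
      _ ≤ _ := by
        gcongr
        rw [← Nat.cast_ofNat (n := 100), Real.rpow_natCast]
        exact_mod_cast hN
  have hN7 : (1 : ℝ) ≤ (N : ℝ) ^ (0.7 : ℝ) := Real.one_le_rpow hN1 (by norm_num)
  set n : ℕ := ⌈(N : ℝ) ^ (0.7 : ℝ)⌉₊ with hn
  have hn1 : (N : ℝ) ^ (0.7 : ℝ) ≤ n := Nat.le_ceil _
  have hn2 : (n : ℝ) ≤ 2 * (N : ℝ) ^ (0.7 : ℝ) := by
    have := Nat.ceil_lt_add_one (a := (N : ℝ) ^ (0.7 : ℝ)) (by positivity)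
    rw [← hn] at this
    linarith
  have hnpos : 0 < n := by
    have : (0 : ℝ) < n := by linarith
    exact_mod_cast this
  choose q a e hap hqn hen using fun t : ZMod (N + 1) => exists_approx t hnpos
  have he3 : ∀ t, ((e t).natAbs : ℝ) ≤ 2 * (N : ℝ) ^ (0.3 : ℝ) := by
    intro t
    have h1 : ((e t).natAbs : ℝ) * (n + 1) ≤ N + 1 := by
      have := hen t
      rw [← Int.natCast_natAbs (e t)] at this
      exact_mod_cast this
    have h2 : (N : ℝ) ^ (0.3 : ℝ) * (N : ℝ) ^ (0.7 : ℝ) = N := by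
      rw [← Real.rpow_add hN0]; norm_num
    have h3 : ((e t).natAbs : ℝ) * (N : ℝ) ^ (0.7 : ℝ) ≤
        2 * (N : ℝ) ^ (0.3 : ℝ) * (N : ℝ) ^ (0.7 : ℝ) := by
      calc ((e t).natAbs : ℝ) * (N : ℝ) ^ (0.7 : ℝ) ≤ ((e t).natAbs : ℝ) * (n + 1) := by
            gcongr; linarith
        _ ≤ _ := by rw [mul_assoc, h2]; linarith
    exact le_of_mul_le_mul_right h3 (by linarith)
  set α : ZMod (N + 1) → ℕ := fun t => Nat.log 2 (q t) with hα
  set β : ZMod (N + 1) → ℕ := fun t => Nat.log 2 ((e t).natAbs / q t) with hβ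
  set ZB := Finset.univ.filter fun t : ZMod (N + 1) => (N : ℝ) ^ (0.25 : ℝ) ≤ q t with hZB
  set ZT := Finset.univ.filter fun t : ZMod (N + 1) => ¬ ((N : ℝ) ^ (0.25 : ℝ) ≤ q t) ∧
    17 * ((2 ^ α t : ℕ) : ℝ) ^ 2 * (2 ^ β t : ℕ) < P₀ with hZT
  set ZA := Finset.univ.filter fun t : ZMod (N + 1) => ¬ ((N : ℝ) ^ (0.25 : ℝ) ≤ q t) ∧
    P₀ ≤ 17 * ((2 ^ α t : ℕ) : ℝ) ^ 2 * (2 ^ β t : ℕ) with hZA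
  have hsplit : ∑ t : ZMod (N + 1), ‖expSum (N + 1) Ω t‖ ^ 2 ≤
      ∑ t ∈ ZT, ‖expSum (N + 1) Ω t‖ ^ 2 + ∑ t ∈ ZA, ‖expSum (N + 1) Ω t‖ ^ 2 +
        ∑ t ∈ ZB, ‖expSum (N + 1) Ω t‖ ^ 2 := by
    rw [hZT, hZA, hZB, Finset.sum_filter, Finset.sum_filter, Finset.sum_filter,
      ← Finset.sum_add_distrib, ← Finset.sum_add_distrib]
    refine Finset.sum_le_sum fun t _ => ?_
    have h0 : 0 ≤ ‖expSum (N + 1) Ω t‖ ^ 2 := by positivity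
    by_cases h1 : (N : ℝ) ^ (0.25 : ℝ) ≤ q t
    · simp [h1]
    · by_cases h2 : 17 * ((2 ^ α t : ℕ) : ℝ) ^ 2 * (2 ^ β t : ℕ) < P₀
      · rw [if_pos ⟨h1, h2⟩, if_neg (fun h => absurd h.2 (not_le.2 h2)), if_neg h1]
        linarith
      · rw [if_neg (fun h => h2 h.2), if_pos ⟨h1, not_lt.1 h2⟩, if_neg h1]
        linarith
  have hB : ∑ t ∈ ZB, ‖expSum (N + 1) Ω t‖ ^ 2 ≤ CB * (Ω.card : ℝ) ^ 2 := by
    refine minor_bound hΩ hN20 (fun t _ => hap t) (fun t ht => (Finset.mem_filter.1 ht).2)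
      (fun t _ => ?_) (fun t _ => ?_)
    · refine le_trans ?_ hn2
      exact_mod_cast hqn t
    · refine le_trans ?_ (by exact_mod_cast hen t)
      have : (q t : ℤ) ≤ n + 1 := by exact_mod_cast (hqn t).trans (Nat.le_succ _)
      exact mul_le_mul_of_nonneg_left this (abs_nonneg _)
  have harc : ∀ S : Finset (ZMod (N + 1)), ∀ i j : ℕ,
      ArcClass (S.filter fun t => α t = i ∧ β t = j) (2 ^ i) (2 ^ j) q a e := fun S i j =>
    arc_class_of_log (fun t _ => hap t) (fun t ht => (Finset.mem_filter.1 ht).2.1)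
      (fun t ht => (Finset.mem_filter.1 ht).2.2)
  have hT : ∑ t ∈ ZT, ‖expSum (N + 1) Ω t‖ ^ 2 ≤ CT * (Ω.card : ℝ) ^ 2 := by
    have hmem : ∀ t ∈ ZT, (q t : ℝ) ≤ 4 * P₀ ∧ (((e t).natAbs : ℕ) : ℝ) ≤ 4 * P₀ := by
      intro t ht
      have hc := harc {t} (α t) (β t)
      have htt : t ∈ ({t} : Finset (ZMod (N + 1))).filter fun s => α s = α t ∧ β s = β t := by simp
      have h1 : (q t : ℝ) ≤ 2 * ((2 ^ α t : ℕ) : ℝ) := by exact_mod_cast hc.den_le t htt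
      have h2 : ((e t).natAbs : ℝ) ≤ 2 * ((2 ^ β t : ℕ) : ℝ) * q t := by
        have := hc.err_le t htt
        rw [← Int.natCast_natAbs (e t)] at this
        exact_mod_cast this
      have h3 := (Finset.mem_filter.1 ht).2.2
      have hx : (1 : ℝ) ≤ ((2 ^ α t : ℕ) : ℝ) := by exact_mod_cast Nat.one_le_two_pow
      have hy : (1 : ℝ) ≤ ((2 ^ β t : ℕ) : ℝ) := by exact_mod_cast Nat.one_le_two_pow
      generalize ((2 ^ α t : ℕ) : ℝ) = x at *
      generalize ((2 ^ β t : ℕ) : ℝ) = y at *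
      have h4 : x ≤ x ^ 2 * y := by
        calc x = x * 1 * 1 := by ring
          _ ≤ x * x * y := by gcongr
          _ = _ := by ring
      have h5 : x * y ≤ x ^ 2 * y := by
        calc x * y = x * 1 * y := by ring
          _ ≤ x * x * y := by gcongr
          _ = _ := by ring
      refine ⟨by linarith, h2.trans ?_⟩
      calc 2 * y * q t ≤ 2 * y * (2 * x) := by gcongr
        _ = 4 * (x * y) := by ring
        _ ≤ 4 * P₀ := by linarith
    have hcard := card_le_of_bounded_approx ZT (m := m) (fun t _ => hap t)
      (fun t ht => by exact_mod_cast (hmem t ht).1.trans (Nat.le_ceil _))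
      (fun t ht => by
        rw [← Int.natCast_natAbs (e t)]
        exact_mod_cast (hmem t ht).2.trans (Nat.le_ceil _))
    calc ∑ t ∈ ZT, ‖expSum (N + 1) Ω t‖ ^ 2 ≤ ∑ t ∈ ZT, (Ω.card : ℝ) ^ 2 := by
          gcongr
          exact norm_expSum_le _ _
      _ = ZT.card * (Ω.card : ℝ) ^ 2 := by rw [Finset.sum_const, nsmul_eq_mul]
      _ ≤ _ := by gcongr
  have hA : ∑ t ∈ ZA, ‖expSum (N + 1) Ω t‖ ^ 2 ≤
      CA * (Ω.card : ℝ) ^ 2 * ((1 - ρ)⁻¹ * (1 - ρ)⁻¹) := by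
    refine sum_dyadic_le ZA _ α β hρ0.le hρ1 (by positivity) fun i j hne => ?_
    obtain ⟨t, ht⟩ := hne
    obtain ⟨htA, rfl, rfl⟩ := Finset.mem_filter.1 ht
    obtain ⟨-, htq, htP⟩ := Finset.mem_filter.1 htA
    have hc := harc ZA (α t) (β t)
    have hx : (1 : ℝ) ≤ ((2 ^ α t : ℕ) : ℝ) := by exact_mod_cast Nat.one_le_two_pow
    have hy : (1 : ℝ) ≤ ((2 ^ β t : ℕ) : ℝ) := by exact_mod_cast Nat.one_le_two_pow
    have hxq : ((2 ^ α t : ℕ) : ℝ) ≤ q t := by exact_mod_cast hc.le_den t ht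
    have hq1 : (1 : ℝ) ≤ q t := hx.trans hxq
    have hyq : ((2 ^ β t : ℕ) : ℝ) * q t ≤ 2 * (N : ℝ) ^ (0.3 : ℝ) := by
      rcases Nat.lt_or_ge 1 (2 ^ β t) with h1 | h1
      · have h2 := hc.le_err h1 t ht
        rw [← Int.natCast_natAbs (e t)] at h2
        refine le_trans ?_ (he3 t)
        exact_mod_cast h2
      · have h2 : ((2 ^ β t : ℕ) : ℝ) ≤ 1 := by exact_mod_cast h1
        have h3 : (N : ℝ) ^ (0.25 : ℝ) ≤ (N : ℝ) ^ (0.3 : ℝ) :=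
          Real.rpow_le_rpow_of_exponent_le hN1 (by norm_num)
        have h4 := not_le.1 htq
        calc ((2 ^ β t : ℕ) : ℝ) * q t ≤ 1 * q t := by gcongr
          _ ≤ _ := by linarith
    have hupp : 17 * ((2 ^ α t : ℕ) : ℝ) ^ 2 * (2 ^ β t : ℕ) ≤ (N : ℝ) ^ (0.56 : ℝ) := by
      calc 17 * ((2 ^ α t : ℕ) : ℝ) ^ 2 * (2 ^ β t : ℕ)
          ≤ 17 * (q t : ℝ) ^ 2 * ((2 ^ β t : ℕ) : ℝ) := by
            gcongr
        _ = 17 * ((q t : ℝ) * (((2 ^ β t : ℕ) : ℝ) * q t)) := by ring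
        _ ≤ 17 * ((N : ℝ) ^ (0.25 : ℝ) * (2 * (N : ℝ) ^ (0.3 : ℝ))) := by
            have := (not_le.1 htq).le
            gcongr
        _ = 34 * (N : ℝ) ^ (0.55 : ℝ) := by
            rw [show (0.55 : ℝ) = 0.25 + 0.3 by norm_num, Real.rpow_add hN0]; ring
        _ ≤ (N : ℝ) ^ (0.01 : ℝ) * (N : ℝ) ^ (0.55 : ℝ) := by gcongr
        _ = _ := by rw [← Real.rpow_add hN0]; norm_num
    refine (arc_class_bound hΩ hP₀ (le_trans (by norm_num) hN20) (by positivity) (by positivity)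
      htP hupp hc).trans ?_
    refine mul_le_mul_of_nonneg_left ?_ (by positivity)
    have hpow : ∀ k : ℕ, ρ ^ k = ((2 ^ k : ℕ) : ℝ) ^ (-0.006 : ℝ) := by
      intro k
      rw [hρ, ← Real.rpow_natCast, ← Real.rpow_mul (by norm_num), mul_comm,
        Real.rpow_mul (by norm_num), Real.rpow_natCast]
      norm_num
    rw [hpow, hpow, ← Real.mul_rpow (by positivity) (by positivity)]
    refine Real.rpow_le_rpow_of_nonpos (by positivity) ?_ (by norm_num)
    calc ((2 ^ α t : ℕ) : ℝ) * (2 ^ β t : ℕ) = 1 * (((2 ^ α t : ℕ) : ℝ) * 1) * (2 ^ β t : ℕ) := by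
          ring
      _ ≤ 17 * (((2 ^ α t : ℕ) : ℝ) * ((2 ^ α t : ℕ) : ℝ)) * (2 ^ β t : ℕ) := by
          gcongr
          norm_num
      _ = _ := by ring
  have hΩ0 : 0 ≤ (Ω.card : ℝ) ^ 2 := by positivity
  have : CA * (Ω.card : ℝ) ^ 2 * ((1 - ρ)⁻¹ * (1 - ρ)⁻¹) =
    CA * ((1 - ρ)⁻¹ * (1 - ρ)⁻¹) * (Ω.card : ℝ) ^ 2 := by ring
  linarith

/-- Denominators of an ensemble have positive density. -/
lemma card_image_den_ge (κ c : ℕ) (P₀ : ℝ) (hP₀ : 1000 ≤ P₀) :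
    ∃ C : ℝ, 0 < C ∧ ∃ N₁ : ℕ, ∀ N : ℕ, N₁ ≤ N → ∀ Ω : Finset (List ℕ), Ensemble N κ c P₀ Ω →
      (N : ℝ) ≤ C * ((Ω.image den).card : ℝ) := by
  obtain ⟨C, hC, N₁, h⟩ := sum_sq_expSum_le κ c P₀ hP₀
  refine ⟨C, hC, N₁, fun N hN Ω hΩ => ?_⟩
  have h1 := mul_card_sq_le (L := N + 1) Ω den (fun γ hγ => Nat.lt_succ_of_le (hΩ.den_le γ hγ))
  have h2 := h N hN Ω hΩ
  have hcard : (0 : ℝ) < (Ω.card : ℝ) ^ 2 := by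
    have : (0 : ℝ) < Ω.card := by exact_mod_cast hΩ.nonempty.card_pos
    positivity
  have h3 : ((N + 1 : ℕ) : ℝ) * (Ω.card : ℝ) ^ 2 ≤
      (C * ((Ω.image den).card : ℝ)) * (Ω.card : ℝ) ^ 2 := by
    refine h1.trans ?_
    rw [mul_comm C, mul_assoc]
    exact mul_le_mul_of_nonneg_left h2 (by positivity)
  have h4 := le_of_mul_le_mul_right h3 hcard
  push_cast at h4
  linarith

/-- The word of the first `n` partial quotients of `x`. -/
noncomputable def prefixWord (x : ℝ) : ℕ → List ℕ
  | 0 => []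
  | n + 1 => prefixWord x n ++ [⌊1 / gaussIter x n⌋₊]

lemma length_prefixWord (x : ℝ) (n : ℕ) : (prefixWord x n).length = n := by
  induction n with
  | zero => rfl
  | succ n ih => simp [prefixWord, ih]

lemma prefixWord_mem {A : Finset ℕ} {x : ℝ} (hx : x ∈ Eset A) (n : ℕ) :
    ∀ d ∈ prefixWord x n, d ∈ A := by
  induction n with
  | zero => simp [prefixWord]
  | succ n ih =>
    intro d hd
    rcases List.mem_append.1 hd with h | h
    · exact ih d h
    · rw [List.mem_singleton.1 h]
      exact hx.2.2 n

lemma gaussIter_mem {x : ℝ} (hx : x ∈ Set.Ioo (0 : ℝ) 1) (hirr : Irrational x) (n : ℕ) :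
    gaussIter x n ∈ Set.Ioo (0 : ℝ) 1 ∧ Irrational (gaussIter x n) := by
  induction n with
  | zero => exact ⟨hx, hirr⟩
  | succ n ih =>
    obtain ⟨⟨h0, -⟩, hi⟩ := ih
    have hi' : Irrational (1 / gaussIter x n) := by
      rw [one_div]; exact hi.inv
    have hirr' : Irrational (gaussIter x (n + 1)) := hi'.sub_natCast _
    have h1 : (⌊1 / gaussIter x n⌋₊ : ℝ) ≤ 1 / gaussIter x n := Nat.floor_le (by positivity)
    have h2 := Nat.lt_floor_add_one (1 / gaussIter x n)
    refine ⟨⟨lt_of_le_of_ne ?_ hirr'.ne_zero.symm, ?_⟩, hirr'⟩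
    · simp only [gaussIter]; linarith
    · simp only [gaussIter]; linarith

lemma prefixWord_formula {x : ℝ} (hx : x ∈ Set.Ioo (0 : ℝ) 1) (hirr : Irrational x) (n : ℕ) :
    x * (den (prefixWord x n) + den' (prefixWord x n) * gaussIter x n) =
      num (prefixWord x n) + num' (prefixWord x n) * gaussIter x n := by
  induction n with
  | zero => simp [prefixWord, gaussIter]
  | succ n ih =>
    have h0 := (gaussIter_mem hx hirr n).1.1
    have h1 : gaussIter x n * (⌊1 / gaussIter x n⌋₊ + gaussIter x (n + 1)) = 1 := by
      simp only [gaussIter]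
      field_simp
      ring
    simp only [prefixWord, num_append, den_append, num'_append, den'_append, num_cons, den_cons,
      num'_cons, den'_cons, num_nil, den_nil, num'_nil, den'_nil]
    push_cast
    generalize (⌊1 / gaussIter x n⌋₊ : ℝ) = a at *
    generalize gaussIter x (n + 1) = y at *
    generalize gaussIter x n = z at *
    have h2 : a + y ≠ 0 := by
      intro h
      rw [h, mul_zero] at h1
      exact zero_ne_one h1
    linear_combination (a + y) * ih + (num' (prefixWord x n) - x * den' (prefixWord x n)) * h1

lemma abs_sub_prefixWord_le {x : ℝ} (hx : x ∈ Set.Ioo (0 : ℝ) 1) (hirr : Irrational x) (n : ℕ)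
    (hpos : Pos (prefixWord x n)) :
    |x - num (prefixWord x n) / den (prefixWord x n)| ≤ 1 / (den (prefixWord x n) : ℝ) ^ 2 := by
  obtain ⟨⟨h0, h1⟩, -⟩ := gaussIter_mem hx hirr n
  have hf := prefixWord_formula hx hirr n
  have hd : (0 : ℝ) < den (prefixWord x n) := by exact_mod_cast den_pos hpos
  have hdet : ((num' (prefixWord x n) : ℝ) * den (prefixWord x n) -
      num (prefixWord x n) * den' (prefixWord x n)) = (-1) ^ (prefixWord x n).length := by
    exact_mod_cast det_eq (prefixWord x n)
  set p : ℝ := (num (prefixWord x n) : ℝ)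
  set p' : ℝ := (num' (prefixWord x n) : ℝ)
  set d : ℝ := (den (prefixWord x n) : ℝ)
  have hd' : (0 : ℝ) ≤ (den' (prefixWord x n) : ℝ) := by positivity
  set d' : ℝ := (den' (prefixWord x n) : ℝ)
  have hs : 0 < d + d' * gaussIter x n := by positivity
  have e1 : x - p / d = gaussIter x n * (-1) ^ (prefixWord x n).length /
      (d * (d + d' * gaussIter x n)) := by
    rw [← hdet]
    field_simp
    linear_combination d * hf
  rw [e1, abs_div, abs_mul, abs_pow, abs_neg, abs_one, one_pow, mul_one, abs_of_pos h0,
    abs_of_pos (mul_pos hd hs), pow_two]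
  have : 0 ≤ d' * gaussIter x n := by positivity
  exact div_le_div₀ zero_le_one h1.le (by positivity)
    (mul_le_mul_of_nonneg_left (by linarith) hd.le)

lemma finite_words {A : Finset ℕ} (h0 : 0 ∉ A) (m : ℕ) :
    {w : List ℕ | (∀ d ∈ w, d ∈ A) ∧ den w ≤ m}.Finite := by
  have h1 := (List.finite_length_le A (2 * m + 1)).image (List.map Subtype.val)
  refine h1.subset ?_
  rintro w ⟨hw, hm⟩
  have hpos : Pos w := fun d hd => Nat.pos_of_ne_zero fun h => h0 (h ▸ hw d hd)
  refine ⟨w.pmap (fun d hd => ⟨d, hd⟩) hw, ?_, ?_⟩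
  · have h2 := two_pow_le_den hpos
    have h3 := Nat.lt_two_pow_self (n := w.length / 2)
    rw [Set.mem_ofPred_eq, List.length_pmap]
    omega
  · simp [List.map_pmap]

lemma pos_of_mem {A : Finset ℕ} (h0 : 0 ∉ A) {w : List ℕ} (hw : ∀ d ∈ w, d ∈ A) : Pos w :=
  fun d hd => Nat.pos_of_ne_zero fun h => h0 (h ▸ hw d hd)

/-- Words over `A` with denominator in `[T, C T]`. -/
noncomputable def words {A : Finset ℕ} (h0 : 0 ∉ A) (C T : ℕ) : Finset (List ℕ) :=
  (finite_words h0 (C * T)).toFinset.filter fun w => T ≤ den w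

lemma mem_words {A : Finset ℕ} {h0 : 0 ∉ A} {C T : ℕ} {w : List ℕ} :
    w ∈ words h0 C T ↔ (∀ d ∈ w, d ∈ A) ∧ T ≤ den w ∧ den w ≤ C * T := by
  rw [words, Finset.mem_filter, Set.Finite.mem_toFinset, Set.mem_ofPred_eq]
  tauto

lemma exists_prefixWord_mem_words {A : Finset ℕ} (h0 : 0 ∉ A) {C T : ℕ} (hC : ∀ d ∈ A, d + 1 ≤ C)
    (hT : 2 ≤ T) {x : ℝ} (hx : x ∈ Eset A) : ∃ n, prefixWord x n ∈ words h0 C T := by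
  classical
  have hpos : ∀ n, Pos (prefixWord x n) := fun n => pos_of_mem h0 (prefixWord_mem hx n)
  have hex : ∃ n, T ≤ den (prefixWord x n) := by
    refine ⟨2 * T, ?_⟩
    have h2 := two_pow_le_den (hpos (2 * T))
    rw [length_prefixWord, Nat.mul_div_cancel_left _ (by norm_num)] at h2
    exact Nat.lt_two_pow_self.le.trans h2
  have hfind := Nat.find_spec hex
  obtain ⟨n, hn⟩ : ∃ n, Nat.find hex = n + 1 := by
    refine Nat.exists_eq_succ_of_ne_zero fun h => ?_
    rw [h] at hfind
    simp [prefixWord] at hfind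
    omega
  refine ⟨n + 1, mem_words.2 ⟨prefixWord_mem hx _, hn ▸ hfind, ?_⟩⟩
  have h1 := Nat.find_min hex (m := n) (by omega)
  rw [not_le] at h1
  have ha := hC _ (hx.2.2 n)
  simp only [prefixWord, den_append, den_cons, num_cons, num_nil, den_nil]
  have h2 := den'_le_den (hpos n)
  calc den' (prefixWord x n) * 1 + den (prefixWord x n) * (0 + ⌊1 / gaussIter x n⌋₊ * 1)
      ≤ den (prefixWord x n) * (⌊1 / gaussIter x n⌋₊ + 1) := by
        simp only [mul_one, zero_add, Nat.mul_add]; omega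
    _ ≤ T * C := Nat.mul_le_mul h1.le ha
    _ = _ := mul_comm _ _

/-- Lower bound for the number of words of given size from the Hausdorff dimension. -/
lemma card_words_ge {A : Finset ℕ} (h0 : 0 ∉ A) {C : ℕ} (hC : ∀ d ∈ A, d + 1 ≤ C) {s : NNReal}
    (hs : (s : ENNReal) < dimH (Eset A)) :
    ∃ T₀ : ℕ, ∀ T : ℕ, T₀ ≤ T → (T : ℝ) ^ (2 * s : ℝ) ≤ (words h0 C T).card := by
  by_contra! hcon
  choose T hT hT' using fun k : ℕ => hcon (k + 2)
  have hTpos : ∀ k, (0 : ℝ) < T k := fun k => by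
    have : 0 < T k := by have := hT k; omega
    exact_mod_cast this
  have hlt := hausdorffMeasure_of_lt_dimH hs
  have hle := MeasureTheory.Measure.hausdorffMeasure_le_liminf_sum (X := ℝ) (β := ℕ)
    (ι := fun k => words h0 C (T k)) (s : ℝ) (Eset A) (l := Filter.atTop)
    (fun k => ENNReal.ofReal (2 / (T k : ℝ) ^ 2)) ?_
    (fun k w => Set.Icc ((num w.1 : ℝ) / den w.1 - 1 / (T k : ℝ) ^ 2)
      ((num w.1 : ℝ) / den w.1 + 1 / (T k : ℝ) ^ 2)) ?_ ?_
  · rw [hlt, top_le_iff] at hle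
    have hbd : Filter.liminf (fun k => ∑ w : words h0 C (T k),
        Metric.ediam (Set.Icc ((num w.1 : ℝ) / den w.1 - 1 / (T k : ℝ) ^ 2)
          ((num w.1 : ℝ) / den w.1 + 1 / (T k : ℝ) ^ 2)) ^ (s : ℝ)) Filter.atTop ≤
        ENNReal.ofReal (2 ^ (s : ℝ)) := by
      refine Filter.liminf_le_of_frequently_le (Filter.Eventually.frequently ?_)
      refine Filter.Eventually.of_forall fun k => ?_
      simp only [Real.ediam_Icc, add_sub_sub_cancel]
      rw [Finset.sum_const, nsmul_eq_mul, Finset.card_univ, Fintype.card_coe,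
        ENNReal.ofReal_rpow_of_nonneg (by positivity) s.coe_nonneg, ← ENNReal.ofReal_natCast,
        ← ENNReal.ofReal_mul (by positivity)]
      refine ENNReal.ofReal_le_ofReal ?_
      have h2 : (1 / (T k : ℝ) ^ 2 + 1 / (T k : ℝ) ^ 2) ^ (s : ℝ) =
          2 ^ (s : ℝ) / (T k : ℝ) ^ (2 * s : ℝ) := by
        rw [← two_mul, mul_one_div, Real.div_rpow (by norm_num) (by positivity),
          Real.rpow_mul (hTpos k).le, Real.rpow_two]
      have h3 : 0 < (T k : ℝ) ^ (2 * s : ℝ) := Real.rpow_pos_of_pos (hTpos k) _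
      rw [h2, mul_div_assoc', div_le_iff₀ h3, mul_comm]
      exact mul_le_mul_of_nonneg_left (hT' k).le (by positivity)
    rw [hle, top_le_iff] at hbd
    exact ENNReal.ofReal_ne_top hbd
  · rw [← ENNReal.ofReal_zero]
    refine ENNReal.tendsto_ofReal ?_
    refine squeeze_zero (fun k => by positivity) (g := fun k : ℕ => 2 / ((k : ℝ) + 1))
      (fun k => ?_) ?_
    · have h1 : (k : ℝ) + 1 ≤ T k := by exact_mod_cast (by have := hT k; omega : k + 1 ≤ T k)
      have h2 : (0 : ℝ) ≤ k := by positivity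
      have h3 : (k : ℝ) + 1 ≤ (T k : ℝ) ^ 2 := by nlinarith
      exact div_le_div_of_nonneg_left (by norm_num) (by positivity) h3
    · have := (tendsto_one_div_add_atTop_nhds_zero_nat (𝕜 := ℝ)).const_mul 2
      simpa [div_eq_mul_inv] using this
  · refine Filter.Eventually.of_forall fun k w => ?_
    rw [Real.ediam_Icc]
    refine ENNReal.ofReal_le_ofReal (le_of_eq ?_)
    ring
  · refine Filter.Eventually.of_forall fun k x hx => ?_
    obtain ⟨n, hn⟩ := exists_prefixWord_mem_words h0 hC (T := T k) (by have := hT k; omega) hx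
    refine Set.mem_iUnion.2 ⟨⟨_, hn⟩, ?_⟩
    have h1 := abs_sub_prefixWord_le hx.1 hx.2.1 n (pos_of_mem h0 (prefixWord_mem hx n))
    have h2 : (T k : ℝ) ≤ den (prefixWord x n) := by exact_mod_cast (mem_words.1 hn).2.1
    have h3 : 1 / (den (prefixWord x n) : ℝ) ^ 2 ≤ 1 / (T k : ℝ) ^ 2 := by
      have := hTpos k
      gcongr
    have h4 := abs_le.1 (h1.trans h3)
    exact ⟨by linarith [h4.1], by linarith [h4.2]⟩

/-- Corresponding matrix entries of words of `S` agree up to the factor `r`. -/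
structure Narrow (r : ℝ) (S : Finset (List ℕ)) : Prop where
  num' : ∀ w ∈ S, ∀ v ∈ S, (num' w : ℝ) ≤ r * num' v
  num : ∀ w ∈ S, ∀ v ∈ S, (num w : ℝ) ≤ r * num v
  den' : ∀ w ∈ S, ∀ v ∈ S, (den' w : ℝ) ≤ r * den' v
  den : ∀ w ∈ S, ∀ v ∈ S, (den w : ℝ) ≤ r * den v

lemma Narrow.mono {r s : ℝ} {S : Finset (List ℕ)} (h : Narrow r S) (hrs : r ≤ s) : Narrow s S :=
  ⟨fun w hw v hv => (h.num' w hw v hv).trans (by gcongr),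
    fun w hw v hv => (h.num w hw v hv).trans (by gcongr),
    fun w hw v hv => (h.den' w hw v hv).trans (by gcongr),
    fun w hw v hv => (h.den w hw v hv).trans (by gcongr)⟩

lemma Narrow.cat {r s : ℝ} (hr : 0 ≤ r) {W V : Finset (List ℕ)} (hW : Narrow r W)
    (hV : Narrow s V) : Narrow (r * s) (cat W V) := by
  have key : ∀ {a b c d a' b' c' d' : ℕ}, (a : ℝ) ≤ r * a' → (b : ℝ) ≤ s * b' → (c : ℝ) ≤ r * c' →
      (d : ℝ) ≤ s * d' → ((a * b + c * d : ℕ) : ℝ) ≤ r * s * ((a' * b' + c' * d' : ℕ) : ℝ) := by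
    intro a b c d a' b' c' d' h1 h2 h3 h4
    push_cast
    have e1 : (a : ℝ) * b ≤ (r * a') * (s * b') := by gcongr
    have e2 : (c : ℝ) * d ≤ (r * c') * (s * d') := by gcongr
    linarith
  constructor <;>
  · intro x hx y hy
    obtain ⟨w, hw, v, hv, rfl⟩ := mem_cat.1 hx
    obtain ⟨w', hw', v', hv', rfl⟩ := mem_cat.1 hy
    simp only [num'_append, num_append, den'_append, den_append]
    apply key <;>
    first
      | exact hW.num' _ hw _ hw'
      | exact hW.num _ hw _ hw'
      | exact hW.den' _ hw _ hw'
      | exact hW.den _ hw _ hw'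
      | exact hV.num' _ hv _ hv'
      | exact hV.num _ hv _ hv'
      | exact hV.den' _ hv _ hv'
      | exact hV.den _ hv _ hv'

/-- A narrow uniform family of words over `A` of denominator about `T`. -/
structure IsBlock (A : Finset ℕ) (C T : ℕ) (B : Finset (List ℕ)) : Prop where
  unif : Unif B
  mem : ∀ w ∈ B, ∀ d ∈ w, d ∈ A
  le : ∀ w ∈ B, T ≤ den w
  ge : ∀ w ∈ B, den w ≤ C * T
  card : (T : ℝ) ^ (1.761 : ℝ) ≤ B.card
  narrow : Narrow (1 + (T : ℝ) ^ (-0.0001 : ℝ)) B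

/-- Logarithmic size class of a natural number. -/
noncomputable def sizeClass (δ : ℝ) (f : ℕ) : ℕ := if f = 0 then 0 else ⌊Real.log f / δ⌋₊ + 1

lemma le_of_sizeClass_eq {ε : ℝ} (hε : 0 < ε) {f g : ℕ}
    (h : sizeClass (Real.log (1 + ε)) f = sizeClass (Real.log (1 + ε)) g) :
    (f : ℝ) ≤ (1 + ε) * g := by
  rcases Nat.eq_zero_or_pos f with rfl | hf
  · simp; positivity
  have hδ : 0 < Real.log (1 + ε) := Real.log_pos (by linarith)
  have hg : 0 < g := by
    refine Nat.pos_of_ne_zero fun hg => ?_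
    rw [sizeClass, sizeClass, if_neg hf.ne', if_pos hg] at h
    omega
  rw [sizeClass, sizeClass, if_neg hf.ne', if_neg hg.ne'] at h
  have hf' : (0 : ℝ) < f := by exact_mod_cast hf
  have hg' : (0 : ℝ) < g := by exact_mod_cast hg
  have h1 := Nat.lt_floor_add_one (Real.log f / Real.log (1 + ε))
  have h2 : (⌊Real.log g / Real.log (1 + ε)⌋₊ : ℝ) ≤ Real.log g / Real.log (1 + ε) :=
    Nat.floor_le (div_nonneg (Real.log_natCast_nonneg g) hδ.le)
  rw [Nat.succ.inj h] at h1
  have h3 : Real.log f / Real.log (1 + ε) < Real.log g / Real.log (1 + ε) + 1 := by linarith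
  rw [div_add_one hδ.ne', div_lt_div_iff_of_pos_right hδ,
    ← Real.log_mul hg'.ne' (by linarith)] at h3
  have h4 := (Real.log_lt_log_iff hf' (by positivity)).1 h3
  linarith

lemma eventually_log_bound (C : ℝ) (hC : 1 ≤ C) : ∀ᶠ x : ℝ in Filter.atTop,
    3 * Real.log (C * x) * x ^ (0.0001 : ℝ) + 3 ≤ x ^ (0.0004 : ℝ) := by
  have h1 := (isLittleO_log_rpow_atTop (r := 0.0001) (by norm_num)).bound (c := 1) one_pos
  have h2 := (tendsto_rpow_atTop (y := (0.0002 : ℝ)) (by norm_num)).eventually_ge_atTop 9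
  filter_upwards [h1, h2, Filter.eventually_ge_atTop C] with x h1 h2 h3
  have hx : 1 ≤ x := hC.trans h3
  have hx0 : 0 < x := by linarith
  rw [one_mul, Real.norm_of_nonneg (Real.log_nonneg hx), Real.norm_of_nonneg (by positivity)] at h1
  have h4 : Real.log (C * x) ≤ 2 * x ^ (0.0001 : ℝ) := by
    rw [Real.log_mul (by linarith) hx0.ne']
    have := Real.log_le_log (by linarith) h3
    linarith
  have e1 : x ^ (0.0001 : ℝ) * x ^ (0.0001 : ℝ) = x ^ (0.0002 : ℝ) := by
    rw [← Real.rpow_add hx0]; norm_num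
  have e2 : x ^ (0.0002 : ℝ) * x ^ (0.0002 : ℝ) = x ^ (0.0004 : ℝ) := by
    rw [← Real.rpow_add hx0]; norm_num
  have h5 : 0 < x ^ (0.0001 : ℝ) := by positivity
  calc 3 * Real.log (C * x) * x ^ (0.0001 : ℝ) + 3
      ≤ 3 * (2 * x ^ (0.0001 : ℝ)) * x ^ (0.0001 : ℝ) + 3 := by gcongr
    _ = 6 * x ^ (0.0002 : ℝ) + 3 := by rw [← e1]; ring
    _ ≤ 9 * x ^ (0.0002 : ℝ) := by linarith
    _ ≤ x ^ (0.0002 : ℝ) * x ^ (0.0002 : ℝ) := by gcongr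
    _ = _ := e2

lemma exists_block {A : Finset ℕ} (h0 : 0 ∉ A) {C : ℕ} (hC : 1 ≤ C) {T₀ : ℕ}
    (hT₀ : ∀ T : ℕ, T₀ ≤ T → (T : ℝ) ^ (1.763 : ℝ) ≤ (words h0 C T).card) :
    ∃ T₁ : ℕ, ∀ T : ℕ, T₁ ≤ T → ∃ B, IsBlock A C T B := by
  classical
  have hev := (tendsto_natCast_atTop_atTop (R := ℝ)).eventually
    (eventually_log_bound C (by exact_mod_cast hC))
  obtain ⟨T₁, hT₁⟩ := Filter.eventually_atTop.1 hev
  refine ⟨max (max T₀ T₁) 1, fun T hT => ?_⟩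
  have hbig := hT₁ T (by omega)
  have hcard := hT₀ T (by omega)
  have hT1 : (1 : ℝ) ≤ T := by exact_mod_cast (by omega : 1 ≤ T)
  have hT0 : (0 : ℝ) < T := by linarith
  set ε : ℝ := (T : ℝ) ^ (-0.0001 : ℝ) with hε
  have hε0 : 0 < ε := by positivity
  have hε1 : ε ≤ 1 := Real.rpow_le_one_of_one_le_of_nonpos hT1 (by norm_num)
  set δ : ℝ := Real.log (1 + ε) with hδ
  have hδε : ε / 2 ≤ δ := by
    have h1 := Real.one_sub_inv_le_log_of_pos (x := 1 + ε) (by linarith)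
    have h2 : ε / 2 ≤ 1 - (1 + ε)⁻¹ := by
      have : 1 - (1 + ε)⁻¹ = ε / (1 + ε) := by field_simp; ring
      rw [this]
      gcongr
      linarith
    linarith
  have hδ0 : 0 < δ := by linarith
  set l : ℝ := Real.log (C * T) with hl
  have hC1 : (1 : ℝ) ≤ C := by exact_mod_cast hC
  have hl0 : 0 ≤ l := Real.log_nonneg (by nlinarith)
  have hTx : 1 ≤ (T : ℝ) ^ (0.0001 : ℝ) := Real.one_le_rpow hT1 (by norm_num)
  set m : ℕ := ⌊(T : ℝ) ^ (0.0004 : ℝ)⌋₊ with hm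
  have hm1 : (T : ℝ) ^ (0.0004 : ℝ) < m + 1 := Nat.lt_floor_add_one _
  have hm2 : (m : ℝ) ≤ (T : ℝ) ^ (0.0004 : ℝ) := Nat.floor_le (by positivity)
  have hsize : ∀ f : ℕ, f ≤ C * T → sizeClass δ f < m := by
    intro f hf
    have h1 : (sizeClass δ f : ℝ) ≤ 3 * l * (T : ℝ) ^ (0.0001 : ℝ) + 1 := by
      rw [sizeClass]
      split_ifs with hf0
      · push_cast; positivity
      · push_cast
        have hfp : (0 : ℝ) < f := by exact_mod_cast Nat.pos_of_ne_zero hf0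
        have h2 : Real.log f ≤ l := Real.log_le_log hfp (by exact_mod_cast hf)
        have h3 : (⌊Real.log f / δ⌋₊ : ℝ) ≤ Real.log f / δ :=
          Nat.floor_le (div_nonneg (Real.log_natCast_nonneg f) hδ0.le)
        have h4 : Real.log f / δ ≤ l / (ε / 2) := by gcongr
        have h5 : l / (ε / 2) = 2 * l * (T : ℝ) ^ (0.0001 : ℝ) := by
          rw [hε, Real.rpow_neg hT0.le]
          field_simp
        have h6 : 0 ≤ l * (T : ℝ) ^ (0.0001 : ℝ) := by positivity
        linarith
    have : (sizeClass δ f : ℝ) < m := by linarith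
    exact_mod_cast this
  have hlen : ∀ w ∈ words h0 C T, w.length < m := by
    intro w hw
    obtain ⟨hwA, -, hwT⟩ := mem_words.1 hw
    have h1 := (two_pow_le_den (pos_of_mem h0 hwA)).trans hwT
    have h2 : ((2 : ℝ)) ^ (w.length / 2) ≤ C * T := by exact_mod_cast h1
    have h3 := Real.log_le_log (by positivity) h2
    rw [Real.log_pow] at h3
    have h4 := Real.log_two_gt_d9
    have h5 : (w.length : ℝ) ≤ 2 * ((w.length / 2 : ℕ) : ℝ) + 1 := by
      exact_mod_cast (by omega : w.length ≤ 2 * (w.length / 2) + 1)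
    have h6 : (0 : ℝ) ≤ ((w.length / 2 : ℕ) : ℝ) := by positivity
    have h7 : ((w.length / 2 : ℕ) : ℝ) * (2 / 3) ≤ l := by
      refine le_trans ?_ h3
      gcongr
      linarith
    have h8 : l * 1 ≤ l * (T : ℝ) ^ (0.0001 : ℝ) := by gcongr
    have : (w.length : ℝ) < m := by linarith
    exact_mod_cast this
  set φ : List ℕ → ℕ × ℕ × ℕ × ℕ × ℕ := fun w =>
    (w.length, sizeClass δ (num' w), sizeClass δ (num w), sizeClass δ (den' w), sizeClass δ (den w))
    with hφ
  set R : Finset (ℕ × ℕ × ℕ × ℕ × ℕ) := Finset.range m ×ˢ Finset.range m ×ˢ Finset.range m ×ˢ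
    Finset.range m ×ˢ Finset.range m with hR
  have hmaps : ∀ w ∈ words h0 C T, φ w ∈ R := by
    intro w hw
    obtain ⟨hwA, -, hwT⟩ := mem_words.1 hw
    have hp := pos_of_mem h0 hwA
    simp only [hR, hφ, Finset.mem_product, Finset.mem_range]
    exact ⟨hlen w hw, hsize _ ((num'_le_den hp).trans hwT), hsize _ ((num_le_den hp).trans hwT),
      hsize _ ((den'_le_den hp).trans hwT), hsize _ hwT⟩
  have hRcard : (R.card : ℝ) = (m : ℝ) ^ 5 := by
    simp only [hR, Finset.card_product, Finset.card_range]
    push_cast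
    ring
  have hne : (words h0 C T).Nonempty := by
    rw [← Finset.card_pos]
    have : (0 : ℝ) < (words h0 C T).card := lt_of_lt_of_le (by positivity) hcard
    exact_mod_cast this
  obtain ⟨w₀, hw₀⟩ := hne
  obtain ⟨y, -, hy⟩ := Finset.exists_le_card_fiber_of_nsmul_le_card_of_maps_to hmaps
    ⟨_, hmaps w₀ hw₀⟩ (b := (T : ℝ) ^ (1.761 : ℝ)) (by
      rw [nsmul_eq_mul, hRcard]
      refine le_trans ?_ hcard
      calc (m : ℝ) ^ 5 * (T : ℝ) ^ (1.761 : ℝ) ≤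
            ((T : ℝ) ^ (0.0004 : ℝ)) ^ 5 * (T : ℝ) ^ (1.761 : ℝ) := by gcongr
        _ = _ := by
            rw [← Real.rpow_natCast, ← Real.rpow_mul hT0.le, ← Real.rpow_add hT0]
            norm_num)
  refine ⟨(words h0 C T).filter fun w => φ w = y, ⟨?_, ?_⟩, ?_, ?_, ?_, hy, ?_⟩
  · intro w hw
    exact pos_of_mem h0 (mem_words.1 (Finset.mem_filter.1 hw).1).1
  · intro w hw v hv
    have := (Finset.mem_filter.1 hw).2.trans (Finset.mem_filter.1 hv).2.symm
    simp only [hφ, Prod.mk.injEq] at this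
    exact this.1
  · intro w hw
    exact (mem_words.1 (Finset.mem_filter.1 hw).1).1
  · intro w hw
    exact (mem_words.1 (Finset.mem_filter.1 hw).1).2.1
  · intro w hw
    exact (mem_words.1 (Finset.mem_filter.1 hw).1).2.2
  · have key : ∀ w ∈ (words h0 C T).filter (fun w => φ w = y),
        ∀ v ∈ (words h0 C T).filter (fun w => φ w = y), φ w = φ v := fun w hw v hv =>
      (Finset.mem_filter.1 hw).2.trans (Finset.mem_filter.1 hv).2.symm
    simp only [hφ, Prod.mk.injEq] at key
    exact ⟨fun w hw v hv => le_of_sizeClass_eq hε0 (key w hw v hv).2.1,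
      fun w hw v hv => le_of_sizeClass_eq hε0 (key w hw v hv).2.2.1,
      fun w hw v hv => le_of_sizeClass_eq hε0 (key w hw v hv).2.2.2.1,
      fun w hw v hv => le_of_sizeClass_eq hε0 (key w hw v hv).2.2.2.2⟩

/-- A narrow uniform family of words over `A` with smallest denominator `h`. -/
structure IsStage (A : Finset ℕ) (X : Finset (List ℕ)) (h : ℕ) : Prop where
  unif : Unif X
  mem : ∀ w ∈ X, ∀ d ∈ w, d ∈ A
  narrow : Narrow (6 / 5 - (h : ℝ) ^ (-(1 / 120000) : ℝ)) X
  le : ∀ w ∈ X, h ≤ den w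
  att : ∃ w ∈ X, den w = h
  card : (h : ℝ) ^ (1.76 : ℝ) ≤ X.card

lemma IsStage.den_le {A : Finset ℕ} {X : Finset (List ℕ)} {h : ℕ} (hX : IsStage A X h)
    {w : List ℕ} (hw : w ∈ X) : (den w : ℝ) ≤ 6 / 5 * h := by
  obtain ⟨v, hv, rfl⟩ := hX.att
  have h1 := hX.narrow.den w hw v hv
  have h2 : (0 : ℝ) ≤ (den v : ℝ) ^ (-(1 / 120000) : ℝ) := by positivity
  nlinarith [Nat.cast_nonneg (α := ℝ) (den v)]

lemma IsStage.den_le_two {A : Finset ℕ} {X : Finset (List ℕ)} {h : ℕ} (hX : IsStage A X h)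
    {w : List ℕ} (hw : w ∈ X) : den w ≤ 2 * h := by
  have h1 := hX.den_le hw
  have : (den w : ℝ) ≤ 2 * h := by linarith [Nat.cast_nonneg (α := ℝ) h]
  exact_mod_cast this

lemma IsStage.pos {A : Finset ℕ} {X : Finset (List ℕ)} {h : ℕ} (hX : IsStage A X h) : 0 < h := by
  obtain ⟨v, hv, rfl⟩ := hX.att
  exact den_pos (hX.unif.pos v hv)

lemma exists_den_eq_min {X : Finset (List ℕ)} (hX : X.Nonempty) :
    ∃ h : ℕ, (∀ w ∈ X, h ≤ den w) ∧ ∃ w ∈ X, den w = h := by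
  obtain ⟨w, hw, hmin⟩ := X.exists_min_image den hX
  exact ⟨den w, hmin, w, hw, rfl⟩

lemma IsBlock.nonempty {A : Finset ℕ} {C T : ℕ} {B : Finset (List ℕ)} (hB : IsBlock A C T B)
    (hT : 0 < T) : B.Nonempty := by
  rw [← Finset.card_pos]
  have h1 : (0 : ℝ) < (T : ℝ) ^ (1.761 : ℝ) := by positivity
  exact_mod_cast h1.trans_le hB.card

lemma mem_of_mem_cat {A : Finset ℕ} {W V : Finset (List ℕ)} (hW : ∀ w ∈ W, ∀ d ∈ w, d ∈ A)
    (hV : ∀ w ∈ V, ∀ d ∈ w, d ∈ A) : ∀ w ∈ cat W V, ∀ d ∈ w, d ∈ A := by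
  intro x hx d hd
  obtain ⟨w, hw, v, hv, rfl⟩ := mem_cat.1 hx
  rcases List.mem_append.1 hd with h | h
  · exact hW w hw d h
  · exact hV v hv d h

lemma eventually_mul_rpow_le (K : ℝ) {a b : ℝ} (hab : a < b) :
    ∀ᶠ x : ℝ in Filter.atTop, K * x ^ a ≤ x ^ b := by
  filter_upwards [(tendsto_rpow_atTop (sub_pos.2 hab)).eventually_ge_atTop K,
    Filter.eventually_gt_atTop 0] with x hx hx0
  calc K * x ^ a ≤ x ^ (b - a) * x ^ a := by gcongr
    _ = x ^ b := by rw [← Real.rpow_add hx0]; ring_nf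

/-- The data of one step of the chain: a stage is extended by a block. -/
structure IsStep (A : Finset ℕ) (C : ℕ) (h h' t : ℕ) (B : Finset (List ℕ)) : Prop where
  block : IsBlock A C t B
  ge : (h : ℝ) ^ (7 / 6 : ℝ) ≤ h'
  le : (h' : ℝ) ≤ 6 * C * (h : ℝ) ^ (7 / 6 : ℝ)
  t_ge : (h : ℝ) ^ (1 / 6 : ℝ) ≤ t
  t_le : (t : ℝ) ≤ 2 * (h : ℝ) ^ (1 / 6 : ℝ)

lemma exists_step {A : Finset ℕ} {C T₁ : ℕ}
    (hT₁ : ∀ T : ℕ, T₁ ≤ T → ∃ B, IsBlock A C T B) :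
    ∃ H₀ : ℕ, ∀ X h, IsStage A X h → H₀ ≤ h →
      ∃ B t h', IsStep A C h h' t B ∧ IsStage A (cat X B) h' := by
  have hev := (tendsto_natCast_atTop_atTop (R := ℝ)).eventually
    (((eventually_mul_rpow_le (12 / 5) (by norm_num : (-(1 / 60000) : ℝ) < -(1 / 120000))).and
      (eventually_mul_rpow_le 2 (by norm_num : (-(7 / 720000) : ℝ) < -(1 / 120000)))).and
      ((eventually_mul_rpow_le T₁ (by norm_num : (0 : ℝ) < 1 / 6)).and
      (eventually_mul_rpow_le ((3 * C : ℝ) ^ (1.76 : ℝ)) (by norm_num : (0 : ℝ) < 1 / 6000))))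
  obtain ⟨H₀, hH₀⟩ := Filter.eventually_atTop.1 hev
  refine ⟨max H₀ 1, fun X h hX hh => ?_⟩
  obtain ⟨⟨e1, e2⟩, e3, e4⟩ := hH₀ h (by omega)
  rw [Real.rpow_zero, mul_one] at e3 e4
  have hh1 : (1 : ℝ) ≤ h := by exact_mod_cast (by omega : 1 ≤ h)
  have hh0 : (0 : ℝ) < h := by linarith
  set q : ℝ := (h : ℝ) ^ (1 / 6 : ℝ) with hq
  have hq1 : 1 ≤ q := Real.one_le_rpow hh1 (by norm_num)
  obtain ⟨t, ht⟩ : ∃ t : ℕ, t = ⌈q⌉₊ := ⟨_, rfl⟩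
  have ht_ge : q ≤ t := ht ▸ Nat.le_ceil q
  have ht_le : (t : ℝ) ≤ 2 * q := by
    have := Nat.ceil_lt_add_one (zero_le_one.trans hq1)
    rw [← ht] at this
    linarith
  have ht1 : (1 : ℝ) ≤ t := hq1.trans ht_ge
  have ht0 : (0 : ℝ) < t := by linarith
  obtain ⟨B, hB⟩ := hT₁ t (by exact_mod_cast e3.trans ht_ge)
  have hBne := hB.nonempty (by exact_mod_cast ht0)
  have hXne : X.Nonempty := ⟨_, hX.att.choose_spec.1⟩
  obtain ⟨h', hmin, x, hx, hatt⟩ := exists_den_eq_min (X := cat X B) (by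
    obtain ⟨w, hw⟩ := hXne
    obtain ⟨b, hb⟩ := hBne
    exact ⟨_, mem_cat.2 ⟨w, hw, b, hb, rfl⟩⟩)
  have hge : (h : ℝ) * t ≤ h' := by
    obtain ⟨w, hw, b, hb, rfl⟩ := mem_cat.1 hx
    rw [← hatt]
    have h1 : h * t ≤ den (w ++ b) :=
      (Nat.mul_le_mul (hX.le w hw) (hB.le b hb)).trans den_mul_le
    exact_mod_cast h1
  have hle : (h' : ℝ) ≤ 3 * C * (h * t) := by
    obtain ⟨w, hw, b, hb, rfl⟩ := mem_cat.1 hx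
    rw [← hatt]
    have h1 : (den (w ++ b) : ℝ) ≤ 2 * (den w * den b) := by
      exact_mod_cast den_append_le (hX.unif.pos w hw) (hB.unif.pos b hb)
    have h2 : (den b : ℝ) ≤ C * t := by exact_mod_cast hB.ge b hb
    have h3 := hX.den_le hw
    have h4 : (0 : ℝ) ≤ h * (C * t) := by positivity
    calc (den (w ++ b) : ℝ) ≤ 2 * (den w * den b) := h1
      _ ≤ 2 * ((6 / 5 * h) * (C * t)) := by gcongr
      _ ≤ 3 * C * (h * t) := by linarith
  have hpow : (h : ℝ) * q = (h : ℝ) ^ (7 / 6 : ℝ) := by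
    rw [hq, ← Real.rpow_one_add' hh0.le (by norm_num)]; norm_num
  have hge' : (h : ℝ) ^ (7 / 6 : ℝ) ≤ h' := by
    rw [← hpow]
    exact (by gcongr : (h : ℝ) * q ≤ h * t).trans hge
  have hh'0 : (0 : ℝ) < h' := lt_of_lt_of_le (by positivity) hge
  refine ⟨B, t, h', ⟨hB, hge', ?_, ht_ge, ht_le⟩, hX.unif.cat hB.unif, mem_of_mem_cat hX.mem hB.mem,
    ?_, hmin, ⟨x, hx, hatt⟩, ?_⟩
  · rw [← hpow]
    calc (h' : ℝ) ≤ 3 * C * (h * t) := hle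
      _ ≤ 3 * C * (h * (2 * q)) := by gcongr
      _ = _ := by ring
  · have h5 : (0 : ℝ) ≤ 6 / 5 - (h : ℝ) ^ (-(1 / 120000) : ℝ) := by
      have := Real.rpow_le_one_of_one_le_of_nonpos hh1 (by norm_num : (-(1 / 120000) : ℝ) ≤ 0)
      linarith
    refine (hX.narrow.cat h5 hB.narrow).mono ?_
    have h6 : (t : ℝ) ^ (-0.0001 : ℝ) ≤ (h : ℝ) ^ (-(1 / 60000) : ℝ) := by
      calc (t : ℝ) ^ (-0.0001 : ℝ) ≤ q ^ (-0.0001 : ℝ) :=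
            Real.rpow_le_rpow_of_nonpos (by positivity) ht_ge (by norm_num)
        _ = _ := by rw [hq, ← Real.rpow_mul hh0.le]; norm_num
    have h7 : (h' : ℝ) ^ (-(1 / 120000) : ℝ) ≤ (h : ℝ) ^ (-(7 / 720000) : ℝ) := by
      calc (h' : ℝ) ^ (-(1 / 120000) : ℝ) ≤ ((h : ℝ) ^ (7 / 6 : ℝ)) ^ (-(1 / 120000) : ℝ) :=
            Real.rpow_le_rpow_of_nonpos (by positivity) hge' (by norm_num)
        _ = _ := by rw [← Real.rpow_mul hh0.le]; norm_num
    have h8 : (0 : ℝ) ≤ (t : ℝ) ^ (-0.0001 : ℝ) := by positivity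
    have h9 : (0 : ℝ) ≤ (h : ℝ) ^ (-(1 / 120000) : ℝ) := by positivity
    nlinarith
  · rw [card_cat hX.unif]
    push_cast
    have h5 : (3 * C : ℝ) ^ (1.76 : ℝ) ≤ (t : ℝ) ^ (0.001 : ℝ) := by
      calc (3 * C : ℝ) ^ (1.76 : ℝ) ≤ (h : ℝ) ^ (1 / 6000 : ℝ) := e4
        _ = q ^ (0.001 : ℝ) := by rw [hq, ← Real.rpow_mul hh0.le]; norm_num
        _ ≤ _ := by gcongr
    calc (h' : ℝ) ^ (1.76 : ℝ) ≤ (3 * C * (h * t)) ^ (1.76 : ℝ) := by gcongr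
      _ = (3 * C : ℝ) ^ (1.76 : ℝ) * ((h : ℝ) ^ (1.76 : ℝ) * (t : ℝ) ^ (1.76 : ℝ)) := by
        rw [Real.mul_rpow (by positivity) (by positivity), Real.mul_rpow hh0.le ht0.le]
      _ ≤ (t : ℝ) ^ (0.001 : ℝ) * ((h : ℝ) ^ (1.76 : ℝ) * (t : ℝ) ^ (1.76 : ℝ)) := by gcongr
      _ = (h : ℝ) ^ (1.76 : ℝ) * (t : ℝ) ^ (1.761 : ℝ) := by
        rw [mul_left_comm, ← Real.rpow_add ht0]; norm_num
      _ ≤ X.card * B.card := by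
        gcongr
        · exact hX.card
        · exact hB.card

lemma exists_stage {A : Finset ℕ} {C T₁ : ℕ} (hC : 1 ≤ C)
    (hT₁ : ∀ T : ℕ, T₁ ≤ T → ∃ B, IsBlock A C T B) (H : ℕ) :
    ∃ X h, IsStage A X h ∧ H ≤ h := by
  have hC1 : (1 : ℝ) ≤ C := by exact_mod_cast hC
  have hev := (tendsto_natCast_atTop_atTop (R := ℝ)).eventually
    ((eventually_mul_rpow_le 10 (by norm_num : (-0.0001 : ℝ) < 0)).and
      ((eventually_mul_rpow_le 10 (by norm_num : (-(1 / 120000) : ℝ) < 0)).and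
      (eventually_mul_rpow_le ((C : ℝ) ^ (1.76 : ℝ)) (by norm_num : (1.76 : ℝ) < 1.761))))
  obtain ⟨T₂, hT₂⟩ := Filter.eventually_atTop.1 hev
  obtain ⟨T, hT⟩ : ∃ T, T = max (max T₁ T₂) (max H 1) := ⟨_, rfl⟩
  obtain ⟨e1, e2, e3⟩ := hT₂ T (by omega)
  rw [Real.rpow_zero] at e1 e2
  obtain ⟨B, hB⟩ := hT₁ T (by omega)
  have hT0 : (0 : ℝ) < T := by exact_mod_cast (by omega : 0 < T)
  obtain ⟨h, hmin, x, hx, hatt⟩ := exists_den_eq_min (hB.nonempty (by omega))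
  have hge : T ≤ h := hatt ▸ hB.le x hx
  have hle : (h : ℝ) ≤ C * T := by
    rw [← hatt]
    exact_mod_cast hB.ge x hx
  refine ⟨B, h, ⟨hB.unif, hB.mem, hB.narrow.mono ?_, hmin, ⟨x, hx, hatt⟩, ?_⟩, by omega⟩
  · have : (h : ℝ) ^ (-(1 / 120000) : ℝ) ≤ (T : ℝ) ^ (-(1 / 120000) : ℝ) :=
      Real.rpow_le_rpow_of_nonpos hT0 (by exact_mod_cast hge) (by norm_num)
    linarith
  · calc (h : ℝ) ^ (1.76 : ℝ) ≤ (C * T) ^ (1.76 : ℝ) := by gcongr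
      _ = (C : ℝ) ^ (1.76 : ℝ) * (T : ℝ) ^ (1.76 : ℝ) := Real.mul_rpow (by positivity) hT0.le
      _ ≤ _ := e3.trans hB.card

/-- A sequence of stages, each obtained from the previous one by appending a block. -/
structure IsChain (A : Finset ℕ) (C : ℕ) (X B : ℕ → Finset (List ℕ)) (h t : ℕ → ℕ) : Prop where
  two_le : ∀ i, 2 ≤ h i
  stage : ∀ i, IsStage A (X i) (h i)
  step : ∀ i, IsStep A C (h i) (h (i + 1)) (t i) (B i)
  succ : ∀ i, X (i + 1) = cat (X i) (B i)

lemma exists_chain {A : Finset ℕ} {C T₁ : ℕ} (hC : 1 ≤ C)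
    (hT₁ : ∀ T : ℕ, T₁ ≤ T → ∃ B, IsBlock A C T B) :
    ∃ X B h t, IsChain A C X B h t := by
  obtain ⟨H₀, hstep⟩ := exists_step hT₁
  obtain ⟨X₀, h₀, hX₀, hh₀⟩ := exists_stage hC hT₁ (max H₀ 2)
  choose! B t h' hs hstage using hstep
  let next : Finset (List ℕ) × ℕ → Finset (List ℕ) × ℕ := fun p => (cat p.1 (B p.1 p.2), h' p.1 p.2)
  let state : ℕ → Finset (List ℕ) × ℕ := fun n => next^[n] (X₀, h₀)
  have hsucc : ∀ n, state (n + 1) = next (state n) := fun n => Function.iterate_succ_apply' next n _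
  have hinv : ∀ n, IsStage A (state n).1 (state n).2 ∧ max H₀ 2 ≤ (state n).2 := by
    intro n
    induction n with
    | zero => exact ⟨hX₀, hh₀⟩
    | succ n ih =>
      have h1 : H₀ ≤ (state n).2 := by omega
      rw [hsucc]
      refine ⟨hstage _ _ ih.1 h1, ih.2.trans ?_⟩
      have h2 := (hs _ _ ih.1 h1).ge
      have h3 : (1 : ℝ) ≤ (state n).2 := by exact_mod_cast (by omega : 1 ≤ (state n).2)
      have h4 := Real.rpow_le_rpow_of_exponent_le h3 (by norm_num : (1 : ℝ) ≤ 7 / 6)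
      rw [Real.rpow_one] at h4
      exact_mod_cast h4.trans h2
  refine ⟨fun n => (state n).1, fun n => B (state n).1 (state n).2, fun n => (state n).2,
    fun n => t (state n).1 (state n).2, fun n => ?_, fun n => (hinv n).1, fun n => ?_, fun n => ?_⟩
  · have := (hinv n).2
    omega
  · simp only [hsucc]
    exact hs _ _ (hinv n).1 (by have := (hinv n).2; omega)
  · simp only [hsucc]
    rfl

lemma IsChain.strictMono {A : Finset ℕ} {C : ℕ} {X B : ℕ → Finset (List ℕ)} {h t : ℕ → ℕ}
    (hc : IsChain A C X B h t) : StrictMono h := by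
  refine strictMono_nat_of_lt_succ fun i => ?_
  have h1 : (1 : ℝ) < h i := by exact_mod_cast hc.two_le i
  have h2 := Real.rpow_lt_rpow_of_exponent_lt h1 (by norm_num : (1 : ℝ) < 7 / 6)
  rw [Real.rpow_one] at h2
  exact_mod_cast h2.trans_le (hc.step i).ge

lemma IsChain.exists_scale {A : Finset ℕ} {C : ℕ} {X B : ℕ → Finset (List ℕ)} {h t : ℕ → ℕ}
    (hc : IsChain A C X B h t) {y : ℝ} (hy : (h 0 : ℝ) < y) :
    ∃ i, (h i : ℝ) < y ∧ y ≤ h (i + 1) ∧ (h (i + 1) : ℝ) ≤ 6 * C * y ^ (7 / 6 : ℝ) := by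
  classical
  have hex : ∃ i, y ≤ h i := by
    obtain ⟨n, hn⟩ := exists_nat_ge y
    exact ⟨n, hn.trans (by exact_mod_cast hc.strictMono.le_apply)⟩
  obtain ⟨i, hi⟩ : ∃ i, Nat.find hex = i + 1 := by
    refine Nat.exists_eq_succ_of_ne_zero fun h0 => ?_
    have := Nat.find_spec hex
    rw [h0] at this
    linarith
  have h1 : (h i : ℝ) < y := not_le.1 (Nat.find_min hex (by omega))
  refine ⟨i, h1, hi ▸ Nat.find_spec hex, (hc.step i).le.trans ?_⟩
  gcongr

lemma cat_singleton_nil (W : Finset (List ℕ)) : cat W {[]} = W := by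
  ext x
  simp [mem_cat]

lemma unif_singleton_nil : Unif {[]} :=
  ⟨fun w hw => by
      rw [Finset.mem_singleton.1 hw]
      simp [Pos],
    fun w hw v hv => by rw [Finset.mem_singleton.1 hw, Finset.mem_singleton.1 hv]⟩

lemma IsChain.exists_rest {A : Finset ℕ} {C : ℕ} {X B : ℕ → Finset (List ℕ)} {h t : ℕ → ℕ}
    (hc : IsChain A C X B h t) {i j : ℕ} (hij : i ≤ j) : ∃ R, Unif R ∧ X j = cat (X i) R := by
  induction j, hij using Nat.le_induction with
  | base => exact ⟨{[]}, unif_singleton_nil, (cat_singleton_nil _).symm⟩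
  | succ j _ ih =>
    obtain ⟨R, hR, hj⟩ := ih
    exact ⟨cat R (B j), hR.cat (hc.step j).block.unif, by rw [hc.succ, hj, cat_assoc]⟩

/-- The reversals of the words of a set. -/
def reversal (S : Finset (List ℕ)) : Finset (List ℕ) := S.image List.reverse

lemma mem_reversal {S : Finset (List ℕ)} {w : List ℕ} : w ∈ reversal S ↔ w.reverse ∈ S := by
  rw [reversal, Finset.mem_image]
  constructor
  · rintro ⟨v, hv, rfl⟩
    rwa [List.reverse_reverse]
  · exact fun h => ⟨_, h, List.reverse_reverse w⟩

lemma reversal_cat (W V : Finset (List ℕ)) :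
    reversal (cat W V) = cat (reversal V) (reversal W) := by
  ext x
  simp only [mem_reversal, mem_cat]
  constructor
  · rintro ⟨w, hw, v, hv, h⟩
    exact ⟨v.reverse, by rwa [List.reverse_reverse], w.reverse, by rwa [List.reverse_reverse],
      by rw [← List.reverse_append, h, List.reverse_reverse]⟩
  · rintro ⟨v, hv, w, hw, rfl⟩
    exact ⟨_, hw, _, hv, by rw [List.reverse_append]⟩

lemma card_reversal (S : Finset (List ℕ)) : (reversal S).card = S.card :=
  Finset.card_image_of_injective _ List.reverse_injective

lemma Unif.reversal {S : Finset (List ℕ)} (hS : Unif S) : Unif (reversal S) := by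
  constructor
  · intro w hw
    have := (hS.pos _ (mem_reversal.1 hw)).reverse
    rwa [List.reverse_reverse] at this
  · intro w hw v hv
    have := hS.len _ (mem_reversal.1 hw) _ (mem_reversal.1 hv)
    rwa [List.length_reverse, List.length_reverse] at this

lemma den_reverse (w : List ℕ) : den w.reverse = den w := (reverse_formula w).2.2.2

/-- Words built from two stages of a chain and a block have size `N` and are supported on `A`. -/
lemma IsBlock.den_bounds {A : Finset ℕ} {C N h h' T : ℕ} {X M X' : Finset (List ℕ)}
    (hX : IsStage A X h) (hX' : IsStage A X' h') (hM : IsBlock A C T M)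
    (hT0 : 0 < T) (hT : T = N / (6 * C * (h * h'))) {γ : List ℕ}
    (hγ : γ ∈ cat X (cat M (reversal X'))) :
    den γ ≤ N ∧ N ≤ 12 * C * den γ ∧ N ≤ 12 * C * (T * h') * h := by
  obtain ⟨w, hw, x, hx, rfl⟩ := mem_cat.1 hγ
  obtain ⟨b, hb, g, hg, rfl⟩ := mem_cat.1 hx
  rw [mem_reversal] at hg
  have hgden := den_reverse g
  have p1 := hX.unif.pos w hw
  have p2 := hM.unif.pos b hb
  have p3 : Pos g := by
    have := (hX'.unif.pos _ hg).reverse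
    rwa [List.reverse_reverse] at this
  have a1 := hX.le w hw
  have a2 := hM.le b hb
  have a3 := hX'.le _ hg
  have b1 := hX.den_le hw
  have b2 : (den b : ℝ) ≤ C * T := by exact_mod_cast hM.ge b hb
  have b3 := hX'.den_le hg
  rw [hgden] at a3 b3
  have hpos : 0 < 6 * C * (h * h') := by
    refine Nat.pos_of_ne_zero fun h0 => ?_
    rw [h0, Nat.div_zero] at hT
    omega
  have hTN : T * (6 * C * (h * h')) ≤ N := hT ▸ Nat.div_mul_le_self _ _
  have hNT : N ≤ 12 * C * (T * h') * h := by
    have h1 : N < (T + 1) * (6 * C * (h * h')) := by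
      rw [mul_comm, hT]
      exact Nat.lt_mul_div_succ N hpos
    have h2 : (T + 1) * (6 * C * (h * h')) ≤ 2 * T * (6 * C * (h * h')) := by
      gcongr
      omega
    calc N ≤ 2 * T * (6 * C * (h * h')) := h1.le.trans h2
      _ = _ := by ring
  refine ⟨?_, ?_, hNT⟩
  · have h1 : (den (w ++ (b ++ g)) : ℝ) ≤ 2 * (den w * den (b ++ g)) := by
      exact_mod_cast den_append_le p1 (p2.append p3)
    have h2 : (den (b ++ g) : ℝ) ≤ 2 * (den b * den g) := by
      exact_mod_cast den_append_le p2 p3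
    have h3 : (T : ℝ) * (6 * C * (h * h')) ≤ N := by exact_mod_cast hTN
    have h4 : (0 : ℝ) ≤ T * (C * (h * h')) := by positivity
    have h5 : (den (w ++ (b ++ g)) : ℝ) ≤ N := by
      calc (den (w ++ (b ++ g)) : ℝ) ≤ 2 * (den w * (2 * (den b * den g))) := h1.trans (by gcongr)
        _ ≤ 2 * ((6 / 5 * h) * (2 * ((C * T) * (6 / 5 * h')))) := by gcongr
        _ ≤ N := by linarith
    exact_mod_cast h5
  · have h1 : h * (T * h') ≤ den (w ++ (b ++ g)) :=
      calc h * (T * h') ≤ den w * (den b * den g) := by gcongr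
        _ ≤ den w * den (b ++ g) := by
          gcongr
          exact den_mul_le
        _ ≤ _ := den_mul_le
    calc N ≤ 12 * C * (T * h') * h := hNT
      _ = 12 * C * (h * (T * h')) := by ring
      _ ≤ _ := by gcongr

/-- Lower bounds on `P` required to select stages at scale `P`. -/
structure IsLarge (C h₀ : ℕ) (P : ℝ) : Prop where
  thousand : 1000 ≤ P
  stage : 6 * C * P ^ (7 / 6 : ℝ) ≤ P ^ (1.168 : ℝ)
  step : 2 * P ^ (1.168 / 6 : ℝ) ≤ P ^ (0.195 : ℝ)
  last : 6 * C * P ^ (7 / 36 : ℝ) ≤ P ^ (0.195 : ℝ)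
  start : (h₀ : ℝ) < P ^ (1 / 6 : ℝ)

lemma eventually_isLarge (C h₀ : ℕ) : ∀ᶠ P : ℝ in Filter.atTop, IsLarge C h₀ P := by
  filter_upwards [Filter.eventually_ge_atTop 1000,
    eventually_mul_rpow_le (6 * C) (by norm_num : (7 / 6 : ℝ) < 1.168),
    eventually_mul_rpow_le 2 (by norm_num : (1.168 / 6 : ℝ) < 0.195),
    eventually_mul_rpow_le (6 * C) (by norm_num : (7 / 36 : ℝ) < 0.195),
    (tendsto_rpow_atTop (by norm_num : (0 : ℝ) < 1 / 6)).eventually_gt_atTop (h₀ : ℝ)]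
    with P h1 h2 h3 h4 h5
  exact ⟨h1, h2, h3, h4, h5⟩

lemma IsChain.exists_stage_at {A : Finset ℕ} {C : ℕ} {X B : ℕ → Finset (List ℕ)} {h t : ℕ → ℕ}
    (hc : IsChain A C X B h t) {P : ℝ} (hP : IsLarge C (h 0) P) :
    ∃ i, P ≤ h i ∧ (h i : ℝ) ≤ P ^ (1.168 : ℝ) := by
  have hP1 : 1 ≤ P := by linarith [hP.thousand]
  have hstart : (h 0 : ℝ) < P := by
    have := Real.rpow_le_rpow_of_exponent_le hP1 (by norm_num : (1 / 6 : ℝ) ≤ 1)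
    rw [Real.rpow_one] at this
    exact hP.start.trans_le this
  obtain ⟨i, -, h2, h3⟩ := hc.exists_scale hstart
  exact ⟨i + 1, h2, h3.trans hP.stage⟩

lemma IsStage.den_mem_window {A : Finset ℕ} {X : Finset (List ℕ)} {h : ℕ} (hX : IsStage A X h) :
    ∀ w ∈ X, h ≤ den w ∧ den w ≤ 2 * h := fun w hw => ⟨hX.le w hw, hX.den_le_two hw⟩

lemma exists_ensemble {A : Finset ℕ} {C T₁ : ℕ} (hC : 1 ≤ C)
    (hT₁ : ∀ T : ℕ, T₁ ≤ T → ∃ B, IsBlock A C T B) :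
    ∃ κ c : ℕ, ∃ P₀ : ℝ, 1000 ≤ P₀ ∧ ∃ N₂ : ℕ, ∀ N : ℕ, N₂ ≤ N → ∃ Ω, Ensemble N κ c P₀ Ω ∧
      ∀ γ ∈ Ω, ∀ d ∈ γ, d ∈ A := by
  obtain ⟨X, B, h, t, hc⟩ := exists_chain hC hT₁
  obtain ⟨P₀, hP₀⟩ := Filter.eventually_atTop.1 (eventually_isLarge C (h 0))
  have hev := (tendsto_natCast_atTop_atTop (R := ℝ)).eventually
    ((((tendsto_rpow_atTop (by norm_num : (0 : ℝ) < 0.0935)).eventually_gt_atTop (h 0 : ℝ)).and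
      (eventually_mul_rpow_le (6 * C) (by norm_num : (0.66 * (7 / 6) : ℝ) < 0.78))).and
      ((eventually_mul_rpow_le (6 * C) (by norm_num : (0.0935 * (7 / 6) : ℝ) < 0.11)).and
      (eventually_mul_rpow_le ((T₁ + 1) * (6 * C)) (by norm_num : (0.89 : ℝ) < 1))))
  obtain ⟨N₂, hN₂⟩ := Filter.eventually_atTop.1 hev
  refine ⟨12 * C, (12 * C) ^ 2, max P₀ 1000, le_max_right _ _, max N₂ 2, fun N hN => ?_⟩
  obtain ⟨⟨n1, n2⟩, n3, n4⟩ := hN₂ N (by omega)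
  have hN1 : (1 : ℝ) < N := by exact_mod_cast (by omega : 1 < N)
  have hN0 : (0 : ℝ) < N := by linarith
  have hCc : C ≤ (12 * C) ^ 2 := by nlinarith
  have hc2 : 2 ≤ (12 * C) ^ 2 := by nlinarith
  obtain ⟨j, -, hj1, hj2⟩ := hc.exists_scale (n1.trans_le
    (Real.rpow_le_rpow_of_exponent_le hN1.le (by norm_num : (0.0935 : ℝ) ≤ 0.66)))
  obtain ⟨k, -, hk1, hk2⟩ := hc.exists_scale n1
  rw [← Real.rpow_mul hN0.le] at hj2 hk2
  replace hj2 := hj2.trans n2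
  replace hk2 := hk2.trans n3
  have hX := hc.stage (j + 1)
  have hX' := hc.stage (k + 1)
  generalize hJ : j + 1 = J at *
  generalize hK : k + 1 = K at *
  obtain ⟨T, hT⟩ : ∃ T, T = N / (6 * C * (h J * h K)) := ⟨_, rfl⟩
  have hhJ := hX.pos
  have hhK := hX'.pos
  have hTge : T₁ + 1 ≤ T := by
    rw [hT, Nat.le_div_iff_mul_le (by positivity)]
    have h1 : ((T₁ : ℝ) + 1) * (6 * C * (h J * h K)) ≤ N := by
      calc ((T₁ : ℝ) + 1) * (6 * C * (h J * h K))
          ≤ (T₁ + 1) * (6 * C * ((N : ℝ) ^ (0.78 : ℝ) * (N : ℝ) ^ (0.11 : ℝ))) := by gcongr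
        _ = (T₁ + 1) * (6 * C) * (N : ℝ) ^ (0.89 : ℝ) := by
          rw [← Real.rpow_add hN0]; norm_num; ring
        _ ≤ N := by rwa [Real.rpow_one] at n4
    exact_mod_cast h1
  obtain ⟨M, hM⟩ := hT₁ T (by omega)
  have hT0 : 0 < T := by omega
  have hT1 : (1 : ℝ) ≤ T := by exact_mod_cast hT0
  have hYmem : ∀ w ∈ reversal (X K), ∀ d ∈ w, d ∈ A := fun w hw d hd =>
    hX'.mem _ (mem_reversal.1 hw) d (List.mem_reverse.2 hd)
  have hYunif := hX'.unif.reversal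
  have hMY := hM.unif.cat hYunif
  have hne : (cat (X J) (cat M (reversal (X K)))).Nonempty := by
    obtain ⟨w, hw, -⟩ := hX.att
    obtain ⟨g, hg, -⟩ := hX'.att
    obtain ⟨b, hb⟩ := hM.nonempty hT0
    exact ⟨_, mem_cat.2 ⟨w, hw, _, mem_cat.2 ⟨b, hb, g.reverse,
      mem_reversal.2 (by rwa [List.reverse_reverse]), rfl⟩, rfl⟩⟩
  have hbounds := fun γ hγ => IsBlock.den_bounds (γ := γ) hX hX' hM hT0 hT hγ
  refine ⟨cat (X J) (cat M (reversal (X K))), ⟨hX.unif.cat hMY, hne, fun γ hγ => (hbounds γ hγ).1,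
    fun γ hγ => (hbounds γ hγ).2.1, ?_, ?_, ?_⟩,
    mem_of_mem_cat hX.mem (mem_of_mem_cat hM.mem hYmem)⟩
  · intro P hP hPN
    have hlarge := hP₀ P ((le_max_left _ _).trans hP)
    have hP1 : 1 ≤ P := by linarith [hlarge.thousand]
    have hP0 : 0 < P := by linarith
    obtain ⟨i, hi1, hi2⟩ := hc.exists_stage_at hlarge
    have hiJ : i < J := by
      refine hc.strictMono.lt_iff_lt.1 ?_
      have : (h i : ℝ) < h J := by
        calc (h i : ℝ) ≤ P ^ (1.168 : ℝ) := hi2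
          _ ≤ ((N : ℝ) ^ (0.56 : ℝ)) ^ (1.168 : ℝ) := by gcongr
          _ = (N : ℝ) ^ (0.65408 : ℝ) := by rw [← Real.rpow_mul hN0.le]; norm_num
          _ < (N : ℝ) ^ (0.66 : ℝ) := Real.rpow_lt_rpow_of_exponent_lt hN1 (by norm_num)
          _ ≤ h J := hj1
      exact_mod_cast this
    obtain ⟨R, hR, hXR⟩ := hc.exists_rest (Nat.succ_le_of_lt hiJ)
    have hS := hc.stage i
    have hstep := hc.step i
    have hti : P ^ (0.1666 : ℝ) ≤ t i := by
      calc P ^ (0.1666 : ℝ) ≤ P ^ (1 / 6 : ℝ) :=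
            Real.rpow_le_rpow_of_exponent_le hP1 (by norm_num)
        _ ≤ (h i : ℝ) ^ (1 / 6 : ℝ) := by gcongr
        _ ≤ t i := hstep.t_ge
    have hti1 : (1 : ℝ) ≤ t i := (Real.one_le_rpow hP1 (by norm_num)).trans hti
    refine ⟨X i, B i, cat R (cat M (reversal (X K))), h i, t i, ?_, hS.unif, hstep.block.unif,
      hR.cat hMY, hi1, hi2, hS.den_mem_window, hS.card, hti, ?_, fun b hb => ⟨hstep.block.le b hb,
      (hstep.block.ge b hb).trans (by gcongr)⟩, ?_⟩
    · rw [hXR, hc.succ, cat_assoc, cat_assoc]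
    · calc (t i : ℝ) ≤ 2 * (h i : ℝ) ^ (1 / 6 : ℝ) := hstep.t_le
        _ ≤ 2 * (P ^ (1.168 : ℝ)) ^ (1 / 6 : ℝ) := by gcongr
        _ = 2 * P ^ (1.168 / 6 : ℝ) := by rw [← Real.rpow_mul hP0.le]; norm_num
        _ ≤ _ := hlarge.step
    · exact (Real.rpow_le_rpow_of_exponent_le hti1 (by norm_num)).trans hstep.block.card
  · intro P hP hPN
    have hlarge := hP₀ P ((le_max_left _ _).trans hP)
    have hP1 : 1 ≤ P := by linarith [hlarge.thousand]
    have hP0 : 0 < P := by linarith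
    obtain ⟨i, hi1, hi2⟩ := hc.exists_stage_at hlarge
    have hiJ : i ≤ J := by
      refine hc.strictMono.le_iff_le.1 ?_
      have : (h i : ℝ) ≤ h J := by
        calc (h i : ℝ) ≤ P ^ (1.168 : ℝ) := hi2
          _ ≤ ((N : ℝ) ^ (0.56 : ℝ)) ^ (1.168 : ℝ) := by gcongr
          _ = (N : ℝ) ^ (0.65408 : ℝ) := by rw [← Real.rpow_mul hN0.le]; norm_num
          _ ≤ (N : ℝ) ^ (0.66 : ℝ) := Real.rpow_le_rpow_of_exponent_le hN1.le (by norm_num)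
          _ ≤ h J := hj1
      exact_mod_cast this
    obtain ⟨R, hR, hXR⟩ := hc.exists_rest hiJ
    obtain ⟨l, hl1, hl2, hl3⟩ := hc.exists_scale hlarge.start
    have hlK : l + 1 ≤ K := by
      refine Nat.succ_le_of_lt (hc.strictMono.lt_iff_lt.1 ?_)
      have : (h l : ℝ) < h K := by
        calc (h l : ℝ) < P ^ (1 / 6 : ℝ) := hl1
          _ ≤ ((N : ℝ) ^ (0.56 : ℝ)) ^ (1 / 6 : ℝ) := by gcongr
          _ = (N : ℝ) ^ (0.56 / 6 : ℝ) := by rw [← Real.rpow_mul hN0.le]; norm_num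
          _ ≤ (N : ℝ) ^ (0.0935 : ℝ) := Real.rpow_le_rpow_of_exponent_le hN1.le (by norm_num)
          _ ≤ h K := hk1
      exact_mod_cast this
    obtain ⟨R', hR', hXR'⟩ := hc.exists_rest hlK
    have hS := hc.stage i
    have hS' := hc.stage (l + 1)
    refine ⟨X i, cat R (cat M (reversal R')), reversal (X (l + 1)), h i, h (l + 1), ?_, hS.unif,
      hR.cat (hM.unif.cat hR'.reversal), hS'.unif.reversal, hi1, hi2, hS.den_mem_window, hS.card,
      ?_, ?_, ?_, ?_⟩
    · rw [hXR, hXR', reversal_cat]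
      simp only [cat_assoc]
    · exact (Real.rpow_le_rpow_of_exponent_le hP1 (by norm_num)).trans hl2
    · rw [← Real.rpow_mul hP0.le] at hl3
      refine hl3.trans (le_trans (le_of_eq ?_) hlarge.last)
      norm_num
    · intro g hg
      have h1 := hS'.den_mem_window _ (mem_reversal.1 hg)
      rw [den_reverse] at h1
      exact ⟨h1.1, h1.2.trans (by gcongr)⟩
    · rw [card_reversal]
      exact hS'.card
  · refine ⟨X J, cat M (reversal (X K)), h J, rfl, hX.unif, hMY, hj1, hj2, hX.den_mem_window,
      hX.card, ?_⟩
    have h1 : (N : ℝ) / h J ≤ 12 * C * (T * h K) := by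
      rw [div_le_iff₀ (by exact_mod_cast hhJ)]
      obtain ⟨γ, hγ⟩ := hne
      exact_mod_cast (hbounds γ hγ).2.2
    have h2 : (1 : ℝ) ≤ 12 * C := by
      have : (1 : ℝ) ≤ C := by exact_mod_cast hC
      linarith
    rw [card_cat hM.unif, card_reversal]
    push_cast
    calc ((N : ℝ) / h J) ^ (1.76 : ℝ) ≤ (12 * C * (T * h K)) ^ (1.76 : ℝ) := by gcongr
      _ = (12 * C : ℝ) ^ (1.76 : ℝ) * ((T : ℝ) ^ (1.76 : ℝ) * (h K : ℝ) ^ (1.76 : ℝ)) := by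
        rw [Real.mul_rpow (x := 12 * (C : ℝ)) (by positivity) (by positivity),
          Real.mul_rpow (x := (T : ℝ)) (by positivity) (by positivity)]
      _ ≤ (12 * C : ℝ) ^ (2 : ℝ) * ((T : ℝ) ^ (1.761 : ℝ) * (h K : ℝ) ^ (1.76 : ℝ)) := by
        gcongr <;> first | assumption | norm_num
      _ ≤ (12 * C : ℝ) ^ 2 * (M.card * (X K).card) := by
        rw [Real.rpow_two]
        gcongr
        · exact hM.card
        · exact hX'.card

lemma image_den_subset {A : Finset ℕ} (h0 : 0 ∉ A) {N κ c : ℕ} {P₀ : ℝ}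
    {Ω : Finset (List ℕ)} (hΩ : Ensemble N κ c P₀ Ω) (hmem : ∀ γ ∈ Ω, ∀ d ∈ γ, d ∈ A)
    (hκ : κ < N) : ((Ω.image den : Finset ℕ) : Set ℕ) ⊆ Dset A N := by
  intro d hd
  rw [Finset.mem_coe, Finset.mem_image] at hd
  obtain ⟨γ, hγ, rfl⟩ := hd
  refine ⟨hΩ.den_le γ hγ, num γ, coprime_num_den γ, γ, ?_, hmem γ hγ,
    cfValue_eq (pos_of_mem h0 (hmem γ hγ))⟩
  rintro rfl
  have := hΩ.le_den _ hγ
  simp [den, act] at this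
  omega

lemma lt_critical : (0.8815 : ℝ) ≤ 1 - 5 / (Real.sqrt 369 + 23) := by
  have h1 : (19.2 : ℝ) ≤ Real.sqrt 369 := Real.le_sqrt_of_sq_le (by norm_num)
  have h2 : 5 / (Real.sqrt 369 + 23) ≤ 0.1185 := by
    rw [div_le_iff₀ (by linarith)]
    linarith
  linarith

end Zaremba

theorem positive_proportion_of_dimH_gt
    (A : Finset ℕ) (hcard : 2 ≤ A.card) (hpos : 0 ∉ A)
    (hdim : ENNReal.ofReal (1 - 5 / (Real.sqrt 369 + 23)) < dimH (Eset A)) :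
    ∃ c : ℝ, 0 < c ∧ ∃ N₀ : ℕ, ∀ N : ℕ, N₀ ≤ N →
      c * (N : ℝ) ≤ ((Dset A N).ncard : ℝ) := by
  classical
  have hC : ∀ d ∈ A, d + 1 ≤ A.sup id + 1 := fun d hd =>
    Nat.succ_le_succ (Finset.le_sup (f := id) hd)
  obtain ⟨T₀, hT₀⟩ := Zaremba.card_words_ge hpos hC (s := (0.8815 : ℝ).toNNReal)
    ((ENNReal.ofReal_le_ofReal Zaremba.lt_critical).trans_lt hdim)
  rw [Real.coe_toNNReal _ (by norm_num)] at hT₀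
  norm_num at hT₀
  obtain ⟨T₁, hT₁⟩ := Zaremba.exists_block hpos (Nat.le_add_left 1 _) (T₀ := T₀)
    (by norm_num; exact hT₀)
  obtain ⟨κ, c, P₀, hP₀, N₂, hens⟩ := Zaremba.exists_ensemble (Nat.le_add_left 1 _) hT₁
  obtain ⟨K, hK, N₁, hN₁⟩ := Zaremba.card_image_den_ge κ c P₀ hP₀
  refine ⟨K⁻¹, inv_pos.2 hK, max (max N₁ N₂) (κ + 2), fun N hN => ?_⟩
  obtain ⟨Ω, hΩ, hmem⟩ := hens N (by omega)
  rw [inv_mul_le_iff₀ hK]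
  refine (hN₁ N (by omega) Ω hΩ).trans ?_
  have hsub := Zaremba.image_den_subset hpos hΩ hmem (by omega)
  have hfin : (Dset A N).Finite := (Set.finite_Iic N).subset fun d hd => hd.1
  have hle := Set.ncard_le_ncard hsub hfin
  rw [Set.ncard_coe_finset] at hle
  gcongr
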